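/- arXiv:2212.12027 — 4 statements merged into one kernel-verified Lean document; each statement's English description precedes it below -/
import Mathlib

section
/- Let f : R → T be a flat ring homomorphism, M a finitely generated R-module, and 𝔞 an ideal of R with 𝔞T ≠ T. If M is 𝔞-relative Gorenstein, then T ⊗_R M is 𝔞T-relative Gorenstein. -/
open CategoryTheory TensorProduct

noncomputable section

universe u

/-- The cohomological dimension `cd(𝔞, M)`: the largest `i` (in `ℕ∞`) such that the local
cohomology module `H^i_𝔞(M)` is nonzero. -/
noncomputable def cohDim {R : Type u} [CommRing R] (a : Ideal R)
    (M : Type u) [AddCommGroup M] [Module R M] : ℕ∞ :=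
  sSup ((fun i : ℕ => (i : ℕ∞)) ''
    {i : ℕ | Nontrivial ((localCohomology a i).obj (ModuleCat.of R M))})

/-- The grade `grade(𝔞, M)`: the least `i` (in `ℕ∞`) such that `Ext^i_R(R/𝔞, M) ≠ 0`. -/
noncomputable def relGrade {R : Type u} [CommRing R] (a : Ideal R)
    (M : Type u) [AddCommGroup M] [Module R M] : ℕ∞ :=
  sInf ((fun i : ℕ => (i : ℕ∞)) ''
    {i : ℕ | Nontrivial (((Ext R (ModuleCat.{u} R) i).obj
      (Opposite.op (ModuleCat.of R (R ⧸ a)))).obj (ModuleCat.of R M))})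

/-- `M` is `𝔞`-relative Cohen-Macaulay: `M = 𝔞M`, or `M ≠ 𝔞M` and `grade(𝔞,M) = cd(𝔞,M)`. -/
def IsRelCM {R : Type u} [CommRing R] (a : Ideal R)
    (M : Type u) [AddCommGroup M] [Module R M] : Prop :=
  a • (⊤ : Submodule R M) = ⊤ ∨
    (a • (⊤ : Submodule R M) ≠ ⊤ ∧ relGrade a M = cohDim a M)

/-- `M` is `𝔞`-relative maximal Cohen-Macaulay: `grade(𝔞,M) = cd(𝔞,R)`. -/
def IsRelMCM {R : Type u} [CommRing R] (a : Ideal R)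
    (M : Type u) [AddCommGroup M] [Module R M] : Prop :=
  relGrade a M = cohDim a R

/-- `M` is `𝔞`-relative Gorenstein: `Ext^i_R(R/𝔞, M) = 0` for all `i ≠ cd(𝔞,R)`. -/
def IsRelGorenstein {R : Type u} [CommRing R] (a : Ideal R)
    (M : Type u) [AddCommGroup M] [Module R M] : Prop :=
  ∀ i : ℕ, (i : ℕ∞) ≠ cohDim a R →
    Subsingleton (((Ext R (ModuleCat.{u} R) i).obj
      (Opposite.op (ModuleCat.of R (R ⧸ a)))).obj (ModuleCat.of R M))

/-- `M` is `𝔞`-relative regular: `M = 𝔞M`, or `M ≠ 𝔞M` and `𝔞` is generated by a sequence of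
length `cd(𝔞,R)` which is both an `M`-regular sequence and an `R`-regular sequence. -/
def IsRelRegular {R : Type u} [CommRing R] (a : Ideal R)
    (M : Type u) [AddCommGroup M] [Module R M] : Prop :=
  a • (⊤ : Submodule R M) = ⊤ ∨
    (a • (⊤ : Submodule R M) ≠ ⊤ ∧ ∃ rs : List R,
      (rs.length : ℕ∞) = cohDim a R ∧ Ideal.span {x | x ∈ rs} = a ∧
      RingTheory.Sequence.IsRegular M rs ∧ RingTheory.Sequence.IsRegular R rs)

/-- A ring map (given as an algebra) `R → T` is pure if `N → T ⊗[R] N`, `n ↦ 1 ⊗ n`,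
is injective for every `R`-module `N`. -/
def IsPureAlgebra (R T : Type u) [CommRing R] [CommRing T] [Algebra R T] : Prop :=
  ∀ (N : Type u) [AddCommGroup N] [Module R N],
    Function.Injective (fun n : N => (1 : T) ⊗ₜ[R] n)

namespace S14
open Limits Opposite Abelian

variable {R : Type u} [CommRing R]

/-- yoneda complex -/
abbrev oldG (Y : ModuleCat.{u} R) : ModuleCat.{u} R ⥤ (ModuleCat.{u} R)ᵒᵖ :=
  ((linearYoneda R (ModuleCat.{u} R)).obj Y).rightOp

/-- the complex of homs out of a projective resolution, in the opposite category -/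
def oldK (X Y : ModuleCat.{u} R) : ChainComplex (ModuleCat.{u} R)ᵒᵖ ℕ :=
  ((oldG Y).mapHomologicalComplex (ComplexShape.down ℕ)).obj (projectiveResolution X).complex

abbrev OldExt (X Y : ModuleCat.{u} R) (n : ℕ) : ModuleCat.{u} R :=
  ((Ext R (ModuleCat.{u} R) n).obj (op X)).obj Y

def oldE (X Y : ModuleCat.{u} R) (n : ℕ) :
    ((oldK X Y).homology n).unop ≅ OldExt X Y n :=
  ((projectiveResolution X).isoLeftDerivedObj (oldG Y) n).unop

/-- surjection from cycles -/
def oldπ (X Y : ModuleCat.{u} R) (n : ℕ) :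
    ((oldK X Y).opcycles n).unop ⟶ OldExt X Y n :=
  ((oldK X Y).homologyι n).unop ≫ (oldE X Y n).hom

def oldι (X Y : ModuleCat.{u} R) (n : ℕ) :
    ((oldK X Y).opcycles n).unop ⟶ ModuleCat.of R ((projectiveResolution X).complex.X n ⟶ Y) :=
  ((oldK X Y).pOpcycles n).unop

lemma oldπ_surj (X Y : ModuleCat.{u} R) (n : ℕ) : Function.Surjective (oldπ X Y n) := by
  rw [← ModuleCat.epi_iff_surjective]
  unfold oldπ
  infer_instance

lemma oldι_inj (X Y : ModuleCat.{u} R) (n : ℕ) : Function.Injective (oldι X Y n) := by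
  rw [← ModuleCat.mono_iff_injective]
  exact inferInstanceAs (Mono ((oldK X Y).pOpcycles n).unop)

lemma oldι_range (X Y : ModuleCat.{u} R) (n : ℕ) (f : (projectiveResolution X).complex.X n ⟶ Y) :
    (∃ z, oldι X Y n z = f) ↔ (projectiveResolution X).complex.d (n+1) n ≫ f = 0 := by
  have h := ShortComplex.exact_of_g_is_cokernel (.mk _ _ ((oldK X Y).d_pOpcycles (n+1) n)) ((oldK X Y).opcyclesIsCokernel (n+1) n (by simp))
  have h' := h.unop
  rw [ShortComplex.moduleCat_exact_iff] at h'
  constructor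
  · rintro ⟨z, rfl⟩
    have := ShortComplex.moduleCat_zero_apply (ShortComplex.mk _ _ ((oldK X Y).d_pOpcycles (n+1) n)).unop z
    exact this
  · intro hf
    exact h' f hf

lemma oldπ_zero (X Y : ModuleCat.{u} R) (n : ℕ) (z) :
    oldπ X Y n z = 0 ↔ ∃ g : (projectiveResolution X).complex.X ((ComplexShape.down ℕ).next n) ⟶ Y,
      (projectiveResolution X).complex.d n _ ≫ g = oldι X Y n z := by
  have h := ShortComplex.exact_of_f_is_kernel (.mk _ _ ((oldK X Y).homologyι_comp_fromOpcycles n ((ComplexShape.down ℕ).next n))) ((oldK X Y).homologyIsKernel n _ rfl)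
  have h' := h.unop
  rw [ShortComplex.moduleCat_exact_iff] at h'
  have e : oldπ X Y n z = 0 ↔ ((oldK X Y).homologyι n).unop z = 0 := by
    have hi : Function.Injective (oldE X Y n).hom := by
      rw [← ModuleCat.mono_iff_injective]; infer_instance
    exact map_eq_zero_iff ((oldE X Y n).hom.hom) hi
  have key : ∀ g : (projectiveResolution X).complex.X ((ComplexShape.down ℕ).next n) ⟶ Y,
     oldι X Y n (((oldK X Y).fromOpcycles n ((ComplexShape.down ℕ).next n)).unop.hom g) = (projectiveResolution X).complex.d n _ ≫ g := by
    intro g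
    have := congrArg Quiver.Hom.unop ((oldK X Y).p_fromOpcycles n ((ComplexShape.down ℕ).next n))
    exact DFunLike.congr_fun (congrArg ModuleCat.Hom.hom this) g
  rw [e]
  constructor
  · intro hz
    obtain ⟨g, hg⟩ := h' z hz
    exact ⟨g, (key g).symm.trans (congrArg (oldι X Y n) hg)⟩
  · rintro ⟨g, hg⟩
    rw [← key] at hg
    rw [← oldι_inj _ _ _ hg]
    exact ShortComplex.moduleCat_zero_apply (ShortComplex.mk _ _ ((oldK X Y).homologyι_comp_fromOpcycles n ((ComplexShape.down ℕ).next n))).unop g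

lemma oldπ_nat {X X' : ModuleCat.{u} R} (g : X' ⟶ X) (Y : ModuleCat.{u} R) (n : ℕ) 
    (φ : ProjectiveResolution.Hom (projectiveResolution X') (projectiveResolution X) g) (z) :
    ∃ z', oldι X' Y n z' = φ.hom.f n ≫ oldι X Y n z ∧ 
    oldπ X' Y n z' = ((Ext R (ModuleCat.{u} R) n).map g.op).app Y (oldπ X Y n z) := by
  let ψ : oldK X' Y ⟶ oldK X Y := ((oldG Y).mapHomologicalComplex (ComplexShape.down ℕ)).map φ.hom
  refine ⟨(HomologicalComplex.opcyclesMap ψ n).unop z, ?_, ?_⟩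
  · have := congrArg Quiver.Hom.unop (HomologicalComplex.p_opcyclesMap ψ n)
    exact DFunLike.congr_fun (congrArg ModuleCat.Hom.hom this) z
  · have h1 := congrArg Quiver.Hom.unop (HomologicalComplex.homologyι_naturality ψ n)
    have h2 : (oldE X Y n).hom ≫ ((Ext R (ModuleCat.{u} R) n).map g.op).app Y =
       (HomologicalComplex.homologyMap ψ n).unop ≫ (oldE X' Y n).hom := congrArg Quiver.Hom.unop (ProjectiveResolution.isoLeftDerivedObj_hom_naturality g _ _ φ.hom (φ.hom_f_zero_comp_π_f_zero) (oldG Y) n)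
    have h3 : (HomologicalComplex.opcyclesMap ψ n).unop ≫ oldπ X' Y n = oldπ X Y n ≫ ((Ext R (ModuleCat.{u} R) n).map g.op).app Y := by
      unfold oldπ
      rw [Category.assoc, h2, ← Category.assoc, ← Category.assoc]
      congr 1
      exact h1.symm
    exact DFunLike.congr_fun (congrArg ModuleCat.Hom.hom h3) z

lemma extMk_zero_deg0 {X Y : ModuleCat.{u} R} (P : ProjectiveResolution X)
    (f : P.complex.X 0 ⟶ Y) (hf : P.complex.d 1 0 ≫ f = 0) :
    P.extMk f 1 rfl hf = 0 ↔ f = 0 := by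
  constructor
  · intro h
    have h2 := congrArg P.extEquivCohomologyClass h
    rw [P.extEquivCohomologyClass_extMk, P.extEquivCohomologyClass_zero, CochainComplex.HomComplex.CohomologyClass.mk_eq_zero_iff,
      CochainComplex.HomComplex.Cocycle.toSingleMk_mem_coboundaries_iff _ _ _ _ _ 1 (by simp)] at h2
    obtain ⟨g, hg⟩ := h2
    have : IsZero (P.cochainComplex.X 1) := by
      have := P.cochainComplex.isZero_of_isStrictlyLE 0 1 (by simp)
      exact this
    rw [← cancel_epi (P.cochainComplexXIso (-0) 0 rfl).hom]
    have hg0 : g = 0 := this.eq_of_src _ _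
    simp [hg0] at hg
    simpa using hg.symm
  · rintro rfl
    simp

/-- comparison relation between the two versions of Ext -/
def Rel {X Y : ModuleCat.{u} R} {n : ℕ} (x : OldExt X Y n) (e : Abelian.Ext X Y n) : Prop :=
  ∃ z, oldπ X Y n z = x ∧ ∃ hf, (projectiveResolution X).extMk (oldι X Y n z) (n+1) rfl hf = e

lemma Rel.left {X Y : ModuleCat.{u} R} {n : ℕ} (x : OldExt X Y n) : ∃ e, Rel x e := by
  obtain ⟨z, rfl⟩ := oldπ_surj X Y n x
  exact ⟨_, z, rfl, (oldι_range _ _ _ _).1 ⟨z, rfl⟩, rfl⟩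

lemma Rel.right {X Y : ModuleCat.{u} R} {n : ℕ} (e : Abelian.Ext X Y n) :
    ∃ x : OldExt X Y n, Rel x e := by
  obtain ⟨f, hf, rfl⟩ := (projectiveResolution X).extMk_surjective e (n+1) rfl
  obtain ⟨z, rfl⟩ := (oldι_range _ _ _ _).2 hf
  exact ⟨_, z, rfl, hf, rfl⟩

lemma Rel.zero_iff {X Y : ModuleCat.{u} R} {n : ℕ} {x : OldExt X Y n} {e : Abelian.Ext X Y n}
    (h : Rel x e) : x = 0 ↔ e = 0 := by
  obtain ⟨z, rfl, hf, rfl⟩ := h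
  rw [oldπ_zero]
  cases n with
  | zero => 
    rw [extMk_zero_deg0]
    have : (projectiveResolution X).complex.d 0 ((ComplexShape.down ℕ).next 0) = 0 := by
      apply HomologicalComplex.shape
      simp
    simp [this, eq_comm]
  | succ n => 
    rw [ProjectiveResolution.extMk_eq_zero_iff _ _ _ _ _ n rfl]
    rw [show (ComplexShape.down ℕ).next (n+1) = n from ComplexShape.next_eq' _ (by simp)]

lemma Rel.nat {X X' Y : ModuleCat.{u} R} {n : ℕ} {x : OldExt X Y n} {e : Abelian.Ext X Y n}
    (h : Rel x e) (g : X' ⟶ X) : 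
    Rel (((Ext R (ModuleCat.{u} R) n).map g.op).app Y x) ((Abelian.Ext.mk₀ g).comp e (zero_add _)) := by
  obtain ⟨z, rfl, hf, rfl⟩ := h
  let φ : ProjectiveResolution.Hom (projectiveResolution X') (projectiveResolution X) g :=
    { hom := ProjectiveResolution.lift g _ _
      hom_f_zero_comp_π_f_zero := ProjectiveResolution.lift_commutes_zero _ _ _ }
  obtain ⟨z', h1, h2⟩ := oldπ_nat g Y n φ z
  refine ⟨z', h2, ?_⟩
  rw [h1]
  refine ⟨_, (ProjectiveResolution.mk₀_comp_extMk _ _ _ _ φ).symm⟩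

lemma subsingleton_iff (X Y : ModuleCat.{u} R) (n : ℕ) :
    Subsingleton (OldExt X Y n) ↔ ∀ e : Abelian.Ext X Y n, e = 0 := by
  constructor
  · intro h e
    obtain ⟨x, hx⟩ := Rel.right e
    exact hx.zero_iff.1 (Subsingleton.elim _ _)
  · intro h
    refine subsingleton_of_forall_eq 0 fun x => ?_
    obtain ⟨e, hx⟩ := Rel.left x
    exact hx.zero_iff.2 (h e)

/-- transition map -/
def tr (b : Ideal R) {m n : ℕ} (h : n ≤ m) : ModuleCat.of R (R ⧸ b ^ m) ⟶ ModuleCat.of R (R ⧸ b ^ n) :=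
  ModuleCat.ofHom (Submodule.mapQ _ _ LinearMap.id (Ideal.pow_le_pow_right h))

/-- local cohomology vanishing in terms of Ext. -/
def V (b : Ideal R) (i : ℕ) (N : ModuleCat.{u} R) : Prop :=
  ∀ (n : ℕ) (e : Abelian.Ext (ModuleCat.of R (R ⧸ b ^ n)) N i), ∃ (m : ℕ) (h : n ≤ m),
    (Abelian.Ext.mk₀ (tr b h)).comp e (zero_add _) = 0

lemma localCohomology_iff (b : Ideal R) (i : ℕ) (N : ModuleCat.{u} R) :
    Subsingleton ((localCohomology b i).obj N) ↔ V b i N := by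
  let F := localCohomology.diagram (localCohomology.idealPowersDiagram b) i
  have : HasColimit F := localCohomology.hasColimitDiagram (localCohomology.idealPowersDiagram b) i
  let hc := isColimitOfPreserves ((evaluation _ _).obj N) (colimit.isColimit F)
  let c := (((evaluation _ _).obj N).mapCocone (colimit.cocone F))
  have : PreservesFilteredColimitsOfSize.{0, 0} (forget (ModuleCat.{u} R)) :=
    preservesFilteredColimitsOfSize_shrink.{0, u, 0, u} (forget (ModuleCat.{u} R))
  have : IsFiltered (ℕᵒᵖ)ᵒᵖ := inferInstance
  have : PreservesColimit (F ⋙ (evaluation _ _).obj N) (forget (ModuleCat.{u} R)) := inferInstance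
  change Subsingleton c.pt ↔ _
  constructor
  · intro h n e
    obtain ⟨x, hx⟩ := Rel.right e
    obtain ⟨k, f, g, hk⟩ := Concrete.isColimit_exists_of_rep_eq _ hc (i := op (op n)) (j := op (op n)) x (0 : OldExt _ _ _) (@Subsingleton.elim _ h _ _)
    refine ⟨k.unop.unop, f.unop.unop.down.down, ?_⟩
    refine ((hx.nat _).zero_iff).1 (Eq.trans hk (map_zero (ModuleCat.Hom.hom ((F.map g).app N))))
  · intro h
    refine subsingleton_of_forall_eq 0 fun x => ?_
    obtain ⟨⟨⟨n⟩⟩, y, rfl⟩ := Concrete.isColimit_exists_rep _ hc x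
    obtain ⟨e, he⟩ := Rel.left y
    obtain ⟨m, hm, hz⟩ := h n e
    have := ((he.nat _).zero_iff).2 hz
    let w : (op (op n) : (ℕᵒᵖ)ᵒᵖ) ⟶ op (op m) := (homOfLE hm).op.op
    rw [← c.w w]
    refine (congrArg (c.ι.app (op (op m))) this).trans ?_
    exact map_zero (ModuleCat.Hom.hom (c.ι.app (op (op m))))

end S14

namespace S14
open Limits Opposite Abelian

variable {R : Type u} [CommRing R]

/-- pullback of an Ext class along a linear map -/
def pb {X X' : Type u} [AddCommGroup X] [Module R X] [AddCommGroup X'] [Module R X']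
    {N : ModuleCat.{u} R} {i : ℕ} (p : X' →ₗ[R] X) (e : Abelian.Ext (ModuleCat.of R X) N i) :
    Abelian.Ext (ModuleCat.of R X') N i :=
  (Abelian.Ext.mk₀ (ModuleCat.ofHom p)).comp e (zero_add _)

section
variable {X X' X'' : Type u} [AddCommGroup X] [Module R X] [AddCommGroup X'] [Module R X']
    [AddCommGroup X''] [Module R X''] {N : ModuleCat.{u} R} {i : ℕ}

lemma pb_comp (p : X' →ₗ[R] X) (q : X'' →ₗ[R] X') (e : Abelian.Ext (ModuleCat.of R X) N i) :
    pb (p ∘ₗ q) e = pb q (pb p e) := by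
  simp [pb]

@[simp] lemma pb_zero (p : X' →ₗ[R] X) : pb p (0 : Abelian.Ext (ModuleCat.of R X) N i) = 0 := by
  simp [pb]

lemma pb_add (p : X' →ₗ[R] X) (e e' : Abelian.Ext (ModuleCat.of R X) N i) :
    pb p (e + e') = pb p e + pb p e' := by
  simp [pb]

lemma pb_id (e : Abelian.Ext (ModuleCat.of R X) N i) :
    pb LinearMap.id e = e := by
  simp [pb]

lemma pb_inj_zero (p : X' →ₗ[R] X) (hp : Function.Surjective p)
    (e : Abelian.Ext (ModuleCat.of R X) N 0) (h : pb p e = 0) : e = 0 := by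
  have : Epi (ModuleCat.ofHom p) := (ModuleCat.epi_iff_surjective _).2 hp
  apply Ext.precomp_mk₀_injective_of_epi N (ModuleCat.ofHom p)
  simpa [pb] using h
end

section
variable {X₁ X₂ X₃ : Type u} [AddCommGroup X₁] [Module R X₁] [AddCommGroup X₂] [Module R X₂]
    [AddCommGroup X₃] [Module R X₃]

lemma mkSE (f : X₁ →ₗ[R] X₂) (g : X₂ →ₗ[R] X₃) (hf : Function.Injective f)
    (hg : Function.Surjective g) (h : Function.Exact f g) :
    (ShortComplex.moduleCatMk f g h.linearMap_comp_eq_zero).ShortExact where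
  exact := (ShortComplex.ShortExact.moduleCat_exact_iff_function_exact _).mpr h
  mono_f := (ModuleCat.mono_iff_injective _).mpr hf
  epi_g := (ModuleCat.epi_iff_surjective _).mpr hg
end

lemma kill_step {Y Z : Type u} [AddCommGroup Y] [Module R Y] [AddCommGroup Z] [Module R Z]
    {N : ModuleCat.{u} R} {i : ℕ} (p : Z →ₗ[R] Y) (hp : Function.Surjective p)
    (e : Abelian.Ext (ModuleCat.of R Y) N (i+1)) (he : pb p e = 0) :
    ∃ f : Abelian.Ext (ModuleCat.of R (LinearMap.ker p)) N i,
    ∀ {I Z' Q : Type u} [AddCommGroup I] [Module R I] [AddCommGroup Z'] [Module R Z']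
      [AddCommGroup Q] [Module R Q] (j : I →ₗ[R] Z') (q : Z' →ₗ[R] Q)
      (_ : Function.Injective j) (_ : Function.Surjective q) (_ : Function.Exact j q)
      (t₁ : I →ₗ[R] LinearMap.ker p) (t₂ : Z' →ₗ[R] Z) (t₃ : Q →ₗ[R] Y)
      (_ : t₂ ∘ₗ j = (LinearMap.ker p).subtype ∘ₗ t₁) (_ : t₃ ∘ₗ q = p ∘ₗ t₂),
      pb t₁ f = 0 → pb t₃ e = 0 := by
  have h := mkSE (LinearMap.ker p).subtype p (LinearMap.ker p).injective_subtype hp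
    (LinearMap.exact_subtype_ker_map p)
  obtain ⟨f, hf⟩ := Ext.contravariant_sequence_exact₃ h N e he (add_comm 1 i)
  refine ⟨f, ?_⟩
  intro I Z' Q _ _ _ _ _ _ j q hj hq hjq t₁ t₂ t₃ c₁ c₂ h0
  have h' := mkSE j q hj hq hjq
  let φ : ShortComplex.moduleCatMk j q hjq.linearMap_comp_eq_zero ⟶
      ShortComplex.moduleCatMk (LinearMap.ker p).subtype p
        (LinearMap.exact_subtype_ker_map p).linearMap_comp_eq_zero :=
    { τ₁ := ModuleCat.ofHom t₁
      τ₂ := ModuleCat.ofHom t₂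
      τ₃ := ModuleCat.ofHom t₃
      comm₁₂ := ModuleCat.hom_ext c₁.symm
      comm₂₃ := ModuleCat.hom_ext c₂.symm }
  have nat := ShortComplex.ShortExact.extClass_naturality h' h φ
  have e1 : pb t₃ e = ((Ext.mk₀ φ.τ₃).comp h.extClass (zero_add 1)).comp f (add_comm 1 i) := by
    rw [← hf]
    exact (Ext.comp_assoc (Ext.mk₀ φ.τ₃) h.extClass f (zero_add 1) (add_comm 1 i) (by omega)).symm
  rw [e1, ← nat, Ext.comp_assoc _ _ _ (add_zero 1) (zero_add i) (by omega)]
  have : (Ext.mk₀ φ.τ₁).comp f (zero_add i) = 0 := h0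
  rw [this, Ext.comp_zero]
  rfl

lemma zero_of_ker {Y Z : Type u} [AddCommGroup Y] [Module R Y] [AddCommGroup Z] [Module R Z]
    {N : ModuleCat.{u} R} {i : ℕ} (p : Z →ₗ[R] Y) (hp : Function.Surjective p)
    (e : Abelian.Ext (ModuleCat.of R Y) N (i+1)) (he : pb p e = 0)
    (hK : ∀ f : Abelian.Ext (ModuleCat.of R (LinearMap.ker p)) N i, f = 0) : e = 0 := by
  obtain ⟨f, hf⟩ := kill_step p hp e he
  rw [← pb_id e]
  exact hf (LinearMap.ker p).subtype p (LinearMap.ker p).injective_subtype hp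
    (LinearMap.exact_subtype_ker_map p) LinearMap.id LinearMap.id LinearMap.id rfl rfl (hK _)

/-- each element of `s` acts nilpotently -/
def Tors (s : Finset R) (Y : Type u) [AddCommGroup Y] [Module R Y] : Prop :=
  ∀ x ∈ s, ∃ k : ℕ, ∀ y : Y, x ^ k • y = 0

lemma exists_free_surj (Y : Type u) [AddCommGroup Y] [Module R Y] [Module.Finite R Y]
    {N : ModuleCat.{u} R} {i : ℕ} (e : Abelian.Ext (ModuleCat.of R Y) N (i+1)) :
    ∃ (k : ℕ) (p : (Fin k → R) →ₗ[R] Y), Function.Surjective p ∧ pb p e = 0 := by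
  obtain ⟨k, p, hp⟩ := Module.Finite.exists_fin' R Y
  have : Projective (ModuleCat.of R (Fin k → R)) := ModuleCat.projective_of_free (Pi.basisFun R (Fin k))
  exact ⟨k, p, hp, Ext.eq_zero_of_projective _⟩

lemma efface [IsNoetherianRing R] (N : ModuleCat.{u} R) (s : Finset R) :
    ∀ (i : ℕ) (_ : s.card < i) (Y : Type u) [AddCommGroup Y] [Module R Y] [Module.Finite R Y]
      (_ : Tors s Y) (e : Abelian.Ext (ModuleCat.of R Y) N i),
      ∃ (Y' : Type u) (_ : AddCommGroup Y') (_ : Module R Y') (_ : Module.Finite R Y')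
        (_ : Tors s Y') (p : Y' →ₗ[R] Y), Function.Surjective p ∧ pb p e = 0 := by
  classical
  induction s using Finset.induction_on with
  | empty =>
    intro i hi Y _ _ _ _ e
    obtain ⟨i, rfl⟩ := Nat.exists_eq_succ_of_ne_zero (by simpa using Nat.ne_of_gt hi : i ≠ 0)
    obtain ⟨k, p, hp, h0⟩ := exists_free_surj Y e
    exact ⟨_, _, _, inferInstance, by intro x hx; simp at hx, p, hp, h0⟩
  | insert x s hx ih =>
    intro i hi Y _ _ _ hY e
    rw [Finset.card_insert_of_notMem hx] at hi
    obtain ⟨i, rfl⟩ := Nat.exists_eq_succ_of_ne_zero (by omega : i ≠ 0)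
    obtain ⟨Z, _, _, _, hZ, p, hp, he⟩ := ih (i+1) (by omega) Y
      (fun y hy => hY y (Finset.mem_insert_of_mem hy)) e
    obtain ⟨f, hf⟩ := kill_step p hp e he
    have hKT : Tors s (LinearMap.ker p) := fun y hy => by
      obtain ⟨k, hk⟩ := hZ y hy
      exact ⟨k, fun z => Subtype.ext (hk z)⟩
    obtain ⟨W, _, _, _, hW, g, hg, hgf⟩ := ih i (by omega) (LinearMap.ker p) hKT f
    obtain ⟨k, hk⟩ := hY x (Finset.mem_insert_self _ _)
    obtain ⟨l, hl⟩ : ∃ l : ℕ, ∀ w : W, x ^ k • x ^ l • w = 0 → x ^ l • w = 0 := by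
      let κ : ℕ →o Submodule R W :=
        { toFun := fun n => LinearMap.ker (LinearMap.lsmul R W (x ^ n))
          monotone' := by
            intro a b hab w hw
            obtain ⟨c, rfl⟩ := Nat.exists_eq_add_of_le hab
            simp only [LinearMap.mem_ker, LinearMap.lsmul_apply] at hw ⊢
            rw [add_comm, pow_add, mul_smul, hw, smul_zero] }
      obtain ⟨l, hl⟩ := (monotone_stabilizes_iff_noetherian (R := R) (M := W)).2 inferInstance κ
      refine ⟨l, fun w hw => ?_⟩
      have h2 := hl (k + l) (by omega)
      have : w ∈ κ (k + l) := by
        change x ^ (k + l) • w = 0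
        rw [pow_add, mul_smul, hw]
      rw [← h2] at this
      exact this
    let Z' : Submodule R (W × Z) := LinearMap.eqLocus
      ((LinearMap.ker p).subtype ∘ₗ g ∘ₗ LinearMap.fst R W Z) ((x ^ k) • LinearMap.snd R W Z)
    have memZ' : ∀ (w : W) (z : Z), (w, z) ∈ Z' ↔ (g w : Z) = x ^ k • z := fun w z => Iff.rfl
    let I : Submodule R W := LinearMap.range (LinearMap.lsmul R W (x ^ l))
    let j₀ : W →ₗ[R] Z' := LinearMap.codRestrict Z'
      (((x ^ k) • LinearMap.id).prod ((LinearMap.ker p).subtype ∘ₗ g)) (by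
        intro w
        refine (memZ' _ _).2 ?_
        simp)
    have hj₀ : ∀ w, (j₀ w : W × Z) = (x ^ k • w, (g w : Z)) := fun w => rfl
    let j : I →ₗ[R] Z' := j₀ ∘ₗ I.subtype
    have hj : Function.Injective j := by
      rw [injective_iff_map_eq_zero]
      rintro ⟨_, w, rfl⟩ hw
      have := congrArg (fun t : Z' => (t : W × Z).1) hw
      exact Subtype.ext (hl w this)
    let t₂ : Z' →ₗ[R] Z := LinearMap.snd R W Z ∘ₗ Z'.subtype
    have ht₂ : Function.Surjective t₂ := by
      intro z
      obtain ⟨w, hw⟩ := hg ⟨x ^ k • z, by simp [hk]⟩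
      exact ⟨⟨(w, z), (memZ' _ _).2 (by rw [hw])⟩, rfl⟩
    have hle : LinearMap.range j ≤ LinearMap.ker (p ∘ₗ t₂) := by
      rintro _ ⟨w, rfl⟩
      exact (g w).2
    let t₃ : (Z' ⧸ LinearMap.range j) →ₗ[R] Y := Submodule.liftQ _ (p ∘ₗ t₂) hle
    refine ⟨Z' ⧸ LinearMap.range j, inferInstance, inferInstance, inferInstance, ?_, t₃, ?_, ?_⟩
    · intro y hy
      rcases Finset.mem_insert.1 hy with rfl | hy
      · refine ⟨k + l, fun q => ?_⟩
        obtain ⟨⟨⟨w, z⟩, hwz⟩, rfl⟩ := Submodule.mkQ_surjective _ q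
        rw [memZ'] at hwz
        rw [← map_smul, Submodule.mkQ_apply, Submodule.Quotient.mk_eq_zero]
        refine ⟨⟨y ^ l • w, w, rfl⟩, ?_⟩
        apply Subtype.ext
        change (y ^ k • y ^ l • w, (g (y ^ l • w) : Z)) = (y ^ (k + l) • w, y ^ (k + l) • z)
        rw [map_smul, Submodule.coe_smul, hwz]
        simp only [pow_add, mul_smul, smul_comm (y ^ l) (y ^ k)]
      · obtain ⟨a, ha⟩ := hW y hy
        obtain ⟨b, hb⟩ := hZ y hy
        refine ⟨a + b, fun q => ?_⟩
        obtain ⟨⟨⟨w, z⟩, hwz⟩, rfl⟩ := Submodule.mkQ_surjective _ q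
        have h0 : y ^ (a + b) • (⟨(w, z), hwz⟩ : Z') = 0 := by
          apply Subtype.ext
          change (y ^ (a + b) • w, y ^ (a + b) • z) = 0
          rw [pow_add, mul_smul, mul_smul, hb, smul_comm, ha]
          simp
        rw [← map_smul, h0, map_zero]
    · intro y
      obtain ⟨z, rfl⟩ := hp y
      obtain ⟨z', rfl⟩ := ht₂ z
      exact ⟨Submodule.Quotient.mk z', rfl⟩
    · refine hf j (LinearMap.range j).mkQ hj (Submodule.mkQ_surjective _)
        (LinearMap.exact_map_mkQ_range j) (g ∘ₗ I.subtype) t₂ t₃ rfl rfl ?_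
      rw [pb_comp, hgf, pb_zero]

end S14

namespace S14
open Limits Opposite Abelian

variable {R : Type u} [CommRing R]

/-- killed by a power -/
def PT (b : Ideal R) (Y : Type u) [AddCommGroup Y] [Module R Y] : Prop :=
  ∃ n : ℕ, ∀ r ∈ b ^ n, ∀ y : Y, r • y = 0

/-- linear transition map -/
def ltr (b : Ideal R) {m n : ℕ} (h : n ≤ m) : (R ⧸ b ^ m) →ₗ[R] (R ⧸ b ^ n) :=
  Submodule.mapQ _ _ LinearMap.id (Ideal.pow_le_pow_right h)

lemma V_iff (b : Ideal R) (i : ℕ) (N : ModuleCat.{u} R) : V b i N ↔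
  ∀ (n : ℕ) (e : Abelian.Ext (ModuleCat.of R (R ⧸ b ^ n)) N i), ∃ (m : ℕ) (h : n ≤ m),
    pb (ltr b h) e = 0 := Iff.rfl

lemma ltr_comp (b : Ideal R) {m n k : ℕ} (h : n ≤ m) (h' : m ≤ k) :
    ltr b h ∘ₗ ltr b h' = ltr b (h.trans h') := by
  ext
  rfl

lemma V_of_gt [IsNoetherianRing R] (b : Ideal R) : ∃ r : ℕ, ∀ i, r < i → ∀ N : ModuleCat.{u} R, V b i N := by
  obtain ⟨s, hs⟩ := (isNoetherian_def.1 ‹_›) b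
  refine ⟨s.card, fun i hi N => ?_⟩
  rw [V_iff]
  intro n e
  have hT : Tors s (R ⧸ b ^ n) := by
    intro x hx
    refine ⟨n, fun y => ?_⟩
    obtain ⟨y, rfl⟩ := Submodule.mkQ_surjective _ y
    rw [← map_smul, Submodule.mkQ_apply, Submodule.Quotient.mk_eq_zero]
    exact Ideal.mul_mem_right _ _ (Ideal.pow_mem_pow (hs ▸ Submodule.subset_span hx) n)
  obtain ⟨Y', _, _, _, hY', p, hp, he⟩ := efface N s i hi (R ⧸ b ^ n) hT e
  have hrad : b ≤ (Module.annihilator R Y').radical := by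
    rw [← hs]
    refine Submodule.span_le.2 fun x hx => ?_
    obtain ⟨k, hk⟩ := hY' x hx
    exact ⟨k, Module.mem_annihilator.2 hk⟩
  obtain ⟨m, hm⟩ := Ideal.exists_pow_le_of_le_radical_of_fg hrad (IsNoetherian.noetherian b)
  obtain ⟨y, hy⟩ := hp (Submodule.Quotient.mk 1)
  let q : (R ⧸ b ^ (n + m)) →ₗ[R] Y' := Submodule.liftQ _ (LinearMap.toSpanSingleton R Y' y) (by
    intro r hr
    have : r ∈ b ^ m := Ideal.pow_le_pow_right (by omega) hr
    exact Module.mem_annihilator.1 (hm this) y)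
  refine ⟨n + m, by omega, ?_⟩
  have : ltr b (by omega : n ≤ n + m) = p ∘ₗ q := by
    apply Submodule.linearMap_qext
    apply LinearMap.ext_ring
    change Submodule.Quotient.mk 1 = p ((1 : R) • y)
    rw [one_smul, hy]
  rw [this, pb_comp, he, pb_zero]

section
variable {X X' : Type u} [AddCommGroup X] [Module R X] [AddCommGroup X'] [Module R X']
  {N N' : ModuleCat.{u} R} {i j k : ℕ}

lemma pb_postcomp (p : X' →ₗ[R] X) (e : Abelian.Ext (ModuleCat.of R X) N i)
    (g : Abelian.Ext N N' j) (h : i + j = k) :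
    (pb p e).comp g h = pb p (e.comp g h) := by
  unfold pb
  exact Ext.comp_assoc _ _ _ (zero_add i) h (by omega)
end

lemma V_ext (b : Ideal R) (i : ℕ) {S : ShortComplex (ModuleCat.{u} R)} (hS : S.ShortExact)
    (h₁ : V b i S.X₁) (h₃ : V b i S.X₃) : V b i S.X₂ := by
  rw [V_iff] at *
  intro n e
  obtain ⟨m, hm, h⟩ := h₃ n (e.comp (Ext.mk₀ S.g) (add_zero _))
  rw [← pb_postcomp] at h
  obtain ⟨x, hx⟩ := Ext.covariant_sequence_exact₂ _ hS _ h
  obtain ⟨m', hm', h'⟩ := h₁ m x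
  refine ⟨m', hm.trans hm', ?_⟩
  rw [← ltr_comp b hm hm', pb_comp, ← hx, ← pb_postcomp, h', Ext.zero_comp]

lemma V_third (b : Ideal R) (i : ℕ) {S : ShortComplex (ModuleCat.{u} R)} (hS : S.ShortExact)
    (h₁ : V b (i+1) S.X₁) (h₂ : V b i S.X₂) : V b i S.X₃ := by
  rw [V_iff] at *
  intro n e
  obtain ⟨m, hm, h⟩ := h₁ n (e.comp hS.extClass rfl)
  rw [← pb_postcomp] at h
  obtain ⟨x, hx⟩ := Ext.covariant_sequence_exact₃ _ hS _ _ h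
  obtain ⟨m', hm', h'⟩ := h₂ m x
  refine ⟨m', hm.trans hm', ?_⟩
  rw [← ltr_comp b hm hm', pb_comp, ← hx, ← pb_postcomp, h', Ext.zero_comp]

lemma V_subsingleton (b : Ideal R) (i : ℕ) (N : Type u) [AddCommGroup N] [Module R N]
    [Subsingleton N] : V b i (ModuleCat.of R N) := by
  rw [V_iff]
  intro n e
  refine ⟨n, le_rfl, ?_⟩
  have h1 : e = e.comp (Ext.mk₀ (𝟙 (ModuleCat.of R N))) (add_zero _) := by simp
  have h2 : 𝟙 (ModuleCat.of R N) = 0 := by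
    apply ModuleCat.hom_ext
    exact LinearMap.ext fun x => Subsingleton.elim _ _
  rw [h1, h2, Ext.mk₀_zero, Ext.comp_zero, pb_zero]

lemma V_all [IsNoetherianRing R] (b : Ideal R) (c : ℕ) (hV : ∀ j, c ≤ j → V b j (ModuleCat.of R R))
    (N : Type u) [AddCommGroup N] [Module R N] (hN : Module.Finite R N) :
    V b c (ModuleCat.of R N) := by
  obtain ⟨r, hr⟩ := V_of_gt b
  have key : ∀ d i : ℕ, c ≤ i → r < i + d → ∀ (N : Type u) [AddCommGroup N] [Module R N]
      (_ : Module.Finite R N), V b i (ModuleCat.of R N) := by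
    intro d
    induction d with
    | zero => intro i _ hi N _ _ _; exact hr i hi _
    | succ d ih =>
      intro i hci hi N _ _ hN
      refine IsNoetherianRing.induction_on_isQuotientEquivQuotientPrime R hN
        (motive := fun N _ _ _ => V b i (ModuleCat.of R N)) ?_ ?_ ?_
      · intro N _ _ _ _
        exact V_subsingleton b i N
      · intro N _ _ _ p f
        let q : R →ₗ[R] N := f.symm.toLinearMap ∘ₗ p.1.mkQ
        have hq : Function.Surjective q := f.symm.surjective.comp (Submodule.mkQ_surjective _)
        have h := mkSE (LinearMap.ker q).subtype q (LinearMap.ker q).injective_subtype hq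
          (LinearMap.exact_subtype_ker_map q)
        exact V_third b i h (ih (i+1) (by omega) (by omega) (LinearMap.ker q) inferInstance)
          (hV i hci)
      · intro N₁ _ _ _ N₂ _ _ _ N₃ _ _ _ f g hf hg hfg h₁ h₃
        exact V_ext b i (mkSE f g hf hg hfg) h₁ h₃
  exact key (r + 1) c le_rfl (by omega) N hN

lemma grade_ind [IsNoetherianRing R] (b : Ideal R) (j : ℕ) (N : ModuleCat.{u} R)
    (hE : ∀ (Y : Type u) [AddCommGroup Y] [Module R Y] (_ : Module.Finite R Y)
      (q : (R ⧸ b) →ₗ[R] Y) (_ : Function.Surjective q)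
      (e : Abelian.Ext (ModuleCat.of R Y) N j), e = 0)
    (Y : Type u) [AddCommGroup Y] [Module R Y] (hY : Module.Finite R Y) :
      PT b Y → ∀ e : Abelian.Ext (ModuleCat.of R Y) N j, e = 0 := by
  refine IsNoetherianRing.induction_on_isQuotientEquivQuotientPrime R hY
    (motive := fun Y _ _ _ => PT b Y → ∀ e : Abelian.Ext (ModuleCat.of R Y) N j, e = 0) ?_ ?_ ?_
  · intro Y _ _ _ _ _ e
    rw [← pb_id e, show (LinearMap.id : Y →ₗ[R] Y) = 0 from
      LinearMap.ext fun x => Subsingleton.elim _ _]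
    simp [pb]
  · intro Y _ _ _ p f hpt e
    obtain ⟨n, hn⟩ := hpt
    have hb : b ≤ p.1 := by
      have : b ^ n ≤ p.1 := by
        intro r hr
        have h1 := hn r hr (f.symm (Submodule.Quotient.mk 1))
        rw [← map_smul, LinearEquiv.map_eq_zero_iff, ← Submodule.Quotient.mk_smul,
          Submodule.Quotient.mk_eq_zero] at h1
        simpa using h1
      have hp := p.2
      exact fun x hx => hp.mem_of_pow_mem n (this (Ideal.pow_mem_pow hx n))
    let q : (R ⧸ b) →ₗ[R] Y := f.symm.toLinearMap ∘ₗ Submodule.mapQ b p.1 LinearMap.id hb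
    have hq : Function.Surjective q := by
      refine f.symm.surjective.comp ?_
      intro y
      obtain ⟨y, rfl⟩ := Submodule.mkQ_surjective _ y
      exact ⟨Submodule.Quotient.mk y, rfl⟩
    exact hE Y inferInstance q hq e
  · intro N₁ _ _ _ N₂ _ _ _ N₃ _ _ _ f g hf hg hfg h₁ h₃ ⟨n, hn⟩ e
    have k₁ := h₁ ⟨n, fun r hr y => hf (by rw [map_smul, hn r hr, map_zero])⟩
    have k₃ := h₃ ⟨n, fun r hr y => by
      obtain ⟨y, rfl⟩ := hg y
      rw [← map_smul, hn r hr, map_zero]⟩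
    obtain ⟨x, hx⟩ := Ext.contravariant_sequence_exact₂ (mkSE f g hf hg hfg) N e (k₁ _)
    have hx0 : x = 0 := k₃ x
    rw [← hx, hx0, Ext.comp_zero]
    rfl

lemma grade_vanish [IsNoetherianRing R] (b : Ideal R) (c : ℕ) (N : ModuleCat.{u} R)
    (hE : ∀ j < c, ∀ e : Abelian.Ext (ModuleCat.of R (R ⧸ b)) N j, e = 0) :
    ∀ j < c, ∀ (Y : Type u) [AddCommGroup Y] [Module R Y] (_ : Module.Finite R Y),
      PT b Y → ∀ e : Abelian.Ext (ModuleCat.of R Y) N j, e = 0 := by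
  intro j
  induction j with
  | zero =>
    intro hj
    exact grade_ind b 0 N fun Y _ _ _ q hq e => pb_inj_zero q hq e (hE 0 hj _)
  | succ j ih =>
    intro hj
    refine grade_ind b (j+1) N fun Y _ _ _ q hq e => zero_of_ker q hq e (hE _ hj _) ?_
    refine ih (by omega) (LinearMap.ker q) inferInstance ⟨1, fun r hr y => Subtype.ext ?_⟩
    obtain ⟨y, hy⟩ := y
    obtain ⟨y, rfl⟩ := Submodule.mkQ_surjective _ y
    change r • Submodule.mkQ b y = 0
    rw [← map_smul, Submodule.mkQ_apply, Submodule.Quotient.mk_eq_zero]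
    rw [pow_one] at hr
    exact Ideal.mul_mem_right _ _ hr

lemma main_core [IsNoetherianRing R] (b : Ideal R) (c : ℕ)
    (N : Type u) [AddCommGroup N] [Module R N] [Module.Finite R N]
    (hV : ∀ j, c + 1 ≤ j → V b j (ModuleCat.of R R))
    (hE : ∀ j < c + 1, ∀ e : Abelian.Ext (ModuleCat.of R (R ⧸ b)) (ModuleCat.of R N) j, e = 0) :
    ∀ e : Abelian.Ext (ModuleCat.of R (R ⧸ b)) (ModuleCat.of R N) (c + 1), e = 0 := by
  intro e
  have h := V_all b (c + 1) hV N inferInstance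
  rw [V_iff] at h
  let q₁ : (R ⧸ b ^ 1) →ₗ[R] (R ⧸ b) := Submodule.mapQ _ _ LinearMap.id (by rw [pow_one]; exact le_rfl)
  obtain ⟨m, hm, h0⟩ := h 1 (pb q₁ e)
  rw [← pb_comp] at h0
  refine zero_of_ker _ ?_ e h0 ?_
  · intro y
    obtain ⟨y, rfl⟩ := Submodule.mkQ_surjective _ y
    exact ⟨Submodule.Quotient.mk y, rfl⟩
  · refine grade_vanish b (c + 1) (ModuleCat.of R N) hE c (by omega) _ inferInstance
      ⟨m, fun r hr y => Subtype.ext ?_⟩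
    obtain ⟨y, hy⟩ := y
    obtain ⟨y, rfl⟩ := Submodule.mkQ_surjective _ y
    change r • Submodule.mkQ (b ^ m) y = 0
    rw [← map_smul, Submodule.mkQ_apply, Submodule.Quotient.mk_eq_zero]
    exact Ideal.mul_mem_right _ _ hr

end S14

namespace S14
open Limits Opposite Abelian

variable (R T : Type u) [CommRing R] [CommRing T] [Algebra R T]

/-- base change functor -/
def BC : ModuleCat.{u} R ⥤ ModuleCat.{u} T where
  obj X := ModuleCat.of T (T ⊗[R] X)
  map f := ModuleCat.ofHom (f.hom.baseChange T)
  map_id X := ModuleCat.hom_ext (by simp [LinearMap.baseChange_id])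
  map_comp f g := ModuleCat.hom_ext (by simp [LinearMap.baseChange_comp])

instance : (BC R T).Additive where
  map_add {_ _ f g} := ModuleCat.hom_ext (LinearMap.baseChange_add f.hom g.hom)

lemma BC_exact [Module.Flat R T] :
    PreservesFiniteLimits (BC R T) ∧ PreservesFiniteColimits (BC R T) := by
  refine ((BC R T).exact_tfae.out 1 3).1 ?_
  intro S hS
  rw [ShortComplex.ShortExact.moduleCat_exact_iff_function_exact] at hS ⊢
  exact Module.Flat.lTensor_exact T hS

instance [Module.Flat R T] : PreservesFiniteLimits (BC R T) := (BC_exact R T).1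
instance [Module.Flat R T] : PreservesFiniteColimits (BC R T) := (BC_exact R T).2

variable {R}

variable {T} in
lemma mk0_smul_mem {A B : ModuleCat.{u} T} (S : Submodule T (Abelian.Ext A B 0)) (s : T) (f : A ⟶ B)
    (h : Ext.mk₀ f ∈ S) : Ext.mk₀ (s • f) ∈ S := by
  have h2 := S.smul_mem s h
  rw [Ext.smul_eq_comp_mk₀, Ext.mk₀_comp_mk₀] at h2
  simpa using h2

variable {T} in
lemma mk0_add_mem {A B : ModuleCat.{u} T} (S : Submodule T (Abelian.Ext A B 0)) (f g : A ⟶ B)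
    (hf : Ext.mk₀ f ∈ S) (hg : Ext.mk₀ g ∈ S) : Ext.mk₀ (f + g) ∈ S := by
  rw [Ext.mk₀_add]
  exact S.add_mem hf hg

variable {T} in
lemma mk0_zero_mem {A B : ModuleCat.{u} T} (S : Submodule T (Abelian.Ext A B 0)) :
    Ext.mk₀ (0 : A ⟶ B) ∈ S := by
  rw [Ext.mk₀_zero]
  exact S.zero_mem

lemma span_ext [IsNoetherianRing R] [Module.Flat R T] (Y : ModuleCat.{u} R) (i : ℕ) :
    ∀ (X : Type u) [AddCommGroup X] [Module R X] [Module.Finite R X]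
      (e : Abelian.Ext ((BC R T).obj (ModuleCat.of R X)) ((BC R T).obj Y) i),
      e ∈ Submodule.span T (Set.range
        (Ext.mapExactFunctor (BC R T) : Abelian.Ext (ModuleCat.of R X) Y i → _)) := by
  induction i with
  | zero =>
    intro X _ _ _ e
    obtain ⟨g, rfl⟩ := (Ext.mk₀_bijective _ _).2 e
    have hX : Module.FinitePresentation R X := Module.finitePresentation_of_finite R X
    have h := Module.FinitePresentation.isBaseChange_map R X Y T
    have key : ∀ g : (T ⊗[R] X) →ₗ[T] (T ⊗[R] Y), (Ext.mk₀ (ModuleCat.ofHom g) : 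
        Abelian.Ext ((BC R T).obj (ModuleCat.of R X)) ((BC R T).obj Y) 0) ∈ Submodule.span T (Set.range
        (Ext.mapExactFunctor (BC R T) : Abelian.Ext (ModuleCat.of R X) Y 0 → _)) := by
      intro g
      refine h.inductionOn g _ ?_ ?_ ?_ ?_
      · exact mk0_zero_mem (A := (BC R T).obj (ModuleCat.of R X)) (B := (BC R T).obj Y) _
      · intro m
        refine Submodule.subset_span ⟨Ext.mk₀ (ModuleCat.ofHom m), ?_⟩
        rw [Ext.mapExactFunctor_mk₀]
        rfl
      · intro s n hn
        exact mk0_smul_mem (A := (BC R T).obj (ModuleCat.of R X)) (B := (BC R T).obj Y) _ s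
          (ModuleCat.ofHom n) hn
      · intro n₁ n₂ h₁ h₂
        exact mk0_add_mem (A := (BC R T).obj (ModuleCat.of R X)) (B := (BC R T).obj Y) _
          (ModuleCat.ofHom n₁) (ModuleCat.ofHom n₂) h₁ h₂
    exact key g.hom
  | succ i ih =>
    intro X _ _ _ e
    obtain ⟨k, p, hp⟩ := Module.Finite.exists_fin' R X
    have h := mkSE (LinearMap.ker p).subtype p (LinearMap.ker p).injective_subtype hp
      (LinearMap.exact_subtype_ker_map p)
    have hproj : Projective ((BC R T).obj (ModuleCat.of R (Fin k → R))) := by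
      have : Module.Projective T (T ⊗[R] (Fin k → R)) := inferInstance
      exact (IsProjective.iff_projective _).1 this
    have h' := h.map_of_exact (BC R T)
    obtain ⟨f, hf⟩ := Ext.contravariant_sequence_exact₃ h' _ e
      (Ext.eq_zero_of_projective (P := (BC R T).obj (ModuleCat.of R (Fin k → R))) _) (add_comm 1 i)
    have hm := ih (LinearMap.ker p) f
    rw [← hf]
    refine Submodule.span_induction (p := fun f _ => h'.extClass.comp f (add_comm 1 i) ∈ Submodule.span T (Set.range
        (Ext.mapExactFunctor (BC R T) : Abelian.Ext (ModuleCat.of R X) Y (i+1) → _))) ?_ ?_ ?_ ?_ hm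
    · rintro _ ⟨f, rfl⟩
      refine Submodule.subset_span ⟨h.extClass.comp f (add_comm 1 i), ?_⟩
      refine (Ext.mapExactFunctor_comp (BC R T) h.extClass f (add_comm 1 i)).trans ?_
      exact congrArg (fun z => Ext.comp z _ (add_comm 1 i)) (Ext.mapExactFunctor_extClass (BC R T) h)
    · erw [Ext.comp_zero]
      exact Submodule.zero_mem _
    · intro x y _ _ hx hy
      erw [Ext.comp_add]
      exact Submodule.add_mem _ hx hy
    · intro t x _ hx
      erw [Ext.comp_smul]
      exact Submodule.smul_mem _ t hx

lemma bc_vanish [IsNoetherianRing R] [Module.Flat R T] (Y : ModuleCat.{u} R) (i : ℕ)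
    (X : Type u) [AddCommGroup X] [Module R X] [Module.Finite R X]
    (h : ∀ e : Abelian.Ext (ModuleCat.of R X) Y i, e = 0) 
    (e : Abelian.Ext ((BC R T).obj (ModuleCat.of R X)) ((BC R T).obj Y) i) : e = 0 := by
  have := span_ext T Y i X e
  rw [← Submodule.mem_bot T]
  refine Submodule.span_le.2 ?_ this
  rintro _ ⟨f, rfl⟩
  rw [h f]
  simp

/-- quotient comparison -/
lemma exists_theta (I : Ideal R) (J : Ideal T) (h : J = I.map (algebraMap R T)) :
    ∃ θ : (T ⧸ J) ≃ₗ[T] T ⊗[R] (R ⧸ I), θ (Submodule.Quotient.mk 1) = 1 ⊗ₜ (Submodule.Quotient.mk 1) := by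
  subst h
  exact ⟨I.qoutMapEquivTensorQout T, rfl⟩

lemma bc_vanish_quot [IsNoetherianRing R] [Module.Flat R T] (a : Ideal R) (M : Type u)
    [AddCommGroup M] [Module R M] (i : ℕ)
    (h : ∀ e : Abelian.Ext (ModuleCat.of R (R ⧸ a)) (ModuleCat.of R M) i, e = 0)
    (e : Abelian.Ext (ModuleCat.of T (T ⧸ a.map (algebraMap R T))) (ModuleCat.of T (T ⊗[R] M)) i) :
    e = 0 := by
  obtain ⟨θ, -⟩ := exists_theta T a _ rfl
  have h1 : pb θ.symm.toLinearMap e = 0 := bc_vanish T (ModuleCat.of R M) i (R ⧸ a) h _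
  have h2 : pb θ.toLinearMap (pb θ.symm.toLinearMap e) = 0 := by rw [h1, pb_zero]
  rw [← pb_comp] at h2
  simpa [pb_id] using h2

lemma V_bc [IsNoetherianRing R] [Module.Flat R T] (a : Ideal R) (i : ℕ) (Y : ModuleCat.{u} R)
    (hV : V a i Y) : V (a.map (algebraMap R T)) i ((BC R T).obj Y) := by
  rw [V_iff] at *
  intro n e
  obtain ⟨θ, hθ⟩ := exists_theta T (a ^ n) (a.map (algebraMap R T) ^ n) (Ideal.map_pow _ _ _).symm
  have key : ∀ x : Abelian.Ext ((BC R T).obj (ModuleCat.of R (R ⧸ a ^ n))) ((BC R T).obj Y) i,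
      ∃ (m : ℕ) (h : n ≤ m), pb ((ltr a h).baseChange T) x = 0 := by
    intro x
    refine Submodule.span_induction (p := fun x _ => ∃ (m : ℕ) (h : n ≤ m), 
      pb ((ltr a h).baseChange T) x = 0) ?_ ?_ ?_ ?_ (span_ext T Y i _ x)
    · rintro _ ⟨f, rfl⟩
      obtain ⟨m, hm, h0⟩ := hV n f
      refine ⟨m, hm, ?_⟩
      have := congrArg (Ext.mapExactFunctor (BC R T)) h0
      unfold pb at this
      rw [Ext.mapExactFunctor_comp, Ext.mapExactFunctor_mk₀, Ext.mapExactFunctor_zero] at this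
      exact this
    · exact ⟨n, le_rfl, pb_zero _⟩
    · rintro x y _ _ ⟨m, hm, hx⟩ ⟨m', hm', hy⟩
      refine ⟨max m m', hm.trans (le_max_left _ _), ?_⟩
      have h1 : ltr a (hm.trans (le_max_left m m')) = ltr a hm ∘ₗ ltr a (le_max_left m m') :=
        (ltr_comp a _ _).symm
      have h2 : ltr a (hm.trans (le_max_left m m')) = ltr a hm' ∘ₗ ltr a (le_max_right m m') :=
        (ltr_comp a _ _).symm
      have e1 : pb ((ltr a (hm.trans (le_max_left m m'))).baseChange T) x = 0 := by
        rw [h1, LinearMap.baseChange_comp, pb_comp, hx, pb_zero]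
      have e2 : pb ((ltr a (hm.trans (le_max_left m m'))).baseChange T) y = 0 := by
        rw [h2, LinearMap.baseChange_comp, pb_comp, hy, pb_zero]
      refine (pb_add _ x y).trans ?_
      rw [e1, e2, add_zero]
    · rintro t x _ ⟨m, hm, hx⟩
      refine ⟨m, hm, ?_⟩
      have : pb ((ltr a hm).baseChange T) (t • x) = t • pb ((ltr a hm).baseChange T) x := 
        Ext.comp_smul _ _ _ _
      exact this.trans (by rw [hx, smul_zero])
  obtain ⟨m, hm, h0⟩ := key (pb θ.symm.toLinearMap e)
  refine ⟨m, hm, ?_⟩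
  obtain ⟨θ', hθ'⟩ := exists_theta T (a ^ m) (a.map (algebraMap R T) ^ m) (Ideal.map_pow _ _ _).symm
  have hc : ltr (a.map (algebraMap R T)) hm =
      θ.symm.toLinearMap ∘ₗ (ltr a hm).baseChange T ∘ₗ θ'.toLinearMap := by
    apply Submodule.linearMap_qext
    apply LinearMap.ext_ring
    change Submodule.Quotient.mk 1 = θ.symm ((ltr a hm).baseChange T (θ' (Submodule.Quotient.mk 1)))
    rw [hθ', LinearMap.baseChange_tmul]
    change _ = θ.symm (1 ⊗ₜ (Submodule.Quotient.mk 1))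
    rw [← hθ, LinearEquiv.symm_apply_apply]
  rw [hc, pb_comp, pb_comp, h0, pb_zero]

lemma V_bc_self [IsNoetherianRing R] [Module.Flat R T] (a : Ideal R) (i : ℕ)
    (hV : V a i (ModuleCat.of R R)) : V (a.map (algebraMap R T)) i (ModuleCat.of T T) := by
  have h := V_bc T a i _ hV
  have f := (TensorProduct.AlgebraTensorModule.rid R T T)
  have hs := mkSE (0 : PUnit.{u+1} →ₗ[T] (T ⊗[R] R)) f.toLinearMap (fun _ _ _ => rfl) f.surjective
    ((LinearMap.exact_zero_iff_injective _ _).2 f.injective)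
  exact V_third _ i hs (V_subsingleton _ _ _) h

end S14

theorem stmt14 {R T : Type u} [CommRing R] [CommRing T] [Algebra R T]
    [IsNoetherianRing R] [IsNoetherianRing T] [Module.Flat R T]
    (a : Ideal R) (hT : a.map (algebraMap R T) ≠ ⊤)
    (M : Type u) [AddCommGroup M] [Module R M] [Module.Finite R M]
    (h : IsRelGorenstein a M) :
    IsRelGorenstein (a.map (algebraMap R T)) (T ⊗[R] M) := by
  intro i hi
  have hbc : ∀ j : ℕ, (j : ℕ∞) ≠ cohDim a R →
      ∀ e : Abelian.Ext (ModuleCat.of T (T ⧸ a.map (algebraMap R T)))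
        (ModuleCat.of T (T ⊗[R] M)) j, e = 0 := fun j hj =>
    S14.bc_vanish_quot T a M j ((S14.subsingleton_iff _ _ j).1 (h j hj))
  refine (S14.subsingleton_iff _ _ i).2 ?_
  by_cases hia : (i : ℕ∞) = cohDim a R
  swap
  · exact hbc i hia
  have hVT : ∀ j : ℕ, i < j → S14.V (a.map (algebraMap R T)) j (ModuleCat.of T T) := by
    intro j hj
    refine S14.V_bc_self T a j ((S14.localCohomology_iff a j _).1 ?_)
    by_contra hn
    rw [not_subsingleton_iff_nontrivial] at hn
    have hle : (j : ℕ∞) ≤ cohDim a R := le_sSup ⟨j, hn, rfl⟩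
    rw [← hia] at hle
    exact absurd (ENat.coe_le_coe.1 hle) (not_le.2 hj)
  have hle : cohDim (a.map (algebraMap R T)) T ≤ i := by
    refine sSup_le ?_
    rintro _ ⟨j, hj, rfl⟩
    by_contra hn
    have hij : i < j := by
      rw [not_le] at hn
      exact ENat.coe_lt_coe.1 hn
    exact not_subsingleton_iff_nontrivial.2 hj ((S14.localCohomology_iff _ j _).2 (hVT j hij))
  have hlt : cohDim (a.map (algebraMap R T)) T < i := lt_of_le_of_ne hle (Ne.symm hi)
  cases i with
  | zero => exact absurd hlt (by simp)
  | succ c =>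
    refine S14.main_core (a.map (algebraMap R T)) c (T ⊗[R] M) ?_ ?_
    · intro j hj
      refine (S14.localCohomology_iff _ j _).1 ?_
      by_contra hn
      rw [not_subsingleton_iff_nontrivial] at hn
      have hle2 : (j : ℕ∞) ≤ cohDim (a.map (algebraMap R T)) T := le_sSup ⟨j, hn, rfl⟩
      exact absurd (ENat.coe_lt_coe.1 (lt_of_le_of_lt hle2 hlt)) (not_lt.2 hj)
    · intro j hj
      refine hbc j ?_
      rw [← hia]
      intro hc
      exact absurd (ENat.coe_inj.1 hc) (ne_of_lt hj)

end
end

section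
/- Let f : R → T be a flat ring homomorphism, M a finitely generated R-module, and 𝔞 an ideal of R with 𝔞T ≠ T. If M is 𝔞-relative regular, then T ⊗_R M is 𝔞T-relative regular. -/
open CategoryTheory TensorProduct

noncomputable section

universe u

namespace RelReg
open RingTheory.Sequence Pointwise

theorem wreg_ses {R : Type*} [CommRing R] (rs : List R) :
    ∀ {A B C : Type u} [AddCommGroup A] [AddCommGroup B] [AddCommGroup C]
    [Module R A] [Module R B] [Module R C] (f : A →ₗ[R] B) (g : B →ₗ[R] C),
    Function.Injective f → Function.Exact f g → Function.Surjective g →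
    IsWeaklyRegular A rs → IsWeaklyRegular C rs → IsWeaklyRegular B rs := by
  induction rs with
  | nil => intros; simp
  | cons x rs ih =>
    intro A B C _ _ _ _ _ _ f g hf hfg hg hA hC
    rw [isWeaklyRegular_cons_iff] at hA hC ⊢
    refine ⟨isSMulRegular_of_range_eq_ker hf hfg.linearMap_ker_eq.symm hA.1 hC.1, ?_⟩
    refine ih (QuotSMulTop.map x f) (QuotSMulTop.map x g) ?_ (QuotSMulTop.map_exact x hfg hg)
      (QuotSMulTop.map_surjective x hg) hA.2 hC.2
    have h0 : Function.Exact (0 : A →ₗ[R] A) f := by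
      rw [LinearMap.exact_iff, LinearMap.ker_eq_bot.mpr hf, LinearMap.range_zero]
    have := QuotSMulTop.map_first_exact_on_four_term_exact_of_isSMulRegular_last h0 hfg hC.1
    rw [map_zero, LinearMap.exact_iff, LinearMap.range_zero] at this
    exact LinearMap.ker_eq_bot.mp this

theorem wreg_punit {R : Type*} [CommRing R] (rs : List R) :
    ∀ {M : Type u} [AddCommGroup M] [Module R M] [Subsingleton M], IsWeaklyRegular M rs := by
  induction rs with
  | nil => intros; simp
  | cons x rs ih =>
    intro M _ _ _
    rw [isWeaklyRegular_cons_iff]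
    exact ⟨fun a b _ => Subsingleton.elim a b, ih⟩

theorem wreg_pow_cons {R : Type*} [CommRing R] {M : Type u} [AddCommGroup M] [Module R M]
    (x : R) (rs : List R) (h : IsWeaklyRegular M (x :: rs)) (k : ℕ) :
    IsWeaklyRegular (QuotSMulTop (x ^ k) M) rs := by
  rw [isWeaklyRegular_cons_iff] at h
  induction k with
  | zero =>
    have : Subsingleton (QuotSMulTop (x ^ 0) M) := by
      refine Submodule.Quotient.subsingleton_iff.mpr ?_; simp



    exact wreg_punit rs
  | succ k ih =>
    let f : QuotSMulTop (x ^ k) M →ₗ[R] QuotSMulTop (x ^ (k+1)) M :=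
      Submodule.mapQ _ _ (LinearMap.lsmul R M x) (by
        rintro _ ⟨y, hy, rfl⟩
        exact ⟨y, hy, by simp [pow_succ', mul_smul, smul_comm x]⟩)
    let g : QuotSMulTop (x ^ (k+1)) M →ₗ[R] QuotSMulTop x M :=
      Submodule.mapQ _ _ LinearMap.id (by
        rintro _ ⟨y, hy, rfl⟩
        exact ⟨x ^ k • y, trivial, by simp [pow_succ', mul_smul, smul_comm x]⟩)
    refine wreg_ses rs f g ?_ ?_ ?_ ih h.2
    · rw [injective_iff_map_eq_zero]
      intro a ha
      obtain ⟨m, rfl⟩ := Submodule.Quotient.mk_surjective _ a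
      have : x • m ∈ x ^ (k+1) • (⊤ : Submodule R M) := by
        rw [← Submodule.Quotient.mk_eq_zero]; exact ha
      obtain ⟨y, hy, hh⟩ := this
      rw [Submodule.Quotient.mk_eq_zero]
      refine ⟨y, hy, h.1 ?_⟩
      simpa [pow_succ', mul_smul] using hh
    · intro b
      obtain ⟨m, rfl⟩ := Submodule.Quotient.mk_surjective _ b
      constructor
      · intro hb
        have : m ∈ x • (⊤ : Submodule R M) := by
          rw [← Submodule.Quotient.mk_eq_zero]; exact hb
        obtain ⟨y, hy, rfl⟩ := this
        exact ⟨Submodule.Quotient.mk y, rfl⟩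
      · rintro ⟨a, ha⟩
        obtain ⟨y, rfl⟩ := Submodule.Quotient.mk_surjective _ a
        rw [← ha]
        change Submodule.Quotient.mk (x • y) = 0
        rw [Submodule.Quotient.mk_eq_zero]
        exact ⟨y, trivial, rfl⟩
    · intro c
      obtain ⟨m, rfl⟩ := Submodule.Quotient.mk_surjective _ c
      exact ⟨Submodule.Quotient.mk m, rfl⟩

theorem wreg_pow {R : Type*} [CommRing R] (k : ℕ) (rs : List R) :
    ∀ {M : Type u} [AddCommGroup M] [Module R M], IsWeaklyRegular M rs →
    IsWeaklyRegular M (rs.map (· ^ k)) := by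
  induction rs with
  | nil => intros; simp
  | cons x rs ih =>
    intro M _ _ h
    rw [List.map_cons, isWeaklyRegular_cons_iff]
    rw [isWeaklyRegular_cons_iff] at h
    refine ⟨h.1.pow k, wreg_pow_cons x _ ?_ k⟩
    rw [isWeaklyRegular_cons_iff]
    exact ⟨h.1, ih h.2⟩

theorem pd_quot {R : Type u} [CommRing R] (rs : List R) :
    ∀ (M : Type u) [AddCommGroup M] [Module R M] (d : ℕ)
    [HasProjectiveDimensionLT (ModuleCat.of R M) d], IsWeaklyRegular M rs →
    HasProjectiveDimensionLT
      (ModuleCat.of R (M ⧸ Ideal.ofList rs • (⊤ : Submodule R M))) (d + rs.length) := by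
  induction rs with
  | nil =>
    intro M _ _ d hd _
    rw [Ideal.ofList_nil, Submodule.bot_smul]
    exact hasProjectiveDimensionLT_of_iso
      (Submodule.quotEquivOfEqBot (⊥ : Submodule R M) rfl).symm.toModuleIso _
  | cons x rs ih =>
    intro M _ _ d hd h
    rw [isWeaklyRegular_cons_iff] at h
    have hS : ((ModuleCat.of R M).smulShortComplex x).ShortExact :=
      IsSMulRegular.smulShortComplex_shortExact (M := ModuleCat.of R M) h.1
    have : HasProjectiveDimensionLT (ModuleCat.of R (QuotSMulTop x M)) (d + 1) :=
      hS.hasProjectiveDimensionLT_X₃ d hd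
        (hasProjectiveDimensionLT_of_ge (ModuleCat.of R M) d (d+1) (Nat.le_add_right _ 1))
    have := ih (QuotSMulTop x M) (d+1) h.2
    rw [List.length_cons, show d + (rs.length + 1) = d + 1 + rs.length by omega]
    exact hasProjectiveDimensionLT_of_iso
      (Submodule.quotOfListConsSMulTopEquivQuotSMulTopInner M x rs).symm.toModuleIso _

/-- nonvanishing of Ext -/
theorem ext_nontrivial {R : Type u} [CommRing R] [IsNoetherianRing R] (I : Ideal R) (rs : List R) :
    ∀ (M : Type u) [AddCommGroup M] [Module R M] [Module.Finite R M],
    (∀ r ∈ rs, r ∈ I) → IsRegular M rs →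
    I • (⊤ : Submodule R M) ≤ Ideal.ofList rs • ⊤ →
    Nontrivial (Abelian.Ext (ModuleCat.of R (R ⧸ I)) (ModuleCat.of R M) rs.length) := by
  induction rs with
  | nil =>
    intro M _ _ _ _ hreg hI
    have := hreg.nontrivial
    obtain ⟨m, hm⟩ := exists_ne (0 : M)
    have hI' : ∀ r ∈ I, r • m = 0 := by
      intro r hr
      have := hI (Submodule.smul_mem_smul hr (Submodule.mem_top (x := m)))
      simpa using this
    let f : (R ⧸ I) →ₗ[R] M := Submodule.liftQ I (LinearMap.toSpanSingleton R M m) (by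
      intro r hr; simpa using hI' r hr)
    have hf : f (Submodule.Quotient.mk 1) = m := by
      change LinearMap.toSpanSingleton R M m 1 = m
      simp
    have hnt : Nontrivial ((R ⧸ I) →ₗ[R] M) := by
      refine ⟨f, 0, fun h => hm ?_⟩
      rw [← hf, h]; rfl
    let e : Abelian.Ext (ModuleCat.of R (R ⧸ I)) (ModuleCat.of R M) 0 ≃ ((R ⧸ I) →ₗ[R] M) :=
      (Abelian.Ext.addEquiv₀.trans ModuleCat.homAddEquiv).toEquiv
    exact e.nontrivial
  | cons x rs ih =>
    intro M _ _ _ hmem hreg hI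
    have hreg' := hreg
    rw [isRegular_cons_iff] at hreg
    have hS : ((ModuleCat.of R M).smulShortComplex x).ShortExact :=
      IsSMulRegular.smulShortComplex_shortExact (M := ModuleCat.of R M) hreg.1
    have hlt : I • (⊤ : Submodule R M) < ⊤ := lt_of_le_of_lt hI hreg'.2.symm.lt_top
    have hsupp : Module.support R (ModuleCat.of R (R ⧸ I)) ⊆ PrimeSpectrum.zeroLocus I := by
      change Module.support R (R ⧸ I) ⊆ _
      rw [Module.support_eq_zeroLocus, Ideal.annihilator_quotient]
    have hz := ModuleCat.subsingleton_ext_of_exists_isRegular I (ModuleCat.of R (R ⧸ I)) hsupp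
      (ModuleCat.of R M) hlt (x :: rs) hmem hreg' rs.length (by simp)
    have hn := ih (QuotSMulTop x M) (fun r hr => hmem r (by simp [hr])) hreg.2 (by
      have h1 := Submodule.map_mono (f := Submodule.mkQ (x • (⊤ : Submodule R M))) hI
      rw [Submodule.map_smul'', Submodule.map_smul'', Ideal.ofList_cons, Submodule.sup_smul] at h1
      simp only [Submodule.map_top, Submodule.range_mkQ] at h1
      refine h1.trans (sup_le ?_ le_rfl)
      rw [Submodule.ideal_span_singleton_smul]
      rintro _ ⟨y, -, rfl⟩
      obtain ⟨m, rfl⟩ := Submodule.Quotient.mk_surjective _ y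
      have : (DistribSMul.toLinearMap R (QuotSMulTop x M) x) (Submodule.Quotient.mk m) = 0 := by
        change Submodule.Quotient.mk (x • m) = 0
        rw [Submodule.Quotient.mk_eq_zero]
        exact ⟨m, trivial, rfl⟩
      exact this ▸ Submodule.zero_mem _)
    obtain ⟨e, he⟩ := @exists_ne _ hn 0
    refine ⟨e.comp hS.extClass rfl, 0, fun h0 => he ?_⟩
    obtain ⟨y, rfl⟩ := Abelian.Ext.covariant_sequence_exact₃ _ hS e rfl h0
    rw [hz.elim y 0]
    exact Abelian.Ext.zero_comp ..

end RelReg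

namespace RelReg
open Limits Opposite

section Bridge
variable {R : Type u} [CommRing R]

/-- the cochain map induced by a chain map -/
noncomputable def yonMap {P Q : ChainComplex (ModuleCat.{u} R) ℕ} (φ : Q ⟶ P) (Y : ModuleCat.{u} R) :
    P.linearYonedaObj R Y ⟶ Q.linearYonedaObj R Y :=
  (HomologicalComplex.unopFunctor _ _).map
    ((((linearYoneda R (ModuleCat.{u} R)).obj Y).rightOp.mapHomologicalComplex _).map φ).op

theorem yonMap_f {P Q : ChainComplex (ModuleCat.{u} R) ℕ} (φ : Q ⟶ P) (Y : ModuleCat.{u} R) (n : ℕ)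
    (z : P.X n ⟶ Y) : ((yonMap φ Y).f n).hom z = φ.f n ≫ z := rfl

theorem yon_d (P : ChainComplex (ModuleCat.{u} R) ℕ) (Y : ModuleCat.{u} R) (i j : ℕ)
    (z : P.X i ⟶ Y) : ((P.linearYonedaObj R Y).d i j).hom z = P.d j i ≫ z := rfl

theorem epi_aux {C : Type*} [Category C] {A B A' B' : C} (f : A ⟶ B) (i : B ≅ B') (j : A ≅ A')
    (f' : A' ⟶ B') [Epi f'] (h : f ≫ i.hom = j.hom ≫ f') : Epi f := by
  rw [← Iso.eq_comp_inv] at h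
  rw [h]
  infer_instance

theorem old_map_eq {X X' : ModuleCat.{u} R} (g : X' ⟶ X) (Y : ModuleCat.{u} R) (n : ℕ)
    (P : ProjectiveResolution X) (Q : ProjectiveResolution X')
    (φ : ProjectiveResolution.Hom Q P g)
    (hm : Mono (HomologicalComplex.homologyMap (yonMap φ.hom Y) n)) :
    Mono ((((_root_.Ext R (ModuleCat.{u} R) n).map g.op).app Y)) := by
  let F := ((linearYoneda R (ModuleCat.{u} R)).obj Y).rightOp
  change Mono ((F.leftDerived n).map g).unop
  have h1 := ProjectiveResolution.isoLeftDerivedObj_hom_naturality g Q P φ.hom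
    (by simpa using φ.hom_f_zero_comp_π_f_zero) F n
  have h2 := HomologicalComplex.homologyOp_hom_naturality (yonMap φ.hom Y) n
  have h3 : Epi ((F.mapHomologicalComplex _ ⋙ HomologicalComplex.homologyFunctor _ _ n).map φ.hom) := by
    have : Epi (HomologicalComplex.homologyMap
      ((HomologicalComplex.opFunctor _ _).map (yonMap φ.hom Y).op) n) := by
      exact epi_aux _ (HomologicalComplex.homologyOp _ n) (HomologicalComplex.homologyOp _ n) _ h2
    exact this
  have h4 : Epi ((F.leftDerived n).map g) := by
    rw [← Iso.eq_comp_inv] at h1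
    rw [h1]
    infer_instance
  infer_instance

theorem homologyMap_mono {K L : CochainComplex (ModuleCat.{u} R) ℕ} (ψ : K ⟶ L) (n : ℕ)
    (h : ∀ z : K.X n, (K.d n (n+1)).hom z = 0 →
      (∃ y, (L.d ((ComplexShape.up ℕ).prev n) n).hom y = (ψ.f n).hom z) →
      ∃ w, (K.d ((ComplexShape.up ℕ).prev n) n).hom w = z) :
    Mono (HomologicalComplex.homologyMap ψ n) := by
  rw [ModuleCat.mono_iff_injective, injective_iff_map_eq_zero]
  intro a ha
  obtain ⟨c, rfl⟩ := (ModuleCat.epi_iff_surjective (K.homologyπ n)).mp inferInstance a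
  have e1 : (L.homologyπ n).hom ((HomologicalComplex.cyclesMap ψ n).hom c) = 0 := by
    have := HomologicalComplex.homologyπ_naturality ψ n
    have := congrArg (fun t => t.hom c) this
    simp only [ModuleCat.hom_comp, LinearMap.comp_apply] at this
    rw [← this]; exact ha
  have ex (K : CochainComplex (ModuleCat.{u} R) ℕ) : ∀ c, (K.homologyπ n).hom c = 0 →
      ∃ y, (K.toCycles ((ComplexShape.up ℕ).prev n) n).hom y = c := by
    have := ShortComplex.exact_of_g_is_cokernel
      (ShortComplex.mk _ _ (K.toCycles_comp_homologyπ ((ComplexShape.up ℕ).prev n) n))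
      (K.homologyIsCokernel _ n rfl)
    rw [ShortComplex.moduleCat_exact_iff] at this
    exact this
  obtain ⟨y, hy⟩ := ex L _ e1
  have hi (K : CochainComplex (ModuleCat.{u} R) ℕ) : Function.Injective (K.iCycles n).hom :=
    (ModuleCat.mono_iff_injective (K.iCycles n)).mp inferInstance
  obtain ⟨w, hw⟩ := h ((K.iCycles n).hom c) (by
      have := congrArg (fun t => t.hom c) (K.iCycles_d n (n+1))
      exact this) ⟨y, by
      have h1 := congrArg (fun t => t.hom y) (L.toCycles_i ((ComplexShape.up ℕ).prev n) n)
      have h2 := congrArg (fun t => t.hom c) (HomologicalComplex.cyclesMap_i ψ n)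
      simp only [ModuleCat.hom_comp, LinearMap.comp_apply] at h1 h2
      rw [← h1, hy, h2]⟩
  have hc : (K.toCycles ((ComplexShape.up ℕ).prev n) n).hom w = c := by
    apply hi K
    have h1 := congrArg (fun t => t.hom w) (K.toCycles_i ((ComplexShape.up ℕ).prev n) n)
    simp only [ModuleCat.hom_comp, LinearMap.comp_apply] at h1
    rw [h1, hw]
  have h1 := congrArg (fun t => t.hom w) (K.toCycles_comp_homologyπ ((ComplexShape.up ℕ).prev n) n)
  simp only [ModuleCat.hom_comp, LinearMap.comp_apply] at h1
  rw [hc] at h1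
  exact h1

theorem isZero_homology_iff (K : CochainComplex (ModuleCat.{u} R) ℕ) (n : ℕ) :
    IsZero (K.homology n) ↔ ∀ z : K.X n, (K.d n (n+1)).hom z = 0 →
      ∃ w, (K.d ((ComplexShape.up ℕ).prev n) n).hom w = z := by
  rw [← HomologicalComplex.exactAt_iff_isZero_homology,
    K.exactAt_iff' _ n (n+1) rfl (by simp), ShortComplex.moduleCat_exact_iff]
  rfl

theorem extMk_zero_iff {X : ModuleCat.{u} R} (Y : ModuleCat.{u} R) (n : ℕ)
    (P : ProjectiveResolution X) (f : P.complex.X n ⟶ Y) (hf : P.complex.d (n+1) n ≫ f = 0) :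
    P.extMk f (n+1) rfl hf = 0 ↔
      ∃ w, ((P.complex.linearYonedaObj R Y).d ((ComplexShape.up ℕ).prev n) n).hom w = f := by
  cases n with
  | succ n =>
    rw [P.extMk_eq_zero_iff f _ _ hf n rfl]
    rw [show (ComplexShape.up ℕ).prev (n+1) = n from by simp]
    rfl
  | zero =>
    have h0 : (∃ w, ((P.complex.linearYonedaObj R Y).d ((ComplexShape.up ℕ).prev 0) 0).hom w = f)
        ↔ f = 0 := by
      rw [HomologicalComplex.shape _ _ _ (by simp)]
      refine ⟨?_, fun h => ⟨0, by rw [h]; rfl⟩⟩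
      rintro ⟨w, rfl⟩
      rfl
    rw [h0]
    refine ⟨fun h => ?_, fun h => by subst h; simp⟩
    rw [← P.extEquivCohomologyClass.apply_eq_iff_eq,
      ProjectiveResolution.extEquivCohomologyClass_extMk,
      ProjectiveResolution.extEquivCohomologyClass_zero,
      CochainComplex.HomComplex.CohomologyClass.mk_eq_zero_iff,
      CochainComplex.HomComplex.Cocycle.toSingleMk_mem_coboundaries_iff _ _ _ _ _ 1 (by simp)] at h
    obtain ⟨g, hg⟩ := h
    have hz : P.cochainComplex.d (-(0:ℕ)) 1 = 0 := by
      apply IsZero.eq_of_tgt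
      exact P.cochainComplex.isZero_of_isStrictlyLE 0 1 (by simp)
    rw [hz, zero_comp] at hg
    rw [← cancel_epi (P.cochainComplexXIso (-(0:ℕ)) 0 rfl).hom, comp_zero, hg]

theorem isZero_old_of_subsingleton {X Y : ModuleCat.{u} R} (n : ℕ)
    (h : Subsingleton (Abelian.Ext X Y n)) :
    IsZero (((_root_.Ext R (ModuleCat.{u} R) n).obj (op X)).obj Y) := by
  let P := projectiveResolution X
  refine IsZero.of_iso ?_ (P.isoExt n Y)
  rw [isZero_homology_iff]
  intro z hz
  exact (extMk_zero_iff Y n P z hz).mp (Subsingleton.elim _ _)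

theorem not_isZero_old_of_nontrivial {X Y : ModuleCat.{u} R} (n : ℕ)
    (h : Nontrivial (Abelian.Ext X Y n)) :
    ¬ IsZero (((_root_.Ext R (ModuleCat.{u} R) n).obj (op X)).obj Y) := by
  let P := projectiveResolution X
  intro h0
  have h1 := h0.of_iso (P.isoExt n Y).symm
  rw [isZero_homology_iff] at h1
  obtain ⟨e, he⟩ := exists_ne (0 : Abelian.Ext X Y n)
  obtain ⟨f, hf, rfl⟩ := P.extMk_surjective e (n+1) rfl
  exact he ((extMk_zero_iff Y n P f hf).mpr (h1 f hf))

theorem mono_old_of_injective {X X' : ModuleCat.{u} R} (g : X' ⟶ X) (Y : ModuleCat.{u} R) (n : ℕ)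
    (h : ∀ e : Abelian.Ext X Y n, (Abelian.Ext.mk₀ g).comp e (zero_add n) = 0 → e = 0) :
    Mono ((((_root_.Ext R (ModuleCat.{u} R) n).map g.op).app Y)) := by
  let P := projectiveResolution X
  let Q := projectiveResolution X'
  let φ : ProjectiveResolution.Hom Q P g :=
    ⟨ProjectiveResolution.lift g Q P, by
      rw [← HomologicalComplex.comp_f, ProjectiveResolution.lift_commutes]; rfl⟩
  refine old_map_eq g Y n P Q φ (homologyMap_mono _ n ?_)
  intro z hz hy
  refine (extMk_zero_iff Y n P z hz).mp (h _ ?_)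
  rw [ProjectiveResolution.mk₀_comp_extMk z _ _ hz φ]
  exact (extMk_zero_iff Y n Q _ _).mpr hy

end Bridge
end RelReg

namespace RelReg
open Limits Opposite RingTheory.Sequence Pointwise

/-- a common way to say that the sequence generates the ideal -/
theorem lc_isZero {R : Type u} [CommRing R] [IsNoetherianRing R] (rs : List R)
    (h : IsWeaklyRegular R rs) (i : ℕ) (hi : rs.length < i) :
    IsZero (localCohomology (Ideal.ofList rs) i) := by
  have key : ∀ t : ℕ, ∃ s : ℕ, ∃ hts : t ≤ s,
      (localCohomology.diagram (localCohomology.idealPowersDiagram (Ideal.ofList rs)) i).map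
        (homOfLE hts).op.op = 0 := by
    intro t
    let J : Ideal R := Ideal.ofList (rs.map (· ^ t))
    have hJt : J ≤ Ideal.ofList rs ^ t := by
      refine Ideal.span_le.mpr ?_
      intro y hy
      obtain ⟨x, hx, rfl⟩ := List.mem_map.mp hy
      have hx' : x ∈ Ideal.ofList rs := Ideal.subset_span (s := {y | y ∈ rs}) hx
      exact Ideal.pow_mem_pow hx' t
    have hrad : Ideal.ofList rs ≤ J.radical := by
      refine Ideal.span_le.mpr ?_
      intro x hx
      have hx' : x ^ t ∈ J :=
        Ideal.subset_span (s := {y | y ∈ rs.map (· ^ t)}) (List.mem_map.mpr ⟨x, hx, rfl⟩)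
      exact ⟨t, hx'⟩
    obtain ⟨s, hs⟩ := Ideal.exists_pow_le_of_le_radical_of_fg hrad (IsNoetherian.noetherian _)
    have hs' : Ideal.ofList rs ^ (max s t) ≤ J := (Ideal.pow_le_pow_right (le_max_left s t)).trans hs
    refine ⟨max s t, le_max_right s t, ?_⟩
    have hpd := pd_quot (rs.map (· ^ t)) R 1 (wreg_pow t rs h)
    have hJ : Ideal.ofList (rs.map (· ^ t)) • (⊤ : Submodule R R) = J := by
      rw [smul_eq_mul, Ideal.mul_top]
    rw [hJ, List.length_map] at hpd
    have hz : IsZero ((_root_.Ext R (ModuleCat.{u} R) i).obj (op (ModuleCat.of R (R ⧸ J)))) := by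
      rw [Functor.isZero_iff]
      intro Y
      exact isZero_old_of_subsingleton i
        (HasProjectiveDimensionLT.subsingleton (ModuleCat.of R (R ⧸ J)) (1 + rs.length) i (by omega) Y)
    let a1 : ModuleCat.of R (R ⧸ Ideal.ofList rs ^ (max s t)) ⟶ ModuleCat.of R (R ⧸ J) :=
      ModuleCat.ofHom (Submodule.mapQ _ _ LinearMap.id hs')
    let a2 : ModuleCat.of R (R ⧸ J) ⟶ ModuleCat.of R (R ⧸ Ideal.ofList rs ^ t) :=
      ModuleCat.ofHom (Submodule.mapQ _ _ LinearMap.id hJt)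
    have hfac : (localCohomology.ringModIdeals
        (localCohomology.idealPowersDiagram (Ideal.ofList rs))).map (homOfLE (le_max_right s t)).op
        = a1 ≫ a2 := by
      refine ModuleCat.hom_ext (LinearMap.ext fun x => ?_)
      obtain ⟨m, rfl⟩ := Submodule.Quotient.mk_surjective (Ideal.ofList rs ^ (max s t)) x
      rfl
    have hzero : (_root_.Ext R (ModuleCat.{u} R) i).map (a1 ≫ a2).op = 0 := by
      rw [op_comp, Functor.map_comp, hz.eq_zero_of_src ((_root_.Ext R _ i).map a1.op), comp_zero]
    change (_root_.Ext R (ModuleCat.{u} R) i).map ((localCohomology.ringModIdeals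
        (localCohomology.idealPowersDiagram (Ideal.ofList rs))).map
          (homOfLE (le_max_right s t)).op).op = 0
    exact (congrArg (fun g => (_root_.Ext R (ModuleCat.{u} R) i).map (Quiver.Hom.op g)) hfac).trans hzero
  rw [IsZero.iff_id_eq_zero]
  change 𝟙 (colimit (localCohomology.diagram
    (localCohomology.idealPowersDiagram (Ideal.ofList rs)) i)) = 0
  apply colimit.hom_ext
  intro j
  obtain ⟨s, hts, hs⟩ := key j.unop.unop
  rw [comp_zero, Category.comp_id]
  have := colimit.w (localCohomology.diagram
    (localCohomology.idealPowersDiagram (Ideal.ofList rs)) i) (homOfLE hts).op.op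
  exact this.symm.trans (by rw [hs, zero_comp])

theorem lc_nontrivial {R : Type u} [CommRing R] [IsNoetherianRing R] (rs : List R)
    (h : IsRegular R rs) :
    Nontrivial ((localCohomology (Ideal.ofList rs) rs.length).obj (ModuleCat.of R R)) := by
  set I := Ideal.ofList rs with hIdef
  set n := rs.length with hn
  have hmem : ∀ r ∈ rs, r ∈ I := fun r hr => Ideal.subset_span hr
  have hlt : I • (⊤ : Submodule R R) < ⊤ := h.2.symm.lt_top
  have hne := ext_nontrivial I rs R hmem h le_rfl
  let D := localCohomology.diagram (localCohomology.idealPowersDiagram I) n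
  let E := D ⋙ (evaluation _ _).obj (ModuleCat.of R R)
  have hmono : ∀ (s : ℕ) (hs : 1 ≤ s), Mono (E.map (homOfLE hs).op.op) := by
    intro s hs
    let g : (R ⧸ I ^ s) →ₗ[R] (R ⧸ I ^ 1) :=
      Submodule.mapQ _ _ LinearMap.id (Ideal.pow_le_pow_right hs)
    have hg : Function.Surjective g := by
      intro y
      obtain ⟨m, rfl⟩ := Submodule.Quotient.mk_surjective _ y
      exact ⟨Submodule.Quotient.mk m, rfl⟩
    change Mono (((_root_.Ext R (ModuleCat.{u} R) n).map (ModuleCat.ofHom g).op).app _)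
    apply mono_old_of_injective
    have hS := LinearMap.shortExact_shortComplexKer hg
    clear_value n
    cases n with
    | zero =>
      intro e he
      have : Epi (ModuleCat.ofHom g) := (ModuleCat.epi_iff_surjective _).mpr hg
      have hinj := Abelian.Ext.precomp_mk₀_injective_of_epi (ModuleCat.of R R) (ModuleCat.ofHom g)
      exact hinj (he.trans (map_zero _).symm)
    | succ n =>
      intro e he
      obtain ⟨x, rfl⟩ := Abelian.Ext.contravariant_sequence_exact₃ hS _ e he (n₀ := n) (by omega)
      have hsupp : Module.support R (ModuleCat.of R (LinearMap.ker g)) ⊆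
          PrimeSpectrum.zeroLocus I := by
        change Module.support R (LinearMap.ker g) ⊆ _
        rw [Module.support_eq_zeroLocus, PrimeSpectrum.zeroLocus_subset_zeroLocus_iff]
        intro r hr
        refine ⟨s, Module.mem_annihilator.mpr ?_⟩
        rintro ⟨y, hy⟩
        obtain ⟨m, rfl⟩ := Submodule.Quotient.mk_surjective _ y
        apply Subtype.ext
        change Submodule.Quotient.mk (r ^ s • m) = 0
        rw [Submodule.Quotient.mk_eq_zero]
        exact Ideal.mul_mem_right _ _ (Ideal.pow_mem_pow hr s)
      have hz := ModuleCat.subsingleton_ext_of_exists_isRegular I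
        (ModuleCat.of R (LinearMap.ker g)) hsupp
        (ModuleCat.of R R) hlt rs hmem h n (by omega)
      rw [hz.elim x 0]
      exact Abelian.Ext.comp_zero ..
  have hnz : Nontrivial (E.obj (op (op 1))) := by
    have h1 : ¬ IsZero (((_root_.Ext R (ModuleCat.{u} R) n).obj
        (op (ModuleCat.of R (R ⧸ I ^ 1)))).obj (ModuleCat.of R R)) := by
      rw [pow_one]
      exact not_isZero_old_of_nontrivial n hne
    rw [ModuleCat.isZero_iff_subsingleton, not_subsingleton_iff_nontrivial] at h1
    exact h1
  let c : Cocone E := ((evaluation _ _).obj (ModuleCat.of R R)).mapCocone (colimit.cocone D)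
  have hc : IsColimit c := isColimitOfPreserves _ (colimit.isColimit D)
  obtain ⟨e, he⟩ := exists_ne (0 : E.obj (op (op 1)))
  change Nontrivial c.pt
  refine ⟨(c.ι.app (op (op 1))).hom e, 0, fun h0 => he ?_⟩
  have h0' : (c.ι.app (op (op 1))) e = (c.ι.app (op (op 1))) 0 := h0.trans (map_zero _).symm
  have hfilt : IsFiltered ℕᵒᵖᵒᵖ := inferInstance
  have hpres : PreservesFilteredColimitsOfSize.{0, 0} (forget (ModuleCat.{u} R)) :=
    preservesSmallestFilteredColimits_of_preservesFilteredColimits _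
  have hpc : PreservesColimit E (forget (ModuleCat.{u} R)) := inferInstance
  obtain ⟨k, f, f', hff⟩ := Concrete.isColimit_exists_of_rep_eq E hc _ _ h0'
  obtain rfl : f = f' := Subsingleton.elim _ _
  have : Mono (E.map f) := hmono k.unop.unop f.unop.unop.le
  exact (ModuleCat.mono_iff_injective _).mp this hff

theorem cohDim_eq {R : Type u} [CommRing R] [IsNoetherianRing R] (rs : List R)
    (h : IsRegular R rs) : cohDim (Ideal.ofList rs) R = rs.length := by
  apply le_antisymm
  · refine sSup_le ?_
    rintro _ ⟨i, hi, rfl⟩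
    by_contra hlt
    have hlt' : rs.length < i := by
      simpa using hlt
    have hz := (Functor.isZero_iff _).mp (lc_isZero rs h.1 i hlt') (ModuleCat.of R R)
    rw [ModuleCat.isZero_iff_subsingleton] at hz
    exact not_subsingleton_iff_nontrivial.mpr hi hz
  · exact le_sSup ⟨rs.length, lc_nontrivial rs h, rfl⟩

end RelReg

theorem stmt15 {R T : Type u} [CommRing R] [CommRing T] [Algebra R T]
    [IsNoetherianRing R] [IsNoetherianRing T] [Module.Flat R T]
    (a : Ideal R) (hT : a.map (algebraMap R T) ≠ ⊤)
    (M : Type u) [AddCommGroup M] [Module R M] [Module.Finite R M]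
    (h : IsRelRegular a M) :
    IsRelRegular (a.map (algebraMap R T)) (T ⊗[R] M) := by
  by_cases htop : a.map (algebraMap R T) • (⊤ : Submodule T (T ⊗[R] M)) = ⊤
  · exact Or.inl htop
  refine Or.inr ⟨htop, ?_⟩
  rcases h with h | ⟨-, rs, -, hspan, hM, hR⟩
  · exfalso
    apply htop
    rw [eq_top_iff]
    rintro x -
    induction x using TensorProduct.induction_on with
    | zero => exact Submodule.zero_mem _
    | add x y hx hy => exact Submodule.add_mem _ hx hy
    | tmul t m =>
      have hm : m ∈ a • (⊤ : Submodule R M) := by rw [h]; exact Submodule.mem_top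
      induction hm using Submodule.smul_induction_on' with
      | smul r hr n hn =>
        rw [TensorProduct.tmul_smul, ← algebraMap_smul T r (t ⊗ₜ[R] n)]
        exact Submodule.smul_mem_smul (Ideal.mem_map_of_mem _ hr) Submodule.mem_top
      | add x hx y hy h1 h2 =>
        rw [TensorProduct.tmul_add]
        exact Submodule.add_mem _ h1 h2
  · have ha : Ideal.ofList (rs.map (algebraMap R T)) = a.map (algebraMap R T) := by
      rw [← Ideal.map_ofList, ← hspan]
    have hTreg : RingTheory.Sequence.IsRegular T (rs.map (algebraMap R T)) := by
      refine ⟨hR.1.of_flat, ?_⟩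
      rw [ha, smul_eq_mul, Ideal.mul_top]
      exact hT.symm
    refine ⟨rs.map (algebraMap R T), ?_, ha, ⟨?_, ?_⟩, hTreg⟩
    · rw [← ha, RelReg.cohDim_eq _ hTreg]
    · exact hM.1.of_flat_of_isBaseChange (TensorProduct.isBaseChange R M T)
    · rw [ha]
      exact fun h => htop h.symm

end
end

section
/- Let f : R → T be a faithfully flat ring homomorphism, 𝔞 a proper ideal of R, and M a finitely generated R-module. Then M is 𝔞-relative Cohen-Macaulay if and only if T ⊗_R M is 𝔞T-relative Cohen-Macaulay; similarly for 𝔞-relative maximal Cohen-Macaulay and 𝔞-relative Gorenstein. -/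
open CategoryTheory TensorProduct

noncomputable section

universe u

open CategoryTheory TensorProduct Limits

namespace RelCMAux

/-- Vanishing of a homology map in the opposite of a module category, elementwise. -/
lemma homologyMap_op_eq_zero_iff {R : Type u} [CommRing R]
    {K L : ChainComplex (ModuleCat.{u} R)ᵒᵖ ℕ} (ψ : K ⟶ L) (i n j : ℕ)
    (hi : (ComplexShape.down ℕ).prev n = i) (hj : (ComplexShape.down ℕ).next n = j) :
    HomologicalComplex.homologyMap ψ n = 0 ↔
      ∀ z : (L.X n).unop, (L.d i n).unop z = 0 →
        ∃ w : (K.X j).unop, (K.d n j).unop w = (ψ.f n).unop z := by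
  have h1 : (ShortComplex.mk (K.iCycles n) (K.d n j) (by simp)).Exact :=
    ShortComplex.exact_of_f_is_kernel _ (K.cyclesIsKernel n j hj)
  have h2 : (ShortComplex.mk (L.d i n) (L.pOpcycles n) (by simp)).Exact :=
    ShortComplex.exact_of_g_is_cokernel _ (L.opcyclesIsCokernel i n hi)
  have h1' := (ShortComplex.moduleCat_exact_iff _).1 h1.unop
  have h2' := (ShortComplex.moduleCat_exact_iff _).1 h2.unop
  have z1 : (K.d n j).unop ≫ (K.iCycles n).unop = 0 := by
    rw [← unop_comp]; simp
  have z2 : (L.pOpcycles n).unop ≫ (L.d i n).unop = 0 := by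
    rw [← unop_comp]; simp
  have key : HomologicalComplex.homologyMap ψ n = 0 ↔
      K.iCycles n ≫ ψ.f n ≫ L.pOpcycles n = 0 := by
    rw [← cancel_mono (L.homologyι n), ← cancel_epi (K.homologyπ n)]
    simp
  have key2 : K.iCycles n ≫ ψ.f n ≫ L.pOpcycles n = 0 ↔
      (L.pOpcycles n).unop ≫ (ψ.f n).unop ≫ (K.iCycles n).unop = 0 := by
    constructor
    · intro h
      have := congrArg Quiver.Hom.unop h
      simpa using this
    · intro h
      apply Quiver.Hom.unop_inj
      simpa using h
  rw [key, key2]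
  constructor
  · intro h z hz
    obtain ⟨y, hy⟩ := h2' z hz
    apply h1'
    have := ConcreteCategory.congr_hom h y
    dsimp at hy this ⊢
    rw [← hy]
    exact this
  · intro h
    ext y
    obtain ⟨w, hw⟩ := h ((L.pOpcycles n).unop y) (by
      have := ConcreteCategory.congr_hom z2 y
      simpa using this)
    have := ConcreteCategory.congr_hom z1 w
    simp only [ModuleCat.hom_comp, LinearMap.comp_apply] at this ⊢
    rw [← hw, this]
    rfl

lemma zero_iff_of_iso {C : Type*} [Category* C] [Preadditive C] {A B A' B' : C}
    (e : A ≅ B) (e' : A' ≅ B') (p : A ⟶ A') (q : B ⟶ B') (h : p ≫ e'.hom = e.hom ≫ q) :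
    p = 0 ↔ q = 0 := by
  rw [← cancel_mono e'.hom, h, zero_comp]
  constructor
  · intro h
    rw [← cancel_epi e.hom, h, comp_zero]
  · intro h
    rw [h, comp_zero]

/-- `Ext^n(f, M) = 0`. -/
def ExtZero {R : Type u} [CommRing R] {X Y : ModuleCat.{u} R} (f : X ⟶ Y) (n : ℕ)
    (M : ModuleCat.{u} R) : Prop :=
  ((Ext R (ModuleCat.{u} R) n).map f.op).app M = 0

lemma extZero_iff {R : Type u} [CommRing R] {X Y : ModuleCat.{u} R} (f : X ⟶ Y) (n : ℕ)
    (M : ModuleCat.{u} R) (P : ProjectiveResolution X) (Q : ProjectiveResolution Y)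
    (φ : P.complex ⟶ Q.complex) (comm : φ.f 0 ≫ Q.π.f 0 = P.π.f 0 ≫ f) (j : ℕ)
    (hj : (ComplexShape.down ℕ).next n = j) :
    ExtZero f n M ↔ ∀ z : Q.complex.X n ⟶ M, Q.complex.d (n+1) n ≫ z = 0 →
      ∃ w : P.complex.X j ⟶ M, P.complex.d n j ≫ w = φ.f n ≫ z := by
  have h := ProjectiveResolution.isoLeftDerivedObj_hom_naturality f P Q φ comm
    ((linearYoneda R (ModuleCat.{u} R)).obj M).rightOp n
  have e2 : ExtZero f n M ↔ HomologicalComplex.homologyMap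
      ((((linearYoneda R (ModuleCat.{u} R)).obj M).rightOp.mapHomologicalComplex _).map φ) n = 0 := by
    have : ExtZero f n M ↔
      (((linearYoneda R (ModuleCat.{u} R)).obj M).rightOp.leftDerived n).map f = 0 :=
      ⟨fun h => Quiver.Hom.unop_inj h, fun h => congrArg Quiver.Hom.unop h⟩
    exact this.trans (zero_iff_of_iso _ _ _ _ h)
  rw [e2, homologyMap_op_eq_zero_iff _ (n+1) n j (by simp) hj]
  rfl

lemma isNoetherian_ext {R : Type u} [CommRing R] {X : ModuleCat.{u} R} (n : ℕ)
    (M : ModuleCat.{u} R) (P : ProjectiveResolution X)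
    (hP : IsNoetherian R (P.complex.X n ⟶ M)) :
    IsNoetherian R (((Ext R (ModuleCat.{u} R) n).obj (Opposite.op X)).obj M) := by
  let K := ((((linearYoneda R (ModuleCat.{u} R)).obj M).rightOp.mapHomologicalComplex
    (ComplexShape.down ℕ)).obj P.complex)
  have hP' : IsNoetherian R (K.X n).unop := hP
  have h1 : Function.Surjective (K.iCycles n).unop :=
    (ModuleCat.epi_iff_surjective _).1 inferInstance
  have h2 : Function.Injective (K.homologyπ n).unop :=
    (ModuleCat.mono_iff_injective _).1 inferInstance
  have n1 : IsNoetherian R (K.cycles n).unop :=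
    isNoetherian_of_surjective (K.iCycles n).unop.hom (LinearMap.range_eq_top.2 h1)
  have n2 : IsNoetherian R (K.homology n).unop :=
    isNoetherian_of_injective (K.homologyπ n).unop.hom h2
  have e : ((Ext R (ModuleCat.{u} R) n).obj (Opposite.op X)).obj M ≅ (K.homology n).unop :=
    (P.isoLeftDerivedObj ((linearYoneda R (ModuleCat.{u} R)).obj M).rightOp n).unop.symm
  exact isNoetherian_of_linearEquiv e.toLinearEquiv.symm

end RelCMAux

open CategoryTheory TensorProduct Limits

namespace RelCMAux

/-- base change functor -/
def bc (R T : Type u) [CommRing R] [CommRing T] [Algebra R T] :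
    ModuleCat.{u} R ⥤ ModuleCat.{u} T where
  obj M := ModuleCat.of T (T ⊗[R] M)
  map f := ModuleCat.ofHom (f.hom.baseChange T)
  map_id M := by
    ext : 1
    exact LinearMap.baseChange_id
  map_comp f g := by
    ext : 1
    exact LinearMap.baseChange_comp _ _

section
variable (R T : Type u) [CommRing R] [CommRing T] [Algebra R T]

instance : (bc R T).Additive where
  map_add {X Y f g} := by
    ext : 1
    exact LinearMap.baseChange_add _ _

instance : (bc R T).PreservesProjectiveObjects where
  projective_obj {X} h := by
    have h1 : Module.Projective R X := (IsProjective.iff_projective X).2 h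
    exact (IsProjective.iff_projective (ModuleCat.of T (T ⊗[R] X))).1 inferInstance

instance [Module.Flat R T] : (bc R T).PreservesHomology := by
  have := ((Functor.exact_tfae (bc R T)).out 1 2).1 (fun S hS => by
    rw [ShortComplex.ShortExact.moduleCat_exact_iff_function_exact] at hS ⊢
    exact Module.Flat.lTensor_exact T hS)
  exact this

end

/-- Existence of resolutions by finite free modules. -/
lemma exists_cover {R : Type u} [CommRing R] (X : ModuleCat.{u} R) :
    ∃ (P : ModuleCat.{u} R) (p : P ⟶ X), Epi p ∧ Projective P ∧
      Module.Free R P ∧ (Module.Finite R X → Module.Finite R P) := by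
  by_cases h : Module.Finite R X
  · obtain ⟨n, f, hf⟩ := Module.Finite.exists_fin' R X
    let e : (ULift.{u} (Fin n) →  R) ≃ₗ[R] (Fin n → R) :=
      LinearEquiv.funCongrLeft R R Equiv.ulift.symm
    refine ⟨ModuleCat.of R (ULift.{u} (Fin n) → R), ModuleCat.ofHom (f ∘ₗ e.toLinearMap), ?_, ?_, ?_, ?_⟩
    · rw [ModuleCat.epi_iff_surjective]
      exact hf.comp e.surjective
    · exact (IsProjective.iff_projective _).1 inferInstance
    · dsimp; infer_instance
    · intro _; dsimp; infer_instance
  · refine ⟨ModuleCat.of R (X →₀ R), ModuleCat.ofHom (Finsupp.linearCombination R id), ?_, ?_, ?_, ?_⟩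
    · rw [ModuleCat.epi_iff_surjective]
      exact Finsupp.linearCombination_id_surjective R X
    · exact (IsProjective.iff_projective _).1 inferInstance
    · dsimp; infer_instance
    · intro h'; exact absurd h' h

section
variable {R : Type u} [CommRing R]

def cov (X : ModuleCat.{u} R) : ModuleCat.{u} R := (exists_cover X).choose
def covπ (X : ModuleCat.{u} R) : cov X ⟶ X := (exists_cover X).choose_spec.choose
instance (X : ModuleCat.{u} R) : Epi (covπ X) := (exists_cover X).choose_spec.choose_spec.1
instance cov_proj (X : ModuleCat.{u} R) : Projective (cov X) :=
  (exists_cover X).choose_spec.choose_spec.2.1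
instance cov_free (X : ModuleCat.{u} R) : Module.Free R (cov X) :=
  (exists_cover X).choose_spec.choose_spec.2.2.1
lemma cov_fin (X : ModuleCat.{u} R) (h : Module.Finite R X) : Module.Finite R (cov X) :=
  (exists_cover X).choose_spec.choose_spec.2.2.2 h

def covd {X Y : ModuleCat.{u} R} (f : X ⟶ Y) : cov (kernel f) ⟶ X := covπ _ ≫ kernel.ι f

lemma covd_comp {X Y : ModuleCat.{u} R} (f : X ⟶ Y) : covd f ≫ f = 0 := by
  simp [covd]

lemma exact_covd {X Y : ModuleCat.{u} R} (f : X ⟶ Y) :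
    (ShortComplex.mk (covd f) f (covd_comp f)).Exact := by
  let α : ShortComplex.mk (covd f) f (covd_comp f) ⟶ ShortComplex.mk (kernel.ι f) f (by simp) :=
    { τ₁ := covπ _
      τ₂ := 𝟙 _
      τ₃ := 𝟙 _
      comm₁₂ := by simp [covd] }
  have : Epi α.τ₁ := by dsimp [α]; infer_instance
  have : IsIso α.τ₂ := by dsimp [α]; infer_instance
  have : Mono α.τ₃ := by dsimp [α]; infer_instance
  rw [ShortComplex.exact_iff_of_epi_of_isIso_of_mono α]
  apply ShortComplex.exact_of_f_is_kernel
  apply kernelIsKernel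

lemma kernel_fin [IsNoetherianRing R] {X Y : ModuleCat.{u} R} (f : X ⟶ Y)
    (h : Module.Finite R X) : Module.Finite R (kernel f : ModuleCat.{u} R) := by
  have h1 : IsNoetherian R X := isNoetherian_of_isNoetherianRing_of_finite R X
  have h2 : IsNoetherian R (kernel f : ModuleCat.{u} R) :=
    isNoetherian_of_injective (kernel.ι f).hom
      ((ModuleCat.mono_iff_injective (kernel.ι f)).1 inferInstance)
  infer_instance

variable (Z : ModuleCat.{u} R)

/-- Auxiliary recursive construction: the `n`-th module with its map to the previous one. -/
def resAux : ℕ → (Σ (X Y : ModuleCat.{u} R), (X ⟶ Y))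
  | 0 => ⟨cov Z, Z, covπ Z⟩
  | n + 1 => ⟨cov (kernel (resAux n).2.2), (resAux n).1, covd (resAux n).2.2⟩

def resX (n : ℕ) : ModuleCat.{u} R := (resAux Z n).1

def resd (n : ℕ) : resX Z (n + 1) ⟶ resX Z n := (resAux Z (n + 1)).2.2

def resπ : resX Z 0 ⟶ Z := covπ Z

instance : Epi (resπ Z) := inferInstanceAs (Epi (covπ Z))

lemma resd_comp_resπ : resd Z 0 ≫ resπ Z = 0 := covd_comp (covπ Z)

lemma resd_comp (n : ℕ) : resd Z (n + 1) ≫ resd Z n = 0 := covd_comp (resAux Z (n + 1)).2.2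

lemma resd_exact_zero : (ShortComplex.mk (resd Z 0) (resπ Z) (resd_comp_resπ Z)).Exact :=
  exact_covd (covπ Z)

lemma resd_exact (n : ℕ) :
    (ShortComplex.mk (resd Z (n + 1)) (resd Z n) (resd_comp Z n)).Exact :=
  exact_covd (resAux Z (n + 1)).2.2

lemma resX_proj (n : ℕ) : Projective (resX Z n) := by
  cases n <;> exact cov_proj _

lemma resX_free (n : ℕ) : Module.Free R (resX Z n) := by
  cases n <;> exact cov_free _

def resComplex : ChainComplex (ModuleCat.{u} R) ℕ :=
  ChainComplex.of (resX Z) (resd Z) (resd_comp Z)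

lemma resComplex_d (n : ℕ) : (resComplex Z).d (n + 1) n = resd Z n :=
  ChainComplex.of_d _ _ _

lemma resComplex_exactAt_succ (n : ℕ) :
    (resComplex Z).ExactAt (n + 1) := by
  rw [HomologicalComplex.exactAt_iff' _ (n + 1 + 1) (n + 1) n (by simp) (by simp)]
  refine (ShortComplex.exact_iff_of_iso ?_).2 (resd_exact Z n)
  exact ShortComplex.isoMk (Iso.refl (resX Z (n+2))) (Iso.refl (resX Z (n+1)))
    (Iso.refl (resX Z n))
    ((Category.id_comp _).trans ((resComplex_d Z (n+1)).symm.trans (Category.comp_id _).symm))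
    ((Category.id_comp _).trans ((resComplex_d Z n).symm.trans (Category.comp_id _).symm))

def resToSingle : resComplex Z ⟶ (ChainComplex.single₀ _).obj Z :=
  (ChainComplex.toSingle₀Equiv _ _).symm ⟨resπ Z, by
    have := resd_comp_resπ Z
    rw [← resComplex_d] at this
    exact this⟩

lemma resToSingle_f_zero : (resToSingle Z).f 0 = resπ Z := by
  exact ChainComplex.toSingle₀Equiv_symm_apply_f_zero (C := resComplex Z) _ _

instance resToSingle_quasiIso : QuasiIso (resToSingle Z) := ⟨fun n => by
    cases n
    · rw [ChainComplex.quasiIsoAt₀_iff, ShortComplex.quasiIso_iff_of_zeros']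
      · refine (ShortComplex.exact_and_epi_g_iff_of_iso ?_).2
          ⟨resd_exact_zero Z, by dsimp; infer_instance⟩
        exact ShortComplex.isoMk (Iso.refl (resX Z 1)) (Iso.refl (resX Z 0)) (Iso.refl Z)
          ((Category.id_comp _).trans ((resComplex_d Z 0).symm.trans (Category.comp_id _).symm))
          ((Category.id_comp _).trans ((resToSingle_f_zero Z).symm.trans (Category.comp_id _).symm))
      all_goals rfl
    · rw [quasiIsoAt_iff_exactAt']
      · apply resComplex_exactAt_succ
      · apply ChainComplex.exactAt_succ_single_obj⟩

def res : ProjectiveResolution Z where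
  complex := resComplex Z
  projective n := resX_proj Z n
  π := resToSingle Z

lemma exists_finite_resolution [IsNoetherianRing R] [Module.Finite R Z] :
    ∃ P : ProjectiveResolution Z, ∀ n, Module.Free R (P.complex.X n) ∧
      Module.Finite R (P.complex.X n) := by
  refine ⟨res Z, fun n => ⟨resX_free Z n, ?_⟩⟩
  change Module.Finite R (resX Z n)
  induction n with
  | zero => exact cov_fin _ inferInstance
  | succ n ih => exact cov_fin _ (kernel_fin _ ih)

end
end RelCMAux

open CategoryTheory TensorProduct Limits

namespace RelCMAux

section LinAlg
variable {R T : Type u} [CommRing R] [CommRing T] [Algebra R T] [Module.FaithfullyFlat R T]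

lemma cond_tensor_iff {A B C D : Type u}
    [AddCommGroup A] [Module R A] [AddCommGroup B] [Module R B]
    [AddCommGroup C] [Module R C] [AddCommGroup D] [Module R D]
    (α : A →ₗ[R] B) (β : A →ₗ[R] C) (γ : D →ₗ[R] C) :
    (∀ x, α x = 0 → ∃ w, γ w = β x) ↔
      (∀ x, α.baseChange T x = 0 → ∃ w, γ.baseChange T w = β.baseChange T x) := by
  constructor
  · intro h x hx
    have ex : Function.Exact (LinearMap.ker α).subtype α := LinearMap.exact_subtype_ker_map α
    have ex2 := Module.Flat.lTensor_exact T ex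
    obtain ⟨y, rfl⟩ := (ex2 x).1 hx
    clear hx
    induction y using TensorProduct.induction_on with
    | zero => exact ⟨0, by simp⟩
    | tmul t k =>
      obtain ⟨w, hw⟩ := h k k.2
      exact ⟨t ⊗ₜ w, by simp [hw]⟩
    | add y z hy hz =>
      obtain ⟨w, hw⟩ := hy
      obtain ⟨v, hv⟩ := hz
      exact ⟨w + v, by rw [map_add, hw, hv, map_add, map_add]⟩
  · intro h x hx
    obtain ⟨w, hw⟩ := h (1 ⊗ₜ x) (by simp [hx])
    have h1 : (LinearMap.range γ).mkQ ∘ₗ γ = 0 := LinearMap.range_mkQ_comp γ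
    have h2 : (1 : T) ⊗ₜ[R] (LinearMap.range γ).mkQ (β x) = 0 := by
      have : ((LinearMap.range γ).mkQ.baseChange T) (γ.baseChange T w) = 0 := by
        rw [← LinearMap.comp_apply, ← LinearMap.baseChange_comp, h1]
        simp
      rw [hw] at this
      simpa using this
    have h3 := (Module.FaithfullyFlat.one_tmul_eq_zero_iff R _ _).1 h2
    have h4 : β x ∈ LinearMap.range γ := (Submodule.Quotient.mk_eq_zero _).1 h3
    exact h4

lemma cond_iff {A B C D A' B' C' D' : Type u}
    [AddCommGroup A] [Module R A] [AddCommGroup B] [Module R B]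
    [AddCommGroup C] [Module R C] [AddCommGroup D] [Module R D]
    [AddCommGroup A'] [Module T A'] [AddCommGroup B'] [Module T B']
    [AddCommGroup C'] [Module T C'] [AddCommGroup D'] [Module T D']
    [Module R A'] [Module R B'] [Module R C'] [Module R D']
    [IsScalarTower R T A'] [IsScalarTower R T B'] [IsScalarTower R T C'] [IsScalarTower R T D']
    (α : A →ₗ[R] B) (β : A →ₗ[R] C) (γ : D →ₗ[R] C)
    (α' : A' →ₗ[T] B') (β' : A' →ₗ[T] C') (γ' : D' →ₗ[T] C')
    (a : A →ₗ[R] A') (b : B →ₗ[R] B') (c : C →ₗ[R] C') (d : D →ₗ[R] D')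
    (ha : IsBaseChange T a) (hb : IsBaseChange T b) (hc : IsBaseChange T c)
    (hd : IsBaseChange T d)
    (hα : ∀ x, α' (a x) = b (α x)) (hβ : ∀ x, β' (a x) = c (β x))
    (hγ : ∀ x, γ' (d x) = c (γ x)) :
    (∀ x, α x = 0 → ∃ w, γ w = β x) ↔ (∀ x, α' x = 0 → ∃ w, γ' w = β' x) := by
  rw [cond_tensor_iff (T := T) α β γ]
  have eα : ∀ x, α' (ha.equiv x) = hb.equiv (α.baseChange T x) := by
    intro x
    induction x using TensorProduct.induction_on with
    | zero => simp
    | tmul t k => simp [IsBaseChange.equiv_tmul, hα]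
    | add y z hy hz => simp [hy, hz]
  have eβ : ∀ x, β' (ha.equiv x) = hc.equiv (β.baseChange T x) := by
    intro x
    induction x using TensorProduct.induction_on with
    | zero => simp
    | tmul t k => simp [IsBaseChange.equiv_tmul, hβ]
    | add y z hy hz => simp [hy, hz]
  have eγ : ∀ x, γ' (hd.equiv x) = hc.equiv (γ.baseChange T x) := by
    intro x
    induction x using TensorProduct.induction_on with
    | zero => simp
    | tmul t k => simp [IsBaseChange.equiv_tmul, hγ]
    | add y z hy hz => simp [hy, hz]
  rw [ha.equiv.surjective.forall]
  refine forall_congr' fun x => ?_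
  rw [eα, eβ, hd.equiv.surjective.exists]
  simp [eγ]

end LinAlg

lemma extZero_iff' {R : Type u} [CommRing R] {X Y : ModuleCat.{u} R} (f : X ⟶ Y) (n : ℕ)
    (M : ModuleCat.{u} R) (P : ProjectiveResolution X) (Q : ProjectiveResolution Y)
    (φ : P.complex ⟶ Q.complex) (comm : φ.f 0 ≫ Q.π.f 0 = P.π.f 0 ≫ f) (j : ℕ)
    (hj : (ComplexShape.down ℕ).next n = j) :
    ExtZero f n M ↔ ∀ z : Q.complex.X n →ₗ[R] M,
      LinearMap.lcomp R M (Q.complex.d (n+1) n).hom z = 0 →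
      ∃ w : P.complex.X j →ₗ[R] M, LinearMap.lcomp R M (P.complex.d n j).hom w =
        LinearMap.lcomp R M (φ.f n).hom z := by
  rw [extZero_iff f n M P Q φ comm j hj]
  constructor
  · intro h z hz
    obtain ⟨w, hw⟩ := h (ModuleCat.ofHom z) (by ext : 1; exact hz)
    exact ⟨w.hom, congrArg ModuleCat.Hom.hom hw⟩
  · intro h z hz
    obtain ⟨w, hw⟩ := h z.hom (congrArg ModuleCat.Hom.hom hz)
    exact ⟨ModuleCat.ofHom w, by ext : 1; exact hw⟩

section
variable {R T : Type u} [CommRing R] [CommRing T] [Algebra R T] [Module.FaithfullyFlat R T]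

lemma baseChange_comm {X Y : ModuleCat.{u} R} (f : X ⟶ Y) (P : ProjectiveResolution X)
    (Q : ProjectiveResolution Y) (φ : P.complex ⟶ Q.complex)
    (w : φ ≫ Q.π = P.π ≫ (ChainComplex.single₀ _).map f) :
    (((bc R T).mapHomologicalComplex _).map φ).f 0 ≫ ((bc R T).mapProjectiveResolution Q).π.f 0 =
      ((bc R T).mapProjectiveResolution P).π.f 0 ≫ (bc R T).map f := by
  have nat := (HomologicalComplex.singleMapHomologicalComplex (bc R T)
    (ComplexShape.down ℕ) 0).hom.naturality f
  have h := congrArg (((bc R T).mapHomologicalComplex (ComplexShape.down ℕ)).map) w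
  rw [Functor.map_comp, Functor.map_comp] at h
  have h2 : ((bc R T).mapHomologicalComplex _).map φ ≫ ((bc R T).mapProjectiveResolution Q).π =
      ((bc R T).mapProjectiveResolution P).π ≫ (ChainComplex.single₀ _).map ((bc R T).map f) := by
    rw [Functor.mapProjectiveResolution_π, Functor.mapProjectiveResolution_π]
    erw [← Category.assoc, h, Category.assoc, nat, Category.assoc]
    rfl
  have h3 := congrArg (fun k => HomologicalComplex.Hom.f k 0) h2
  exact h3

lemma lrHom_apply {N M : Type u} [AddCommGroup N] [Module R N] [AddCommGroup M] [Module R M]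
    (x : N →ₗ[R] M) (y : N) :
    IsBaseChange.linearMapLeftRightHom (TensorProduct.isBaseChange R N T) (mk R T M 1) x
      ((1 : T) ⊗ₜ[R] y) = (1 : T) ⊗ₜ[R] x y :=
  IsBaseChange.linearMapLeftRightHom_comp_apply (TensorProduct.isBaseChange R N T) (mk R T M 1) x y

lemma extZero_bc_iff [IsNoetherianRing R] {X Y : ModuleCat.{u} R} [Module.Finite R X]
    [Module.Finite R Y] (f : X ⟶ Y) (n : ℕ) (M : ModuleCat.{u} R) :
    ExtZero f n M ↔ ExtZero ((bc R T).map f) n ((bc R T).obj M) := by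
  obtain ⟨P, hP⟩ := exists_finite_resolution X
  obtain ⟨Q, hQ⟩ := exists_finite_resolution Y
  let φ := ProjectiveResolution.lift f P Q
  have w : φ ≫ Q.π = P.π ≫ (ChainComplex.single₀ _).map f :=
    ProjectiveResolution.lift_commutes f P Q
  rw [extZero_iff' f n M P Q φ (ProjectiveResolution.lift_commutes_zero f P Q) _ rfl,
    extZero_iff' ((bc R T).map f) n _ ((bc R T).mapProjectiveResolution P)
      ((bc R T).mapProjectiveResolution Q) (((bc R T).mapHomologicalComplex _).map φ)
      (baseChange_comm f P Q φ w) _ rfl]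
  have := fun n => (hP n).1
  have := fun n => (hP n).2
  have := fun n => (hQ n).1
  have := fun n => (hQ n).2
  have bM := TensorProduct.isBaseChange R M T
  refine cond_iff (R := R) (T := T)
    (A' := T ⊗[R] (Q.complex.X n) →ₗ[T] T ⊗[R] M)
    (B' := T ⊗[R] (Q.complex.X (n+1)) →ₗ[T] T ⊗[R] M)
    (C' := T ⊗[R] (P.complex.X n) →ₗ[T] T ⊗[R] M)
    (D' := T ⊗[R] (P.complex.X ((ComplexShape.down ℕ).next n)) →ₗ[T] T ⊗[R] M)
    (LinearMap.lcomp R M (Q.complex.d (n+1) n).hom)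
    (LinearMap.lcomp R M (φ.f n).hom)
    (LinearMap.lcomp R M (P.complex.d n ((ComplexShape.down ℕ).next n)).hom)
    (LinearMap.lcomp T _ ((Q.complex.d (n+1) n).hom.baseChange T))
    (LinearMap.lcomp T _ ((φ.f n).hom.baseChange T))
    (LinearMap.lcomp T _ ((P.complex.d n ((ComplexShape.down ℕ).next n)).hom.baseChange T))
    _ _ _ _
    (IsBaseChange.linearMapLeftRight (TensorProduct.isBaseChange R _ T) bM)
    (IsBaseChange.linearMapLeftRight (TensorProduct.isBaseChange R _ T) bM)
    (IsBaseChange.linearMapLeftRight (TensorProduct.isBaseChange R _ T) bM)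
    (IsBaseChange.linearMapLeftRight (TensorProduct.isBaseChange R _ T) bM) ?_ ?_ ?_
  all_goals
    intro x
    ext y
    refine (lrHom_apply (T := T) x _).trans ?_
    exact Eq.symm (Eq.trans (lrHom_apply (R := R) (T := T) (M := M) (LinearMap.lcomp R M _ x) y) rfl)

end
end RelCMAux

open CategoryTheory TensorProduct Limits Opposite

namespace RelCMAux

lemma subsingleton_colimit_iff {R : Type u} [CommRing R] {J : Type} [SmallCategory J] [IsFiltered J]
    (F : J ⥤ ModuleCat.{u} R) (hF : ∀ j, IsNoetherian R (F.obj j)) :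
    Subsingleton (colimit F : ModuleCat.{u} R) ↔ ∀ j, ∃ (j' : J) (i : j ⟶ j'), F.map i = 0 := by
  have : PreservesFilteredColimitsOfSize.{0, 0} (forget (ModuleCat.{u} R)) :=
    preservesFilteredColimitsOfSize_shrink.{0, u, 0, u} (forget (ModuleCat.{u} R))
  constructor
  · intro h j
    obtain ⟨s, hs⟩ := (hF j).noetherian ⊤
    have key : ∀ s : Finset (F.obj j), ∃ (j' : J) (i : j ⟶ j'), ∀ x ∈ s, (F.map i).hom x = 0 := by
      classical
      intro s
      induction s using Finset.induction_on with
      | empty => exact ⟨j, 𝟙 j, by simp⟩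
      | insert x s hx ih =>
        obtain ⟨j₁, i₁, h₁⟩ := ih
        obtain ⟨j₂, i₂, h₂⟩ := Concrete.colimit_rep_eq_zero R F j x (Subsingleton.elim _ _)
        obtain ⟨k, f, g, hfg⟩ := IsFiltered.span i₁ i₂
        refine ⟨k, i₁ ≫ f, fun y hy => ?_⟩
        rcases Finset.mem_insert.1 hy with rfl | hy
        · rw [hfg]; simp [h₂]
        · simp [h₁ y hy]
    obtain ⟨j', i, hi⟩ := key s
    refine ⟨j', i, ?_⟩
    ext : 1
    refine LinearMap.ext_on hs fun x hx => ?_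
    simpa using hi x hx
  · intro h
    refine ⟨fun x y => ?_⟩
    have : ∀ x : (colimit F : ModuleCat.{u} R), x = 0 := by
      intro x
      obtain ⟨j, x, rfl⟩ := Concrete.colimit_exists_rep F x
      obtain ⟨j', i, hi⟩ := h j
      rw [← colimit.w F i, hi]
      simp
    rw [this x, this y]

section
variable {R : Type u} [CommRing R]

/-- The canonical map. -/
def tr (a : Ideal R) {n m : ℕ} (h : n ≤ m) :
    ModuleCat.of R (R ⧸ a ^ m) ⟶ ModuleCat.of R (R ⧸ a ^ n) :=
  ModuleCat.ofHom (Submodule.mapQ _ _ LinearMap.id (Ideal.pow_le_pow_right h))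

lemma subsingleton_localCohomology_iff [IsNoetherianRing R] (a : Ideal R) (i : ℕ)
    (M : ModuleCat.{u} R) [Module.Finite R M] :
    Subsingleton ((localCohomology a i).obj M) ↔
      ∀ n : ℕ, ∃ (m : ℕ) (h : n ≤ m), ExtZero (tr a h) i M := by
  let e : (localCohomology a i).obj M ≅ _ := colimitObjIsoColimitCompEvaluation
    (localCohomology.diagram (localCohomology.idealPowersDiagram a) i) M
  rw [e.toLinearEquiv.toEquiv.subsingleton_congr]
  erw [subsingleton_colimit_iff]
  · constructor
    · intro h n
      obtain ⟨j, f, hf⟩ := h (op (op n))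
      exact ⟨j.unop.unop, f.unop.unop.down.down, hf⟩
    · intro h j
      obtain ⟨m, hm, hz⟩ := h j.unop.unop
      exact ⟨op (op m), (homOfLE hm).op.op, hz⟩
  · intro j
    obtain ⟨P, hP⟩ := exists_finite_resolution (ModuleCat.of R (R ⧸ a ^ (j.unop.unop)))
    have := (hP i).1
    have := (hP i).2
    refine isNoetherian_ext i M P ?_
    have : IsNoetherian R (P.complex.X i →ₗ[R] M) := inferInstance
    exact isNoetherian_of_linearEquiv (ModuleCat.homLinearEquiv (S := R) (M := P.complex.X i) (N := M)).symm

lemma extZero_comp {X Y X' Y' : ModuleCat.{u} R} (f : X ⟶ Y) (a : X' ⟶ X) (b : Y ⟶ Y') (n : ℕ)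
    (M : ModuleCat.{u} R) (h : ExtZero f n M) : ExtZero (a ≫ f ≫ b) n M := by
  unfold ExtZero at *
  simp [h]

lemma extZero_iso {X Y X' Y' : ModuleCat.{u} R} (f : X ⟶ Y) (f' : X' ⟶ Y') (a : X ≅ X')
    (b : Y ≅ Y') (w : f ≫ b.hom = a.hom ≫ f') (n : ℕ)
    (M : ModuleCat.{u} R) : ExtZero f n M ↔ ExtZero f' n M := by
  constructor
  · intro h
    have := extZero_comp f a.inv b.hom n M h
    rwa [w, Iso.inv_hom_id_assoc] at this
  · intro h
    have := extZero_comp f' a.hom b.inv n M h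
    rwa [← Category.assoc, ← w, Category.assoc, Iso.hom_inv_id, Category.comp_id] at this

lemma subsingleton_ext_iff (X M : ModuleCat.{u} R) (n : ℕ) :
    Subsingleton (((Ext R (ModuleCat.{u} R) n).obj (op X)).obj M) ↔ ExtZero (𝟙 X) n M := by
  unfold ExtZero
  rw [← ModuleCat.isZero_iff_subsingleton, IsZero.iff_id_eq_zero]
  simp
end

section
variable {R T : Type u} [CommRing R] [CommRing T] [Algebra R T]

/-- base change of quotient -/
def quotIso (J : Ideal R) (J' : Ideal T) (h : J.map (algebraMap R T) = J') :
    ModuleCat.of T (T ⧸ J') ≅ (bc R T).obj (ModuleCat.of R (R ⧸ J)) :=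
  LinearEquiv.toModuleIso ((Submodule.quotEquivOfEq _ _ h.symm).trans
    (Algebra.TensorProduct.quotIdealMapEquivTensorQuot T J).toLinearEquiv)

lemma quotIso_tr (a : Ideal R) {n m : ℕ} (h : n ≤ m) :
    tr (a.map (algebraMap R T)) h ≫ (quotIso (a ^ n) _ (Ideal.map_pow _ a n)).hom =
      (quotIso (a ^ m) _ (Ideal.map_pow _ a m)).hom ≫ (bc R T).map (tr a h) := by
  refine ModuleCat.hom_ext (LinearMap.ext fun x => ?_)
  obtain ⟨x, rfl⟩ := Submodule.Quotient.mk_surjective _ x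
  rfl

variable [IsNoetherianRing R] [IsNoetherianRing T] [Module.FaithfullyFlat R T]

lemma subsingleton_ext_bc (a : Ideal R) (M : Type u) [AddCommGroup M] [Module R M] (n : ℕ) :
    Subsingleton (((Ext R (ModuleCat.{u} R) n).obj
      (Opposite.op (ModuleCat.of R (R ⧸ a)))).obj (ModuleCat.of R M)) ↔
    Subsingleton (((Ext T (ModuleCat.{u} T) n).obj
      (Opposite.op (ModuleCat.of T (T ⧸ a.map (algebraMap R T))))).obj
        (ModuleCat.of T (T ⊗[R] M))) := by
  rw [subsingleton_ext_iff, subsingleton_ext_iff, extZero_bc_iff (T := T)]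
  exact (extZero_iso _ _ (quotIso a _ rfl) (quotIso a _ rfl) (by simp) n _).symm

lemma subsingleton_lc_bc (a : Ideal R) (M : Type u) [AddCommGroup M] [Module R M]
    [Module.Finite R M] (n : ℕ) :
    Subsingleton ((localCohomology a n).obj (ModuleCat.of R M)) ↔
    Subsingleton ((localCohomology (a.map (algebraMap R T)) n).obj
        (ModuleCat.of T (T ⊗[R] M))) := by
  rw [subsingleton_localCohomology_iff, subsingleton_localCohomology_iff]
  refine forall_congr' fun k => exists_congr fun m => exists_congr fun h => ?_
  rw [extZero_bc_iff (T := T)]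
  exact (extZero_iso _ _ _ _ (quotIso_tr a h) n _).symm

variable (T) in
lemma relGrade_bc (a : Ideal R) (M : Type u) [AddCommGroup M] [Module R M] :
    relGrade (a.map (algebraMap R T)) (T ⊗[R] M) = relGrade a M := by
  unfold relGrade
  congr 2
  ext i
  exact not_subsingleton_iff_nontrivial.symm.trans
    ((not_congr (subsingleton_ext_bc a M i)).symm.trans not_subsingleton_iff_nontrivial)

variable (T) in
lemma cohDim_bc (a : Ideal R) (M : Type u) [AddCommGroup M] [Module R M] [Module.Finite R M] :
    cohDim (a.map (algebraMap R T)) (T ⊗[R] M) = cohDim a M := by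
  unfold cohDim
  congr 2
  ext i
  exact not_subsingleton_iff_nontrivial.symm.trans
    ((not_congr (subsingleton_lc_bc a M i)).symm.trans not_subsingleton_iff_nontrivial)

variable (T) in
lemma cohDim_bc_self (a : Ideal R) :
    cohDim (a.map (algebraMap R T)) T = cohDim a R := by
  rw [← cohDim_bc T a R]
  unfold cohDim
  congr 2
  ext i
  have e := (localCohomology (a.map (algebraMap R T)) i).mapIso
    (LinearEquiv.toModuleIso (AlgebraTensorModule.rid R T T))
  exact e.toLinearEquiv.toEquiv.nontrivial_congr.symm

end
end RelCMAux

theorem stmt16 {R T : Type u} [CommRing R] [CommRing T] [Algebra R T]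
    [IsNoetherianRing R] [IsNoetherianRing T] [Module.FaithfullyFlat R T]
    (a : Ideal R) (ha : a ≠ ⊤)
    (M : Type u) [AddCommGroup M] [Module R M] [Module.Finite R M] :
    (IsRelCM a M ↔ IsRelCM (a.map (algebraMap R T)) (T ⊗[R] M)) ∧
      (IsRelMCM a M ↔ IsRelMCM (a.map (algebraMap R T)) (T ⊗[R] M)) ∧
      (IsRelGorenstein a M ↔ IsRelGorenstein (a.map (algebraMap R T)) (T ⊗[R] M)) := by
  refine ⟨?_, ?_, ?_⟩
  · have h := (IsBaseChange.map_smul_top_ne_top_iff_of_faithfullyFlat R M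
      (TensorProduct.isBaseChange R M T) a)
    unfold IsRelCM
    rw [RelCMAux.relGrade_bc, RelCMAux.cohDim_bc, h, not_iff_not.1 h]
  · unfold IsRelMCM
    rw [RelCMAux.relGrade_bc, RelCMAux.cohDim_bc_self]
  · unfold IsRelGorenstein
    rw [RelCMAux.cohDim_bc_self]
    exact forall_congr' fun i => imp_congr_right fun _ => RelCMAux.subsingleton_ext_bc a M i

end
end

section
/- Let 𝔞 be an ideal of R and M a finitely generated R-module with M ≠ 𝔞M. Let x₁, …, x_n be a part of an 𝔞-relative system of parameters of M which is also an M-regular sequence, and set M̄ = M/(x₁, …, x_n)M, R̄ = R/(x₁, …, x_n). Then M is 𝔞-relative Cohen-Macaulay over R if and only if M̄ is 𝔞-relative Cohen-Macaulay over R (equivalently, 𝔞R̄-relative Cohen-Macaulay over R̄). -/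
open CategoryTheory TensorProduct

noncomputable section

universe u

/-- `rs` is an `𝔞`-relative system of parameters of `M`: it has length `cd(𝔞,M)`, consists of
elements of `𝔞`, and `Rad(⟨rs⟩ + Ann M) = Rad(𝔞 + Ann M)`. -/
def IsRelSOP {R : Type u} [CommRing R] (a : Ideal R)
    (M : Type u) [AddCommGroup M] [Module R M] (rs : List R) : Prop :=
  (rs.length : ℕ∞) = cohDim a M ∧ (∀ x ∈ rs, x ∈ a) ∧
    (Ideal.span {x | x ∈ rs} + Module.annihilator R M).radical =
      (a + Module.annihilator R M).radical

section Bridge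
open Opposite Limits
variable {R : Type u} [CommRing R]

lemma br_ι_surj (K : ChainComplex (ModuleCat.{u} R)ᵒᵖ ℕ) (n : ℕ) :
    Function.Surjective (K.homologyι n).unop :=
  (ModuleCat.epi_iff_surjective _).1 inferInstance

lemma br_p_inj (K : ChainComplex (ModuleCat.{u} R)ᵒᵖ ℕ) (n : ℕ) :
    Function.Injective (K.pOpcycles n).unop :=
  (ModuleCat.mono_iff_injective _).1 inferInstance

lemma br_p_range (K : ChainComplex (ModuleCat.{u} R)ᵒᵖ ℕ) (n : ℕ) (w : (K.X n).unop)
    (hw : (K.d (n+1) n).unop w = 0) : ∃ z, (K.pOpcycles n).unop z = w := by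
  have h := (ShortComplex.exact_of_g_is_cokernel
    (ShortComplex.mk (K.d (n+1) n) (K.pOpcycles n) (by simp))
    (K.opcyclesIsCokernel (n+1) n (by simp))).unop
  rw [ShortComplex.moduleCat_exact_iff] at h
  exact h w hw

lemma br_ι_zero (K : ChainComplex (ModuleCat.{u} R)ᵒᵖ ℕ) (n : ℕ) (z : (K.opcycles (n+1)).unop) :
    (K.homologyι (n+1)).unop z = 0 ↔
      ∃ v, (K.d (n+1) n).unop v = (K.pOpcycles (n+1)).unop z := by
  have h := (ShortComplex.exact_of_f_is_kernel
    (ShortComplex.mk (K.homologyι (n+1)) (K.fromOpcycles (n+1) n) (by simp))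
    (K.homologyIsKernel (n+1) n (by simp))).unop
  rw [ShortComplex.moduleCat_exact_iff] at h
  have e : K.d (n+1) n = K.pOpcycles (n+1) ≫ K.fromOpcycles (n+1) n := by simp
  constructor
  · intro hz
    obtain ⟨v, hv⟩ := h z hz
    refine ⟨v, ?_⟩
    rw [e, unop_comp]
    change (K.pOpcycles (n+1)).unop ((K.fromOpcycles (n+1) n).unop v) = _
    exact congrArg _ hv
  · rintro ⟨v, hv⟩
    rw [e, unop_comp] at hv
    have hv := br_p_inj K (n+1) hv
    rw [← hv]
    change ((K.fromOpcycles (n+1) n).unop ≫ (K.homologyι (n+1)).unop) v = 0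
    rw [← unop_comp]
    simp

lemma br_ι_zero0 (K : ChainComplex (ModuleCat.{u} R)ᵒᵖ ℕ) (z : (K.opcycles 0).unop) :
    (K.homologyι 0).unop z = 0 ↔ z = 0 := by
  have : Function.Injective (K.homologyι 0).unop :=
    (ModuleCat.mono_iff_injective _).1 inferInstance
  exact map_eq_zero_iff _ this

abbrev yF (Y : ModuleCat.{u} R) : ModuleCat.{u} R ⥤ (ModuleCat.{u} R)ᵒᵖ :=
  ((linearYoneda R (ModuleCat.{u} R)).obj Y).rightOp

abbrev yK {X : ModuleCat.{u} R} (P : ProjectiveResolution X) (Y : ModuleCat.{u} R) :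
    ChainComplex (ModuleCat.{u} R)ᵒᵖ ℕ := ((yF Y).mapHomologicalComplex _).obj P.complex

abbrev oldExt (i : ℕ) (X Y : ModuleCat.{u} R) : ModuleCat.{u} R :=
  ((Ext R (ModuleCat.{u} R) i).obj (op X)).obj Y

/-- comparison iso -/
def brIso {X : ModuleCat.{u} R} (P : ProjectiveResolution X) (Y : ModuleCat.{u} R) (i : ℕ) :
    ((yF Y).leftDerived i).obj X ≅ (yK P Y).homology i := P.isoLeftDerivedObj (yF Y) i

def brRep {X : ModuleCat.{u} R} (P : ProjectiveResolution X) (Y : ModuleCat.{u} R) (i : ℕ) :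
    ((yK P Y).opcycles i).unop ⟶ oldExt i X Y :=
  ((brIso P Y i).hom ≫ (yK P Y).homologyι i).unop

lemma brRep_surj {X : ModuleCat.{u} R} (P : ProjectiveResolution X) (Y : ModuleCat.{u} R) (i : ℕ) :
    Function.Surjective (brRep P Y i) :=
  (ModuleCat.epi_iff_surjective _).1 (inferInstanceAs (Epi ((brIso P Y i).hom ≫ (yK P Y).homologyι i).unop))

lemma brRep_zero {X : ModuleCat.{u} R} (P : ProjectiveResolution X) (Y : ModuleCat.{u} R) (i : ℕ) (z) :
    brRep P Y i z = 0 ↔ ((yK P Y).homologyι i).unop z = 0 := by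
  have : Function.Injective (brIso P Y i).hom.unop :=
    (ModuleCat.mono_iff_injective _).1 inferInstance
  exact map_eq_zero_iff _ this

/-- underlying cocycle -/
def brCoc {X : ModuleCat.{u} R} (P : ProjectiveResolution X) (Y : ModuleCat.{u} R) (i : ℕ)
    (z : ((yK P Y).opcycles i).unop) : P.complex.X i ⟶ Y :=
  ((yK P Y).pOpcycles i).unop z

lemma brCoc_d {X : ModuleCat.{u} R} (P : ProjectiveResolution X) (Y : ModuleCat.{u} R) (i : ℕ)
    (z : ((yK P Y).opcycles i).unop) : P.complex.d (i+1) i ≫ brCoc P Y i z = 0 := by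
  change (((yK P Y).pOpcycles i).unop ≫ ((yK P Y).d (i+1) i).unop) z = 0
  rw [← unop_comp, (yK P Y).d_pOpcycles]
  rfl

lemma brCoc_surj {X : ModuleCat.{u} R} (P : ProjectiveResolution X) (Y : ModuleCat.{u} R) (i : ℕ)
    (f : P.complex.X i ⟶ Y) (hf : P.complex.d (i+1) i ≫ f = 0) : ∃ z, brCoc P Y i z = f :=
  br_p_range (yK P Y) i f hf

lemma brRep_nat {X X' : ModuleCat.{u} R} (g : X' ⟶ X) (P : ProjectiveResolution X)
    (P' : ProjectiveResolution X') (φ : ProjectiveResolution.Hom P' P g)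
    (Y : ModuleCat.{u} R) (i : ℕ) (z) :
    ∃ z', (((Ext R (ModuleCat.{u} R) i).map g.op).app Y) (brRep P Y i z) = brRep P' Y i z' ∧
      brCoc P' Y i z' = φ.hom.f i ≫ brCoc P Y i z := by
  let ψ : yK P' Y ⟶ yK P Y := ((yF Y).mapHomologicalComplex _).map φ.hom
  refine ⟨(HomologicalComplex.opcyclesMap ψ i).unop z, ?_, ?_⟩
  · have h : ((yF Y).leftDerived i).map g ≫ (brIso P Y i).hom =
        (brIso P' Y i).hom ≫ HomologicalComplex.homologyMap ψ i :=
      P'.isoLeftDerivedObj_hom_naturality g P φ.hom φ.hom_f_zero_comp_π_f_zero (yF Y) i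
    have e1 : ((yF Y).leftDerived i).map g ≫ (brIso P Y i).hom ≫
        (yK P Y).homologyι i = (brIso P' Y i).hom ≫ (yK P' Y).homologyι i ≫
        HomologicalComplex.opcyclesMap ψ i := by
      rw [← Category.assoc, h, Category.assoc, ← HomologicalComplex.homologyι_naturality]
    have e2 := congrArg (fun f => f.unop z) e1
    exact e2
  · have e1 := HomologicalComplex.p_opcyclesMap ψ i
    exact congrArg (fun f => f.unop z) e1

lemma extMk_eq_zero_iff0 {X Y : ModuleCat.{u} R} (P : ProjectiveResolution X)
    (f : P.complex.X 0 ⟶ Y) (hf : P.complex.d 1 0 ≫ f = 0) :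
    P.extMk f 1 rfl hf = 0 ↔ f = 0 := by
  constructor
  · intro h
    have h2 := (P.extEquivCohomologyClass.apply_eq_iff_eq).2 h
    rw [P.extEquivCohomologyClass_extMk, P.extEquivCohomologyClass_zero,
      CochainComplex.HomComplex.CohomologyClass.mk_eq_zero_iff,
      CochainComplex.HomComplex.Cocycle.toSingleMk_mem_coboundaries_iff _ _ _ _ _ 1 (by simp)] at h2
    obtain ⟨g, hg⟩ := h2
    have : IsZero (P.cochainComplex.X 1) := P.cochainComplex.isZero_of_isStrictlyLE 0 1
    rw [this.eq_of_src g 0, comp_zero] at hg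
    rw [← cancel_epi (P.cochainComplexXIso (-(0:ℕ)) 0 rfl).hom, ← hg, comp_zero]
  · rintro rfl
    simp

lemma br_zero_iff {X : ModuleCat.{u} R} (P : ProjectiveResolution X) (Y : ModuleCat.{u} R) (i : ℕ)
    (z : ((yK P Y).opcycles i).unop) :
    brRep P Y i z = 0 ↔ P.extMk (brCoc P Y i z) (i+1) rfl (brCoc_d P Y i z) = 0 := by
  rw [brRep_zero]
  cases i with
  | zero =>
    rw [br_ι_zero0, extMk_eq_zero_iff0]
    exact (map_eq_zero_iff _ (br_p_inj _ _)).symm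
  | succ i =>
    rw [br_ι_zero, P.extMk_eq_zero_iff _ _ _ _ i rfl]
    rfl

lemma bridge {ι : Type*} (X Y : ModuleCat.{u} R) (i : ℕ) (X' : ι → ModuleCat.{u} R)
    (g : ∀ k, X' k ⟶ X) :
    (∀ α : oldExt i X Y, ∃ k, (((Ext R (ModuleCat.{u} R) i).map (g k).op).app Y) α = 0) ↔
    (∀ β : Abelian.Ext X Y i, ∃ k, (Abelian.Ext.mk₀ (g k)).comp β (zero_add i) = 0) := by
  let P := projectiveResolution X
  let P' := fun k => projectiveResolution (X' k)
  let φ : ∀ k, ProjectiveResolution.Hom (P' k) P (g k) := fun k =>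
    ⟨ProjectiveResolution.lift (g k) (P' k) P,
      (ProjectiveResolution.lift_commutes_zero (g k) (P' k) P)⟩
  have key : ∀ z k, (((Ext R (ModuleCat.{u} R) i).map (g k).op).app Y) (brRep P Y i z) = 0 ↔
      (Abelian.Ext.mk₀ (g k)).comp (P.extMk (brCoc P Y i z) (i+1) rfl (brCoc_d P Y i z))
        (zero_add i) = 0 := by
    intro z k
    obtain ⟨z', h1, h2⟩ := brRep_nat (g k) P (P' k) (φ k) Y i z
    rw [h1, br_zero_iff, ProjectiveResolution.mk₀_comp_extMk _ _ _ _ (φ k)]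
    simp only [h2]
  constructor
  · intro h β
    obtain ⟨f, hf, rfl⟩ := P.extMk_surjective β (i+1) rfl
    obtain ⟨z, rfl⟩ := brCoc_surj P Y i f hf
    obtain ⟨k, hk⟩ := h (brRep P Y i z)
    exact ⟨k, (key z k).1 hk⟩
  · intro h α
    obtain ⟨z, rfl⟩ := brRep_surj P Y i α
    obtain ⟨k, hk⟩ := h (P.extMk (brCoc P Y i z) (i+1) rfl (brCoc_d P Y i z))
    exact ⟨k, (key z k).2 hk⟩

lemma oldExt_subsingleton_iff (X Y : ModuleCat.{u} R) (i : ℕ) :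
    Subsingleton (oldExt i X Y) ↔ ∀ β : Abelian.Ext X Y i, β = 0 := by
  have := bridge X Y i (fun _ : Unit => X) (fun _ => 𝟙 X)
  simp at this
  rw [← this]
  exact ⟨fun h a => Subsingleton.elim _ _, fun h => ⟨fun a b => (h a).trans (h b).symm⟩⟩

/-- transition map -/
def lcTrans (a : Ideal R) {n k : ℕ} (h : n ≤ k) :
    ModuleCat.of R (R ⧸ a ^ k) ⟶ ModuleCat.of R (R ⧸ a ^ n) :=
  ModuleCat.ofHom <| Submodule.mapQ _ _ LinearMap.id (Ideal.pow_le_pow_right h)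

/-- vanishing of local cohomology -/
def LV (a : Ideal R) (i : ℕ) (N : Type u) [AddCommGroup N] [Module R N] : Prop :=
  ∀ (n : ℕ) (α : Abelian.Ext (ModuleCat.of R (R ⧸ a ^ n)) (ModuleCat.of R N) i),
    ∃ (k : ℕ) (h : n ≤ k), (Abelian.Ext.mk₀ (lcTrans a h)).comp α (zero_add i) = 0

lemma LV_iff (a : Ideal R) (i : ℕ) (N : Type u) [AddCommGroup N] [Module R N] :
    LV a i N ↔ Subsingleton ((localCohomology a i).obj (ModuleCat.of R N)) := by
  let D := localCohomology.diagram (localCohomology.idealPowersDiagram a) i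
  let Y := ModuleCat.of R N
  let F := D ⋙ (evaluation _ _).obj Y
  have e : (localCohomology a i).obj Y ≅ colimit F := colimitObjIsoColimitCompEvaluation D Y
  have e' := e.toLinearEquiv.toEquiv.subsingleton_congr
  rw [e']
  have hb : LV a i N ↔ ∀ n : ℕ, ∀ α : oldExt i (ModuleCat.of R (R ⧸ a ^ n)) Y,
      ∃ k : {k : ℕ // n ≤ k}, (((Ext R (ModuleCat.{u} R) i).map (lcTrans a k.2).op).app Y) α = 0 := by
    refine forall_congr' fun n => ?_
    rw [bridge (ι := {k : ℕ // n ≤ k}) (X' := fun k => ModuleCat.of R (R ⧸ a ^ k.1))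
      (g := fun k => lcTrans a k.2)]
    refine forall_congr' fun α => ?_
    simp
  rw [hb]
  have : PreservesFilteredColimitsOfSize.{0,0} (forget (ModuleCat.{u} R)) :=
    preservesFilteredColimitsOfSize_shrink.{0, u, 0, u} _
  have : IsFiltered (ℕᵒᵖᵒᵖ) := inferInstance
  have : PreservesColimit F (forget (ModuleCat.{u} R)) := inferInstance
  constructor
  · intro h
    refine ⟨fun x y => ?_⟩
    suffices ∀ x : ((colimit F : ModuleCat.{u} R) : Type u), x = 0 from (this x).trans (this y).symm
    intro x
    obtain ⟨j, z, rfl⟩ := Concrete.colimit_exists_rep F x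
    obtain ⟨k, hk⟩ := h j.unop.unop z
    let w : j ⟶ op (op k.1) := (homOfLE k.2).op.op
    rw [← colimit.w F w]
    change (colimit.ι F _) ((F.map w) z) = 0
    have : (F.map w) z = 0 := hk
    rw [this, map_zero]
  · intro h n α
    obtain ⟨j, w, hw⟩ := Concrete.colimit_rep_eq_zero R F (op (op n)) α (Subsingleton.elim _ _)
    exact ⟨⟨j.unop.unop, leOfHom w.unop.unop⟩, hw⟩
end Bridge

section LES
variable {R : Type u} [CommRing R] (a : Ideal R)
  {N N₁ N₂ N₃ : Type u} [AddCommGroup N] [Module R N] [AddCommGroup N₁] [Module R N₁]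
  [AddCommGroup N₂] [Module R N₂] [AddCommGroup N₃] [Module R N₃]

open Abelian

/-- pull back along a transition map -/
def pull {n k i : ℕ} (h : n ≤ k) {Y : ModuleCat.{u} R}
    (α : Abelian.Ext (ModuleCat.of R (R ⧸ a ^ n)) Y i) :
    Abelian.Ext (ModuleCat.of R (R ⧸ a ^ k)) Y i :=
  (Ext.mk₀ (lcTrans a h)).comp α (zero_add i)

lemma lcTrans_comp {n k l : ℕ} (h : n ≤ k) (h' : k ≤ l) :
    lcTrans a h' ≫ lcTrans a h = lcTrans a (h.trans h') := by
  ext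
  rfl

lemma pull_pull {n k l i : ℕ} (h : n ≤ k) (h' : k ≤ l) {Y : ModuleCat.{u} R}
    (α : Abelian.Ext (ModuleCat.of R (R ⧸ a ^ n)) Y i) :
    pull a h' (pull a h α) = pull a (h.trans h') α := by
  unfold pull
  rw [Ext.mk₀_comp_mk₀_assoc, lcTrans_comp]

lemma pull_comp {n k i j l : ℕ} (h : n ≤ k) {Y Z : ModuleCat.{u} R}
    (α : Abelian.Ext (ModuleCat.of R (R ⧸ a ^ n)) Y i) (β : Abelian.Ext Y Z j) (e : i + j = l) :
    pull a h (α.comp β e) = (pull a h α).comp β e := by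
  unfold pull
  rw [Ext.comp_assoc]
  omega

lemma pull_zero {n k i : ℕ} (h : n ≤ k) {Y : ModuleCat.{u} R} :
    pull a h (0 : Abelian.Ext (ModuleCat.of R (R ⧸ a ^ n)) Y i) = 0 := by
  simp [pull]

lemma pull_smul {n k i : ℕ} (h : n ≤ k) {Y : ModuleCat.{u} R} (r : R)
    (α : Abelian.Ext (ModuleCat.of R (R ⧸ a ^ n)) Y i) :
    pull a h (r • α) = r • pull a h α := by
  simp [pull, Ext.comp_smul]

variable {a}

lemma LV_def {i : ℕ} : LV a i N ↔ ∀ (n : ℕ)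
    (α : Abelian.Ext (ModuleCat.of R (R ⧸ a ^ n)) (ModuleCat.of R N) i),
    ∃ (k : ℕ) (h : n ≤ k), pull a h α = 0 := Iff.rfl

variable {f : N₁ →ₗ[R] N₂} {g : N₂ →ₗ[R] N₃}

lemma sesOf (hf : Function.Injective f) (hg : Function.Surjective g) (hfg : Function.Exact f g) :
    (ModuleCat.shortComplexOfCompEqZero f g hfg.linearMap_comp_eq_zero).ShortExact :=
  ModuleCat.shortComplex_shortExact _ hfg hf hg

lemma LES1 (hf : Function.Injective f) (hg : Function.Surjective g) (hfg : Function.Exact f g)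
    {i : ℕ} (h3 : LV a i N₃) (h2 : LV a (i+1) N₂) : LV a (i+1) N₁ := by
  rw [LV_def] at *
  intro n α
  have hS := sesOf hf hg hfg
  obtain ⟨k, h, hk⟩ := h2 n (α.comp (Ext.mk₀ (ModuleCat.ofHom f)) (add_zero _))
  rw [pull_comp] at hk
  obtain ⟨x, hx⟩ := Ext.covariant_sequence_exact₁ _ hS (pull a h α) hk (n₀ := i) rfl
  obtain ⟨l, h', hl⟩ := h3 k x
  refine ⟨l, h.trans h', ?_⟩
  rw [← pull_pull a h h', ← hx, pull_comp, hl, Ext.zero_comp]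

lemma LES3 (hf : Function.Injective f) (hg : Function.Surjective g) (hfg : Function.Exact f g)
    {i : ℕ} (h2 : LV a i N₂) (h1 : LV a (i+1) N₁) : LV a i N₃ := by
  rw [LV_def] at *
  intro n α
  have hS := sesOf hf hg hfg
  obtain ⟨k, h, hk⟩ := h1 n (α.comp hS.extClass rfl)
  rw [pull_comp] at hk
  obtain ⟨x, hx⟩ := Ext.covariant_sequence_exact₃ _ hS (pull a h α) rfl hk
  obtain ⟨l, h', hl⟩ := h2 k x
  refine ⟨l, h.trans h', ?_⟩
  rw [← pull_pull a h h', ← hx, pull_comp, hl, Ext.zero_comp]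

/-- torsion elements -/
def Tors (a : Ideal R) (z : N) : Prop := ∃ n : ℕ, ∀ t ∈ a ^ n, t • z = 0

/-- hom associated to torsion element -/
def torHom {n : ℕ} (z : N) (h : ∀ t ∈ a ^ n, t • z = 0) :
    ModuleCat.of R (R ⧸ a ^ n) ⟶ ModuleCat.of R N :=
  ModuleCat.ofHom ((a ^ n).liftQ (LinearMap.toSpanSingleton R N z) (fun t ht => h t ht))

lemma torHom_one {n : ℕ} (z : N) (h : ∀ t ∈ a ^ n, t • z = 0) :
    torHom z h (Ideal.Quotient.mk _ 1 : R ⧸ a ^ n) = z := by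
  change (1 : R) • z = z
  simp

lemma hom_tors {n : ℕ} (φ : ModuleCat.of R (R ⧸ a ^ n) ⟶ ModuleCat.of R N) :
    ∀ t ∈ a ^ n, t • (φ (Ideal.Quotient.mk _ 1 : R ⧸ a ^ n)) = 0 := by
  intro t ht
  rw [← map_smul]
  convert map_zero φ.hom
  change (Ideal.Quotient.mk (a^n) (t • 1)) = 0
  rw [Ideal.Quotient.eq_zero_iff_mem]
  simpa using ht

lemma hom_ext_one {n : ℕ} {φ ψ : ModuleCat.of R (R ⧸ a ^ n) ⟶ ModuleCat.of R N}
    (h : φ (Ideal.Quotient.mk _ 1 : R ⧸ a ^ n) = ψ (Ideal.Quotient.mk _ 1 : R ⧸ a ^ n)) :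
    φ = ψ := by
  ext
  exact h

lemma mk0_surj {X Y : ModuleCat.{u} R} (α : Abelian.Ext X Y 0) : ∃ φ, α = Ext.mk₀ φ :=
  ⟨Ext.homEquiv₀ α, (Ext.mk₀_homEquiv₀_apply α).symm⟩

lemma pull_mk0 {n k : ℕ} (h : n ≤ k) {Y : ModuleCat.{u} R} (φ : ModuleCat.of R (R ⧸ a ^ n) ⟶ Y) :
    pull a h (Ext.mk₀ φ) = Ext.mk₀ (lcTrans a h ≫ φ) := by
  unfold pull
  rw [Ext.mk₀_comp_mk₀]

lemma E0 : LV a 0 N ↔ ∀ z : N, Tors a z → z = 0 := by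
  rw [LV_def]
  constructor
  · rintro H z ⟨n, hn⟩
    obtain ⟨k, h, hk⟩ := H n (Ext.mk₀ (torHom z hn))
    rw [pull_mk0, Ext.mk₀_eq_zero_iff] at hk
    have := congrArg (fun φ => φ (Ideal.Quotient.mk _ 1 : R ⧸ a ^ k)) hk
    exact (torHom_one z hn).symm.trans this
  · intro H n α
    obtain ⟨φ, rfl⟩ := mk0_surj α
    have : φ = 0 := hom_ext_one (H _ ⟨n, hom_tors φ⟩)
    exact ⟨n, le_rfl, by rw [this]; simp [pull_zero]⟩

lemma E1 (hf : Function.Injective f) (hg : Function.Surjective g) (hfg : Function.Exact f g)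
    (h1 : LV a 1 N₁) (z : N₃) (hz : Tors a z) : ∃ e, Tors a e ∧ g e = z := by
  obtain ⟨n, hn⟩ := hz
  have hS := sesOf hf hg hfg
  obtain ⟨k, h, hk⟩ := h1 n ((Ext.mk₀ (torHom z hn)).comp hS.extClass rfl)
  change pull a h _ = 0 at hk
  rw [pull_comp] at hk
  obtain ⟨x, hx⟩ := Ext.covariant_sequence_exact₃ _ hS _ rfl hk
  obtain ⟨ψ, rfl⟩ := mk0_surj x
  rw [pull_mk0, Ext.mk₀_comp_mk₀] at hx
  have := (Ext.homEquiv₀.symm.injective hx)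
  have := congrArg (fun φ => φ (Ideal.Quotient.mk _ 1 : R ⧸ a ^ k)) this
  exact ⟨_, ⟨k, hom_tors ψ⟩, this.trans (torHom_one z hn)⟩

lemma E1' (hf : Function.Injective f) (hg : Function.Surjective g) (hfg : Function.Exact f g)
    (h2 : LV a 1 N₂) (hs : ∀ z : N₃, Tors a z → ∃ e, Tors a e ∧ g e = z) : LV a 1 N₁ := by
  rw [LV_def] at *
  intro n α
  have hS := sesOf hf hg hfg
  obtain ⟨k, h, hk⟩ := h2 n (α.comp (Ext.mk₀ (ModuleCat.ofHom f)) (add_zero _))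
  rw [pull_comp] at hk
  obtain ⟨x, hx⟩ := Ext.covariant_sequence_exact₁ _ hS (pull a h α) hk (n₀ := 0) rfl
  obtain ⟨φ, rfl⟩ := mk0_surj x
  obtain ⟨e, ⟨m, hm⟩, he⟩ := hs _ ⟨k, hom_tors φ⟩
  have hm' : ∀ t ∈ a ^ (max k m), t • e = 0 := fun t ht =>
    hm t (Ideal.pow_le_pow_right (le_max_right _ _) ht)
  refine ⟨max k m, h.trans (le_max_left _ _), ?_⟩
  rw [← pull_pull a h (le_max_left _ _), ← hx, pull_comp, pull_mk0]
  have : lcTrans a (le_max_left k m) ≫ φ = torHom e hm' ≫ ModuleCat.ofHom g := by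
    apply hom_ext_one
    refine he.symm.trans ?_
    exact congrArg g (torHom_one e hm').symm
  rw [this, ← Ext.mk₀_comp_mk₀, Ext.comp_assoc_of_second_deg_zero]
  have := hS.comp_extClass
  erw [this]
  simp

lemma LV_inj [Injective (ModuleCat.of R N)] (i : ℕ) : LV a (i+1) N := by
  intro n α
  exact ⟨n, le_rfl, by rw [Ext.eq_zero_of_injective α]; simp⟩

lemma LV_congr {N' : Type u} [AddCommGroup N'] [Module R N'] (e : N ≃ₗ[R] N') {i : ℕ} :
    LV a i N ↔ LV a i N' := by
  rw [LV_iff, LV_iff]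
  exact ((localCohomology a i).mapIso e.toModuleIso).toLinearEquiv.toEquiv.subsingleton_congr

lemma LV_rad [IsNoetherianRing R] {b : Ideal R} (h : a.radical = b.radical) {i : ℕ} :
    LV a i N ↔ LV b i N := by
  rw [LV_iff, LV_iff]
  exact ((localCohomology.isoOfSameRadical h i).app _).toLinearEquiv.toEquiv.subsingleton_congr
end LES

section Reg
variable {R : Type u} [CommRing R] {a : Ideal R}
  {N : Type u} [AddCommGroup N] [Module R N] {x : R}
open Abelian
open scoped Pointwise

lemma ext_smul_zero {X Y : ModuleCat.{u} R} {i : ℕ} (r : R) (hr : r • 𝟙 X = 0)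
    (α : Abelian.Ext X Y i) : r • α = 0 := by
  have h : (Ext.mk₀ (r • 𝟙 X)).comp α (zero_add i) = r • α := by
    rw [Ext.mk₀_smul, Ext.smul_comp, Ext.mk₀_id_comp]
  rw [← h, hr]
  simp

lemma smul_id_quot {b : Ideal R} {r : R} (hr : r ∈ b) : r • 𝟙 (ModuleCat.of R (R ⧸ b)) = 0 := by
  ext
  change Ideal.Quotient.mk b (r • 1) = 0
  rw [Ideal.Quotient.eq_zero_iff_mem]
  simpa using hr

lemma lsmul_eq {X : ModuleCat.{u} R} {i : ℕ} (β : Abelian.Ext X (ModuleCat.of R N) i) :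
    β.comp (Ext.mk₀ (ModuleCat.ofHom (LinearMap.lsmul R N x))) (add_zero i) = x • β := by
  rw [Ext.smul_eq_comp_mk₀]
  congr 2

lemma reg_exact : Function.Exact (LinearMap.lsmul R N x) (x • (⊤ : Submodule R N)).mkQ :=
  LinearMap.exact_lsmul_mkQ_smul_top N x

lemma LV_T0 (hx : x ∈ a) (hr : IsSMulRegular N x) : LV a 0 N := by
  rw [E0]
  rintro z ⟨n, hn⟩
  have := hn _ (Ideal.pow_mem_pow hx n)
  exact (hr.pow n).right_eq_zero_of_smul this

lemma LV_T (hx : x ∈ a) (hr : IsSMulRegular N x) {i : ℕ} (h : LV a i (QuotSMulTop x N)) :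
    LV a (i+1) N := by
  have hS := sesOf (f := LinearMap.lsmul R N x) (g := (x • (⊤ : Submodule R N)).mkQ) hr
    (Submodule.mkQ_surjective _) reg_exact
  have key : ∀ m n (α : Abelian.Ext (ModuleCat.of R (R ⧸ a ^ n)) (ModuleCat.of R N) (i+1)),
      x ^ m • α = 0 → ∃ (k : ℕ) (h : n ≤ k), pull a h α = 0 := by
    intro m
    induction m with
    | zero =>
      intro n α hα
      exact ⟨n, le_rfl, by rw [pow_zero, one_smul] at hα; rw [hα, pull_zero]⟩
    | succ m ih =>
      intro n α hα
      rw [pow_succ, mul_smul] at hα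
      obtain ⟨k, hk, h1⟩ := ih n _ hα
      rw [pull_smul, ← lsmul_eq] at h1
      obtain ⟨y, hy⟩ := Ext.covariant_sequence_exact₁ _ hS (pull a hk α) h1 (n₀ := i) rfl
      obtain ⟨l, h', hl⟩ := h k y
      refine ⟨l, hk.trans h', ?_⟩
      change pull a h' y = 0 at hl
      rw [← pull_pull a hk h', ← hy, pull_comp, hl, Ext.zero_comp]
  intro n α
  exact key n n α (ext_smul_zero _ (smul_id_quot (Ideal.pow_mem_pow hx n)) α)

lemma LV_L (hr : IsSMulRegular N x) {i : ℕ} (h : LV a i N) (h' : LV a (i+1) N) :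
    LV a i (QuotSMulTop x N) :=
  LES3 (f := LinearMap.lsmul R N x) (g := (x • (⊤ : Submodule R N)).mkQ) hr
    (Submodule.mkQ_surjective _) reg_exact h h'

def EV (a : Ideal R) (i : ℕ) (N : Type u) [AddCommGroup N] [Module R N] : Prop :=
  ∀ β : Abelian.Ext (ModuleCat.of R (R ⧸ a)) (ModuleCat.of R N) i, β = 0

lemma EV_T (hx : x ∈ a) (hr : IsSMulRegular N x) {i : ℕ} (h : EV a i (QuotSMulTop x N)) :
    EV a (i+1) N := by
  have hS := sesOf (f := LinearMap.lsmul R N x) (g := (x • (⊤ : Submodule R N)).mkQ) hr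
    (Submodule.mkQ_surjective _) reg_exact
  intro β
  have h1 := ext_smul_zero _ (smul_id_quot hx) β
  rw [← lsmul_eq] at h1
  obtain ⟨y, hy⟩ := Ext.covariant_sequence_exact₁ _ hS β h1 (n₀ := i) rfl
  rw [← hy, h y, Ext.zero_comp]

lemma EV_L (hr : IsSMulRegular N x) {i : ℕ} (h : EV a i N) (h' : EV a (i+1) N) :
    EV a i (QuotSMulTop x N) := by
  have hS := sesOf (f := LinearMap.lsmul R N x) (g := (x • (⊤ : Submodule R N)).mkQ) hr
    (Submodule.mkQ_surjective _) reg_exact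
  intro β
  obtain ⟨y, hy⟩ := Ext.covariant_sequence_exact₃ _ hS β (n₁ := i+1) rfl (h' _)
  rw [← hy, h y, Ext.zero_comp]

lemma EV_LV [IsNoetherianRing R] (k : ℕ) (N : Type u) [AddCommGroup N] [Module R N]
    [Module.Finite R N] : (∀ i < k, EV a i N) ↔ ∀ i < k, LV a i N := by
  induction k generalizing N with
  | zero => simp
  | succ k ih =>
    by_cases h0 : EV a 0 N
    · have hs : Subsingleton ((R ⧸ a) →ₗ[R] N) := by
        refine ⟨fun φ ψ => ?_⟩
        have hz : ∀ φ : (R ⧸ a) →ₗ[R] N, φ = 0 := by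
          intro φ
          have := h0 (Ext.mk₀ (ModuleCat.ofHom φ))
          rw [Ext.mk₀_eq_zero_iff] at this
          exact congrArg ModuleCat.Hom.hom this
        rw [hz φ, hz ψ]
      rw [IsSMulRegular.subsingleton_linearMap_iff] at hs
      obtain ⟨x, hx, hr⟩ := hs
      rw [Ideal.annihilator_quotient] at hx
      have e1 : (∀ i < k+1, EV a i N) ↔ ∀ i < k, EV a i (QuotSMulTop x N) := by
        constructor
        · intro h i hi
          exact EV_L hr (h i (by omega)) (h (i+1) (by omega))
        · intro h i hi
          cases i with
          | zero => exact h0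
          | succ i => exact EV_T hx hr (h i (by omega))
      have e2 : (∀ i < k+1, LV a i N) ↔ ∀ i < k, LV a i (QuotSMulTop x N) := by
        constructor
        · intro h i hi
          exact LV_L hr (h i (by omega)) (h (i+1) (by omega))
        · intro h i hi
          cases i with
          | zero => exact LV_T0 hx hr
          | succ i => exact LV_T hx hr (h i (by omega))
      rw [e1, e2]
      exact ih _
    · have h1 : ¬ LV a 0 N := by
        intro h
        apply h0
        intro β
        obtain ⟨φ, rfl⟩ := mk0_surj β
        rw [Ext.mk₀_eq_zero_iff]
        rw [E0] at h
        have := h (φ (Ideal.Quotient.mk _ 1 : R ⧸ a)) ⟨1, ?_⟩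
        · ext
          exact this
        · intro t ht
          rw [pow_one] at ht
          rw [← map_smul]
          convert map_zero φ.hom
          change (Ideal.Quotient.mk a (t • 1)) = 0
          rw [Ideal.Quotient.eq_zero_iff_mem]
          simpa using ht
      exact ⟨fun h => absurd (h 0 (by omega)) h0, fun h => absurd (h 0 (by omega)) h1⟩

lemma LV_Tstar (rs : List R) (hrs : ∀ x ∈ rs, x ∈ a) (N : Type u) [AddCommGroup N] [Module R N]
    (hr : RingTheory.Sequence.IsWeaklyRegular N rs) :
    (∀ i < rs.length, LV a i N) ∧
    (∀ i, LV a i (N ⧸ Ideal.ofList rs • (⊤ : Submodule R N)) → LV a (i + rs.length) N) ∧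
    ∀ k, (∀ i < k + rs.length, LV a i N) →
      ∀ i < k, LV a i (N ⧸ Ideal.ofList rs • (⊤ : Submodule R N)) := by
  induction rs generalizing N with
  | nil =>
    have e : (N ⧸ Ideal.ofList ([] : List R) • (⊤ : Submodule R N)) ≃ₗ[R] N :=
      Submodule.quotEquivOfEqBot _ (by simp)
    have e' : ∀ i, LV a i (N ⧸ Ideal.ofList ([] : List R) • (⊤ : Submodule R N)) ↔ LV a i N :=
      fun i => LV_congr e
    simp [e']
  | cons x rs ih =>
    rw [RingTheory.Sequence.isWeaklyRegular_cons_iff] at hr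
    obtain ⟨hx, hr⟩ := hr
    obtain ⟨h1, h2, h3⟩ := ih (fun y hy => hrs y (by simp [hy])) _ hr
    have hxa := hrs x (by simp)
    have e : ∀ i, LV a i (N ⧸ Ideal.ofList (x :: rs) • (⊤ : Submodule R N)) ↔
      LV a i (QuotSMulTop x N ⧸ Ideal.ofList rs • (⊤ : Submodule R (QuotSMulTop x N))) :=
      fun i => LV_congr (Submodule.quotOfListConsSMulTopEquivQuotSMulTopInner N x rs)
    refine ⟨fun i hi => ?_, fun i hi => ?_, fun k hk i hi => ?_⟩
    · cases i with
      | zero => exact LV_T0 hxa hx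
      | succ i => exact LV_T hxa hx (h1 i (by simpa using hi))
    · exact LV_T hxa hx (h2 i ((e i).1 hi))
    · refine (e i).2 (h3 k ?_ i hi)
      intro j hj
      refine LV_L hx (hk j ?_) (hk (j+1) ?_) <;> simp <;> omega
end Reg

section Gen
variable {R : Type u} [CommRing R]
open Abelian

lemma exists_emb (R : Type u) [CommRing R] (N : Type u) [AddCommGroup N] [Module R N] :
    ∃ (I C : Type u) (_ : AddCommGroup I) (_ : Module R I) (_ : AddCommGroup C) (_ : Module R C)
      (f : N →ₗ[R] I) (g : I →ₗ[R] C), Injective (ModuleCat.of R I) ∧ Module.Injective R I ∧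
      Function.Injective f ∧ Function.Surjective g ∧ Function.Exact f g := by
  let I := Injective.under (ModuleCat.of R N)
  let f : N →ₗ[R] I := (Injective.ι (ModuleCat.of R N)).hom
  have hI : Injective (ModuleCat.of R I) := inferInstanceAs (Injective I)
  refine ⟨I, I ⧸ LinearMap.range f, inferInstance, inferInstance, inferInstance, inferInstance,
    f, (LinearMap.range f).mkQ, hI, Module.injective_module_of_injective_object R I, ?_,
    Submodule.mkQ_surjective _, LinearMap.exact_map_mkQ_range f⟩
  exact (ModuleCat.mono_iff_injective (Injective.ι (ModuleCat.of R N))).1 inferInstance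

variable {b : Ideal R} {y : R} {N N' : Type u} [AddCommGroup N] [Module R N]
  [AddCommGroup N'] [Module R N']

def YS (b : Ideal R) (y : R) (N : Type u) [AddCommGroup N] [Module R N] : Prop :=
  ∀ e : N, Tors b e → ∃ (e' : N) (k : ℕ), Tors b e' ∧ y ^ (k+1) • e' = y ^ k • e

lemma YS_inj [IsNoetherianRing R] [Module.Injective R N] : YS b y N := by
  rintro e ⟨n, hn⟩
  let K : ℕ →o Ideal R := ⟨fun k => Submodule.comap (LinearMap.lsmul R R (y^k)) (b^n), by
    refine monotone_nat_of_le_succ fun k r hr => ?_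
    simp only [Submodule.mem_comap, LinearMap.lsmul_apply, smul_eq_mul] at hr ⊢
    rw [pow_succ', mul_assoc]
    exact Ideal.mul_mem_left _ _ hr⟩
  obtain ⟨k, hk⟩ := monotone_stabilizes_iff_noetherian.2 ‹_› K
  have hk1 : K k = K (k+1) := hk (k+1) (by omega)
  let f : (R ⧸ K k) →ₗ[R] (R ⧸ b ^ n) :=
    Submodule.mapQ (K k) (b^n) (LinearMap.lsmul R R (y^(k+1))) (by rw [hk1]; exact le_rfl)
  have hf : Function.Injective f := by
    rw [injective_iff_map_eq_zero]
    intro z hz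
    obtain ⟨r, rfl⟩ := Submodule.mkQ_surjective _ z
    have h1 : (b^n).mkQ (y^(k+1) * r) = 0 := hz
    have h2 : y^(k+1) * r ∈ b ^ n := (Submodule.Quotient.mk_eq_zero _).1 h1
    have h3 : r ∈ K k := by rw [hk1]; exact h2
    exact (Submodule.Quotient.mk_eq_zero _).2 h3
  let g : (R ⧸ K k) →ₗ[R] N :=
    Submodule.liftQ (K k) (LinearMap.toSpanSingleton R N (y^k • e)) (by
      intro r hr
      have h2 : y^k * r ∈ b ^ n := hr
      simp only [LinearMap.mem_ker, LinearMap.toSpanSingleton_apply]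
      rw [smul_smul, mul_comm]
      exact hn _ h2)
  obtain ⟨h, hh⟩ := Module.Injective.out f hf g
  refine ⟨h (Submodule.mkQ _ 1), k, ⟨n, fun t ht => ?_⟩, ?_⟩
  · rw [← map_smul, ← map_smul]
    convert map_zero h
    exact (Submodule.Quotient.mk_eq_zero _).2 (by simpa using ht)
  · rw [← map_smul, ← map_smul]
    have h1 := hh (Submodule.mkQ _ 1)
    have h2 : g (Submodule.mkQ _ 1) = y^k • e := by
      change (1 : R) • (y^k • e) = _
      rw [one_smul]
    have h3 : f (Submodule.mkQ _ 1) = Submodule.mkQ _ (y^(k+1) • 1) := rfl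
    rw [← h3, h1, h2]

lemma Tors.map {z : N} (h : Tors b z) (g : N →ₗ[R] N') : Tors b (g z) := by
  obtain ⟨n, hn⟩ := h
  exact ⟨n, fun t ht => by rw [← map_smul, hn t ht, map_zero]⟩

lemma YS_surj (g : N →ₗ[R] N') (hg : ∀ z : N', Tors b z → ∃ e, Tors b e ∧ g e = z)
    (h : YS b y N) : YS b y N' := by
  intro z hz
  obtain ⟨e, he, rfl⟩ := hg z hz
  obtain ⟨e', k, he', hk⟩ := h e he
  exact ⟨g e', k, he'.map g, by rw [← map_smul, hk, map_smul]⟩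

lemma YS_iter (h : YS b y N) (j : ℕ) (w : N) (hw : Tors b w) :
    ∃ (u : N) (k : ℕ), Tors b u ∧ y ^ (k + j) • u = y ^ k • w := by
  induction j with
  | zero => exact ⟨w, 0, hw, by simp⟩
  | succ j ih =>
    obtain ⟨u, k, hu, hk⟩ := ih
    obtain ⟨u', m, hu', hm⟩ := h u hu
    refine ⟨u', m + k, hu', ?_⟩
    calc y ^ (m + k + (j+1)) • u' = y ^ (k + j) • y ^ (m+1) • u' := by
          rw [smul_smul]; congr 1; ring
      _ = y ^ m • y ^ (k + j) • u := by rw [hm, smul_comm]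
      _ = _ := by rw [hk, smul_smul, pow_add]

lemma Tors.sub {z z' : N} (h : Tors b z) (h' : Tors b z') : Tors b (z - z') := by
  obtain ⟨n, hn⟩ := h
  obtain ⟨m, hm⟩ := h'
  refine ⟨max n m, fun t ht => ?_⟩
  rw [smul_sub, hn t (Ideal.pow_le_pow_right (le_max_left _ _) ht),
    hm t (Ideal.pow_le_pow_right (le_max_right _ _) ht), sub_zero]

lemma Tors.mono {a : Ideal R} {z : N} (h : Tors a z) (hb : b ≤ a) : Tors b z := by
  obtain ⟨n, hn⟩ := h
  exact ⟨n, fun t ht => hn t (Ideal.pow_right_mono hb n ht)⟩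

lemma tors_sup {z : N} (h : Tors b z) {p : ℕ} (hp : y ^ p • z = 0) :
    Tors (Ideal.span {y} ⊔ b) z := by
  obtain ⟨n, hn⟩ := h
  refine ⟨p + n, fun t ht => ?_⟩
  have := Ideal.sup_pow_add_le_pow_sup_pow ht
  rw [Ideal.span_singleton_pow] at this
  obtain ⟨s, hs, r, hr, rfl⟩ := Submodule.mem_sup.1 this
  obtain ⟨c, rfl⟩ := Ideal.mem_span_singleton'.1 hs
  rw [add_smul, mul_smul, hp, hn r hr, smul_zero, add_zero]

lemma lemB [IsNoetherianRing R] (i : ℕ) (N : Type u) [AddCommGroup N] [Module R N]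
    (h : ∀ i, LV b (i+1) N) (hy : YS b y N) : LV (Ideal.span {y} ⊔ b) (i+1) N := by
  obtain ⟨I, C, _, _, _, _, f, g, hI, hI', hf, hg, hfg⟩ := exists_emb R N
  have hsurj := E1 hf hg hfg (h 0)
  induction i generalizing N C I with
  | zero =>
    refine E1' hf hg hfg (LV_inj 0) fun z hz => ?_
    obtain ⟨e, he, rfl⟩ := hsurj z (hz.mono le_sup_right)
    obtain ⟨n, hn⟩ := hz
    have h1 : g (y ^ n • e) = 0 := by
      rw [map_smul]
      exact hn _ (Ideal.pow_mem_pow (Ideal.mem_sup_left (Ideal.mem_span_singleton_self y)) n)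
    obtain ⟨w, hw⟩ := (hfg _).1 h1
    have hwt : Tors b w := by
      obtain ⟨m, hm⟩ := he
      refine ⟨m, fun t ht => hf ?_⟩
      rw [map_smul, hw, smul_comm, hm t ht, smul_zero, map_zero]
    obtain ⟨u, k, hu, hk⟩ := YS_iter hy n w hwt
    refine ⟨e - f u, tors_sup (he.sub (hu.map f)) (p := k + n) ?_, ?_⟩
    · rw [smul_sub, pow_add, mul_smul, ← hw, ← map_smul, ← map_smul, hk.symm, pow_add]
      exact sub_self _
    · rw [map_sub, hfg.apply_apply_eq_zero, sub_zero]
  | succ i ih =>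
    refine LES1 hf hg hfg ?_ (LV_inj _)
    obtain ⟨I2, C2, _, _, _, _, f2, g2, hI2, hI2', hf2, hg2, hfg2⟩ := exists_emb R C
    have hC : ∀ i, LV b (i+1) C := fun i => LES3 hf hg hfg (LV_inj i) (h (i+1))
    exact ih C hC (YS_surj g hsurj YS_inj) I2 C2 _ _ _ _ f2 g2 hI2 hI2' hf2 hg2 hfg2 (E1 hf2 hg2 hfg2 (hC 0))

lemma lemA [IsNoetherianRing R] (k : ℕ) (N : Type u) [AddCommGroup N] [Module R N]
    (h : ∀ i > k, LV b i N) : ∀ i > k + 1, LV (Ideal.span {y} ⊔ b) i N := by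
  induction k generalizing N with
  | zero =>
    obtain ⟨I, C, _, _, _, _, f, g, hI, hI', hf, hg, hfg⟩ := exists_emb R N
    intro i hi
    obtain ⟨i, rfl⟩ : ∃ j, i = j + 2 := ⟨i - 2, by omega⟩
    refine LES1 hf hg hfg ?_ (LV_inj _)
    exact lemB i C (fun i => LES3 hf hg hfg (LV_inj i) (h _ (by omega)))
      (YS_surj g (E1 hf hg hfg (h 1 (by omega))) YS_inj)
  | succ k ih =>
    obtain ⟨I, C, _, _, _, _, f, g, hI, hI', hf, hg, hfg⟩ := exists_emb R N
    intro i hi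
    obtain ⟨i, rfl⟩ : ∃ j, i = j + 1 := ⟨i - 1, by omega⟩
    refine LES1 hf hg hfg (ih C ?_ i (by omega)) (LV_inj _)
    intro j hj
    obtain ⟨j, rfl⟩ : ∃ l, j = l + 1 := ⟨j - 1, by omega⟩
    exact LES3 hf hg hfg (LV_inj j) (h _ (by omega))

lemma LV_bot (i : ℕ) (N : Type u) [AddCommGroup N] [Module R N] :
    LV (⊥ : Ideal R) (i+1) N := by
  intro n α
  refine ⟨n+1, by omega, ?_⟩
  have e : (R ⧸ (⊥ : Ideal R)^(n+1)) ≃ₗ[R] R := Submodule.quotEquivOfEqBot _ (by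
    rw [pow_succ]; simp)
  have : Module.Projective R (R ⧸ (⊥ : Ideal R)^(n+1)) := Module.Projective.of_equiv e.symm
  have : Projective (ModuleCat.of R (R ⧸ (⊥ : Ideal R)^(n+1))) :=
    (IsProjective.iff_projective _).1 this
  exact Ext.eq_zero_of_projective _

lemma LV_gen [IsNoetherianRing R] (ys : List R) (N : Type u) [AddCommGroup N] [Module R N] :
    ∀ i > ys.length, LV (Ideal.ofList ys) i N := by
  induction ys with
  | nil =>
    intro i hi
    obtain ⟨i, rfl⟩ : ∃ j, i = j + 1 := ⟨i - 1, by simp at hi; omega⟩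
    rw [Ideal.ofList_nil]
    exact LV_bot i N
  | cons y ys ih =>
    rw [Ideal.ofList_cons]
    exact lemA _ N ih

section BC
variable {R' : Type u} [CommRing R'] [Algebra R R'] {E : Type u} [AddCommGroup E]
  [Module R E] [Module R' E] [IsScalarTower R R' E]

lemma tors_map (b : Ideal R) (z : E) : Tors b z ↔ Tors (b.map (algebraMap R R')) z := by
  refine exists_congr fun n => ?_
  rw [← Ideal.map_pow]
  constructor
  · intro h t ht
    have : (b^n).map (algebraMap R R') ≤ (R' ∙ z).annihilator := by
      rw [Ideal.map_le_iff_le_comap]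
      intro t ht
      rw [Ideal.mem_comap, Submodule.mem_annihilator_span_singleton, algebraMap_smul, h t ht]
    exact (Submodule.mem_annihilator_span_singleton _ _).1 (this ht)
  · intro h t ht
    rw [← algebraMap_smul R' t z]
    exact h _ (Ideal.mem_map_of_mem _ ht)

lemma YS_inj' [IsNoetherianRing R'] [Module.Injective R' E] (b : Ideal R) (y : R) : YS b y E := by
  intro e he
  obtain ⟨e', k, h1, h2⟩ := YS_inj (b := b.map (algebraMap R R')) (y := algebraMap R R' y) e
    ((tors_map b e).1 he)
  refine ⟨e', k, (tors_map b e').2 h1, ?_⟩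
  rw [← map_pow, ← map_pow, algebraMap_smul, algebraMap_smul] at h2
  exact h2

lemma LV_inj' [IsNoetherianRing R] [IsNoetherianRing R'] [Module.Injective R' E] (a : Ideal R)
    (i : ℕ) : LV a (i+1) E := by
  obtain ⟨s, rfl⟩ := IsNoetherian.noetherian a
  have key : ∀ (ys : List R) (i : ℕ), LV (Ideal.ofList ys) (i+1) E := by
    intro ys
    induction ys with
    | nil => intro i; rw [Ideal.ofList_nil]; exact LV_bot i E
    | cons y ys ih =>
      intro i
      rw [Ideal.ofList_cons]
      exact lemB i E ih (YS_inj' (R' := R') _ _)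
  have : Ideal.ofList s.toList = Submodule.span R (s : Set R) := by
    unfold Ideal.ofList
    simp [Ideal.span]
  rw [← this]
  exact key _ i

lemma LV_BC [IsNoetherianRing R] [IsNoetherianRing R'] (a : Ideal R) (i : ℕ)
    (E : Type u) [AddCommGroup E] [Module R E] [Module R' E] [IsScalarTower R R' E] :
    LV a i E ↔ LV (a.map (algebraMap R R')) i E := by
  cases i with
  | zero =>
    rw [E0, E0]
    simp_rw [tors_map (R' := R') a]
  | succ i =>
  obtain ⟨I, C, _, _, _, _, f, g, hI, hI', hf, hg, hfg⟩ := exists_emb R' E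
  induction i generalizing E I C with
  | zero =>
    let _ : Module R I := Module.compHom I (algebraMap R R')
    let _ : Module R C := Module.compHom C (algebraMap R R')
    have : IsScalarTower R R' I := IsScalarTower.of_algebraMap_smul fun _ _ => rfl
    have : IsScalarTower R R' C := IsScalarTower.of_algebraMap_smul fun _ _ => rfl
    let f' := f.restrictScalars R
    let g' := g.restrictScalars R
    have hf' : Function.Injective f' := hf
    have hg' : Function.Surjective g' := hg
    have hfg' : Function.Exact f' g' := hfg
    constructor
    · intro h
      refine E1' hf hg hfg (LV_inj 0) ?_
      have := E1 hf' hg' hfg' h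
      intro z hz
      obtain ⟨e, he, h⟩ := this z ((tors_map a z).2 hz)
      exact ⟨e, (tors_map a e).1 he, h⟩
    · intro h
      refine E1' hf' hg' hfg' (LV_inj' (R' := R') _ 0) ?_
      have := E1 hf hg hfg h
      intro z hz
      obtain ⟨e, he, h⟩ := this z ((tors_map a z).1 hz)
      exact ⟨e, (tors_map a e).2 he, h⟩
  | succ i ih =>
    let _ : Module R I := Module.compHom I (algebraMap R R')
    let _ : Module R C := Module.compHom C (algebraMap R R')
    have : IsScalarTower R R' I := IsScalarTower.of_algebraMap_smul fun _ _ => rfl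
    have : IsScalarTower R R' C := IsScalarTower.of_algebraMap_smul fun _ _ => rfl
    let f' := f.restrictScalars R
    let g' := g.restrictScalars R
    have hf' : Function.Injective f' := hf
    have hg' : Function.Surjective g' := hg
    have hfg' : Function.Exact f' g' := hfg
    obtain ⟨I2, C2, _, _, _, _, f2, g2, hI2, hI2', hf2, hg2, hfg2⟩ := exists_emb R' C
    have ih' := ih C I2 C2 _ _ _ _ f2 g2 hI2 hI2' hf2 hg2 hfg2
    constructor
    · intro h
      exact LES1 hf hg hfg (ih'.1 (LES3 hf' hg' hfg' (LV_inj' (R' := R') _ _) h)) (LV_inj _)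
    · intro h
      exact LES1 hf' hg' hfg' (ih'.2 (LES3 hf hg hfg (LV_inj _) h)) (LV_inj' (R' := R') _ _)
end BC
end Gen

section Final
open Abelian
variable {R : Type u} [CommRing R]

lemma le_relGrade [IsNoetherianRing R] (a : Ideal R) (N : Type u) [AddCommGroup N] [Module R N]
    [Module.Finite R N] (k : ℕ) : (k : ℕ∞) ≤ relGrade a N ↔ ∀ i < k, LV a i N := by
  rw [← EV_LV, relGrade, le_sInf_iff]
  simp only [Set.forall_mem_image, Set.mem_ofPred_eq, Nat.cast_le]
  refine forall_congr' fun i => ?_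
  have h : Nontrivial (((Ext R (ModuleCat.{u} R) i).obj
      (Opposite.op (ModuleCat.of R (R ⧸ a)))).obj (ModuleCat.of R N)) ↔ ¬ EV a i N := by
    rw [← not_subsingleton_iff_nontrivial]
    exact not_congr (oldExt_subsingleton_iff _ _ i)
  rw [h]
  constructor
  · intro H hi
    by_contra hc
    exact absurd (H hc) (by omega)
  · intro H hc
    by_contra hi
    exact hc (H (by omega))

lemma cohDim_le (a : Ideal R) (N : Type u) [AddCommGroup N] [Module R N]
    (k : ℕ) : cohDim a N ≤ (k : ℕ∞) ↔ ∀ i > k, LV a i N := by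
  rw [cohDim, sSup_le_iff]
  simp only [Set.forall_mem_image, Set.mem_ofPred_eq, Nat.cast_le]
  refine forall_congr' fun i => ?_
  rw [← not_subsingleton_iff_nontrivial, ← LV_iff]
  constructor
  · intro H hi
    by_contra hc
    exact absurd (H hc) (by omega)
  · intro H hc
    by_contra hi
    exact hc (H (by omega))

lemma le_cohDim (a : Ideal R) (N : Type u) [AddCommGroup N] [Module R N]
    (k : ℕ) (h : ¬ LV a k N) : (k : ℕ∞) ≤ cohDim a N := by
  refine le_sSup ⟨k, ?_, rfl⟩
  rw [LV_iff] at h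
  exact not_subsingleton_iff_nontrivial.1 h

lemma CM_iff [IsNoetherianRing R] (a : Ideal R) (N : Type u) [AddCommGroup N] [Module R N]
    [Module.Finite R N] : relGrade a N = cohDim a N ↔
      ∃ m, ¬ LV a m N ∧ ∀ i ≠ m, LV a i N := by
  constructor
  · intro h
    by_cases hS : ∃ i, ¬ LV a i N
    · classical
      have h1 := Nat.find_spec hS
      have h2 : ∀ i < Nat.find hS, LV a i N := fun i hi => not_not.1 (Nat.find_min hS hi)
      set m := Nat.find hS
      refine ⟨m, h1, ?_⟩
      have h3 : ¬ ((m+1 : ℕ) : ℕ∞) ≤ relGrade a N := by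
        rw [le_relGrade]
        intro h
        exact h1 (h m (by omega))
      have h4 : relGrade a N ≤ m := by
        rw [not_le] at h3
        exact Order.le_of_lt_add_one (by exact_mod_cast h3)
      rw [h, cohDim_le] at h4
      intro i hi
      rcases lt_or_gt_of_ne hi with hi | hi
      · exact h2 i hi
      · exact h4 i hi
    · push Not at hS
      have h1 : ((1 : ℕ) : ℕ∞) ≤ relGrade a N := (le_relGrade a N 1).2 fun i _ => hS i
      have h2 : cohDim a N ≤ (0 : ℕ) := (cohDim_le a N 0).2 fun i _ => hS i
      rw [h] at h1
      have := h1.trans h2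
      simp at this
  · rintro ⟨m, h1, h2⟩
    have h3 : ¬ ((m+1 : ℕ) : ℕ∞) ≤ relGrade a N := by
      rw [le_relGrade]
      intro h
      exact h1 (h m (by omega))
    have h4 : relGrade a N ≤ m := by
      rw [not_le] at h3
      exact Order.le_of_lt_add_one (by exact_mod_cast h3)
    have h5 : (m : ℕ∞) ≤ relGrade a N := (le_relGrade a N m).2 fun i hi => h2 i (by omega)
    have h6 : cohDim a N ≤ m := (cohDim_le a N m).2 fun i hi => h2 i (by omega)
    rw [le_antisymm h4 h5, le_antisymm h6 (le_cohDim a N m h1)]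

lemma LV_U [IsNoetherianRing R] (a : Ideal R) (M N : Type u) [AddCommGroup M] [Module R M]
    [AddCommGroup N] [Module R N] (rs ys : List R)
    (hy : ∀ y ∈ ys, y ∈ a) (hr : ∀ r ∈ rs, r ∈ Module.annihilator R N)
    (hMN : Module.annihilator R M ≤ Module.annihilator R N)
    (hrad : (Ideal.span {x | x ∈ rs ++ ys} + Module.annihilator R M).radical =
      (a + Module.annihilator R M).radical) : ∀ i > ys.length, LV a i N := by
  intro i hi
  let _ := Module.quotientAnnihilator (R := R) (M := N)
  have : IsScalarTower R (R ⧸ Module.annihilator R N) N := inferInstance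
  let π := Ideal.Quotient.mk (Module.annihilator R N)
  rw [LV_BC (R' := R ⧸ Module.annihilator R N)]
  change LV (a.map π) i N
  have hle : Ideal.span {x | x ∈ rs ++ ys} + Module.annihilator R M ≤
      Ideal.comap π (Ideal.ofList (ys.map π)) := by
    have h0 : Module.annihilator R N ≤ Ideal.comap π (Ideal.ofList (ys.map π)) := by
      intro t ht
      rw [Ideal.mem_comap, Ideal.Quotient.eq_zero_iff_mem.2 ht]
      exact Ideal.zero_mem _
    refine sup_le (Ideal.span_le.2 ?_) (hMN.trans h0)
    intro t ht
    rcases List.mem_append.1 ht with ht | ht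
    · exact h0 (hr t ht)
    · exact Ideal.subset_span (List.mem_map_of_mem ht)
  have hR : (a.map π).radical = (Ideal.ofList (ys.map π)).radical := by
    apply le_antisymm
    · rw [Ideal.radical_le_radical_iff, Ideal.map_le_iff_le_comap]
      intro t ht
      have h1 : t ∈ (a + Module.annihilator R M).radical :=
        Ideal.le_radical (Ideal.mem_sup_left ht)
      rw [← hrad] at h1
      obtain ⟨k, hk⟩ := h1
      refine ⟨k, ?_⟩
      have := hle hk
      rwa [Ideal.mem_comap, map_pow] at this
    · apply Ideal.radical_mono
      refine Ideal.span_le.2 ?_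
      intro t ht
      obtain ⟨s, hs, rfl⟩ := List.mem_map.1 ht
      exact Ideal.mem_map_of_mem _ (hy s hs)
  rw [LV_rad hR]
  exact LV_gen _ N i (by simpa using hi)

lemma main_aux [IsNoetherianRing R]
    (a : Ideal R) (M : Type u) [AddCommGroup M] [Module R M] [Module.Finite R M] (rs : List R)
    (hsop : ∃ rs' : List R, rs <+: rs' ∧ IsRelSOP a M rs')
    (hreg : RingTheory.Sequence.IsWeaklyRegular M rs) :
    (∃ m, ¬ LV a m M ∧ ∀ i ≠ m, LV a i M) ↔
    ∃ m, ¬ LV a m (M ⧸ ((Ideal.span {x | x ∈ rs}) • (⊤ : Submodule R M))) ∧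
      ∀ i ≠ m, LV a i (M ⧸ ((Ideal.span {x | x ∈ rs}) • (⊤ : Submodule R M))) := by
  obtain ⟨rs', ⟨ys, rfl⟩, hc, hmem, hrad⟩ := hsop
  obtain ⟨h1, h2, h3⟩ := LV_Tstar rs (a := a) (fun x hx => hmem x (by simp [hx])) M hreg
  change ∀ i, LV a i (M ⧸ ((Ideal.span {x | x ∈ rs}) • (⊤ : Submodule R M))) → _ at h2
  change ∀ k, _ → ∀ i < k, LV a i (M ⧸ ((Ideal.span {x | x ∈ rs}) • (⊤ : Submodule R M))) at h3
  have hU : ∀ i > ys.length, LV a i (M ⧸ ((Ideal.span {x | x ∈ rs}) • (⊤ : Submodule R M))) := by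
    refine LV_U a M _ rs ys (fun y hy => hmem y (by simp [hy])) ?_ ?_ hrad
    · intro r hr
      rw [Module.mem_annihilator]
      intro z
      obtain ⟨w, rfl⟩ := Submodule.mkQ_surjective _ z
      rw [← map_smul]
      exact (Submodule.Quotient.mk_eq_zero _).2
        (Submodule.smul_mem_smul (Ideal.subset_span hr) trivial)
    · exact LinearMap.annihilator_le_of_surjective (Submodule.mkQ _) (Submodule.mkQ_surjective _)
  have hlen : (rs ++ ys).length = ys.length + rs.length := by simp [add_comm]
  rw [hlen] at hc
  have hbig : ∀ i > ys.length + rs.length, LV a i M := (cohDim_le a M _).1 hc.ge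
  have htop : (∃ i, ¬ LV a i M) → ¬ LV a (ys.length + rs.length) M := by
    rintro ⟨i, hi⟩ hLV
    have hi' := le_cohDim a M i hi
    rw [← hc, Nat.cast_le] at hi'
    have : cohDim a M ≤ ((ys.length + rs.length - 1 : ℕ) : ℕ∞) := by
      rw [cohDim_le]
      intro j hj
      rcases lt_or_ge (ys.length + rs.length) j with h | h
      · exact hbig j h
      · rcases Nat.eq_or_lt_of_le h with h | h
        · rwa [h]
        · omega
    rw [← hc, Nat.cast_le] at this
    have : ys.length + rs.length = 0 := by omega
    have : i = ys.length + rs.length := by omega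
    exact hi (this ▸ hLV)
  constructor
  · rintro ⟨m, hm, hm'⟩
    have ht := htop ⟨m, hm⟩
    have hmc : m = ys.length + rs.length := by
      by_contra h
      exact ht (hm' _ (Ne.symm h))
    subst hmc
    refine ⟨ys.length, fun h => ht (h2 _ h), fun i hi => ?_⟩
    rcases lt_or_gt_of_ne hi with hi | hi
    · exact h3 ys.length (fun j hj => hm' j (by omega)) i hi
    · exact hU i hi
  · rintro ⟨m, hm, hm'⟩
    have hne : ∃ i, ¬ LV a i M := by
      by_contra h
      push Not at h
      exact hm (h3 (m+1) (fun i _ => h i) m (by omega))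
    have ht := htop hne
    have hmc : m = ys.length := by
      by_contra h
      exact ht (h2 _ (hm' _ (Ne.symm h)))
    subst hmc
    refine ⟨ys.length + rs.length, ht, fun i hi => ?_⟩
    rcases lt_or_gt_of_ne hi with hi | hi
    · rcases lt_or_ge i rs.length with h | h
      · exact h1 i h
      · obtain ⟨j, rfl⟩ : ∃ j, i = j + rs.length := ⟨i - rs.length, by omega⟩
        exact h2 j (hm' j (by omega))
    · exact hbig i hi

lemma smul_top_ne (a I : Ideal R) (h : I ≤ a) (M : Type u) [AddCommGroup M] [Module R M]
    (hM : a • (⊤ : Submodule R M) ≠ ⊤) :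
    a • (⊤ : Submodule R (M ⧸ (I • (⊤ : Submodule R M)))) ≠ ⊤ := by
  intro hc
  apply hM
  have h1 : Submodule.map (I • (⊤ : Submodule R M)).mkQ (a • (⊤ : Submodule R M)) = ⊤ := by
    rw [Submodule.map_smul'', Submodule.map_top, Submodule.range_mkQ, hc]
  have h2 := congrArg (Submodule.comap (I • (⊤ : Submodule R M)).mkQ) h1
  rw [Submodule.comap_map_mkQ, Submodule.comap_top] at h2
  rwa [sup_eq_right.2 (Submodule.smul_mono_left h)] at h2
end Final

theorem stmt17 {R : Type u} [CommRing R] [IsNoetherianRing R]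
    (a : Ideal R) (M : Type u) [AddCommGroup M] [Module R M] [Module.Finite R M]
    (hM : a • (⊤ : Submodule R M) ≠ ⊤) (rs : List R)
    (hsop : ∃ rs' : List R, rs <+: rs' ∧ IsRelSOP a M rs')
    (hreg : RingTheory.Sequence.IsRegular M rs) :
    (IsRelCM a M ↔
      IsRelCM a (M ⧸ ((Ideal.span {x | x ∈ rs}) • (⊤ : Submodule R M)))) ∧
    (IsRelCM a M ↔
      IsRelCM (a.map (Ideal.Quotient.mk (Ideal.span {x | x ∈ rs})))
        (M ⧸ ((Ideal.span {x | x ∈ rs}) • (⊤ : Submodule R M)))) := by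
  have hle : Ideal.span {x | x ∈ rs} ≤ a := by
    obtain ⟨rs', ⟨ys, rfl⟩, hc, hmem, hrad⟩ := hsop
    exact Ideal.span_le.2 fun x hx => hmem x (List.mem_append_left _ hx)
  have hmain := main_aux a M rs hsop hreg.toIsWeaklyRegular
  have hne := smul_top_ne a _ hle M hM
  have hne' : (a.map (Ideal.Quotient.mk (Ideal.span {x | x ∈ rs}))) •
      (⊤ : Submodule (R ⧸ Ideal.span {x | x ∈ rs})
        (M ⧸ ((Ideal.span {x | x ∈ rs}) • (⊤ : Submodule R M)))) ≠ ⊤ := by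
    intro h
    apply hne
    have h2 := Ideal.smul_restrictScalars (R := R) (S := R ⧸ Ideal.span {x | x ∈ rs}) a
      (⊤ : Submodule (R ⧸ Ideal.span {x | x ∈ rs})
        (M ⧸ ((Ideal.span {x | x ∈ rs}) • (⊤ : Submodule R M))))
    rw [Submodule.restrictScalars_top] at h2
    rw [← h2]
    have h3 := congrArg (Submodule.restrictScalars R) h
    rw [Submodule.restrictScalars_top] at h3
    exact h3
  have e1 : IsRelCM a M ↔ ∃ m, ¬ LV a m M ∧ ∀ i ≠ m, LV a i M := by
    rw [← CM_iff]
    simp only [IsRelCM, hM, false_or, ne_eq, not_false_eq_true, true_and]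
  have e2 : IsRelCM a (M ⧸ ((Ideal.span {x | x ∈ rs}) • (⊤ : Submodule R M))) ↔
      ∃ m, ¬ LV a m (M ⧸ ((Ideal.span {x | x ∈ rs}) • (⊤ : Submodule R M))) ∧
      ∀ i ≠ m, LV a i (M ⧸ ((Ideal.span {x | x ∈ rs}) • (⊤ : Submodule R M))) := by
    rw [← CM_iff]
    simp only [IsRelCM, hne, false_or, ne_eq, not_false_eq_true, true_and]
  have hBC : ∀ i, LV a i (M ⧸ ((Ideal.span {x | x ∈ rs}) • (⊤ : Submodule R M))) ↔
      LV (a.map (Ideal.Quotient.mk (Ideal.span {x | x ∈ rs}))) i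
        (M ⧸ ((Ideal.span {x | x ∈ rs}) • (⊤ : Submodule R M))) := fun i =>
    LV_BC (R' := R ⧸ Ideal.span {x | x ∈ rs}) a i _
  have e3 : IsRelCM (a.map (Ideal.Quotient.mk (Ideal.span {x | x ∈ rs})))
        (M ⧸ ((Ideal.span {x | x ∈ rs}) • (⊤ : Submodule R M))) ↔
      ∃ m, ¬ LV a m (M ⧸ ((Ideal.span {x | x ∈ rs}) • (⊤ : Submodule R M))) ∧
      ∀ i ≠ m, LV a i (M ⧸ ((Ideal.span {x | x ∈ rs}) • (⊤ : Submodule R M))) := by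
    simp only [hBC]
    rw [← CM_iff]
    simp only [IsRelCM, hne', false_or, ne_eq, not_false_eq_true, true_and]
  rw [e1, e2, e3]
  exact ⟨hmain, hmain⟩

end
end
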